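/- arXiv:2509.17578 — 5 statements merged into one kernel-verified Lean document; each statement's English description precedes it below -/
import Mathlib

section
/- (Zygmund type theorem for harmonic (K,K')-quasiregular mappings.) Let K ≥ 1 and K' ≥ 0 and let f = u + iv be a harmonic (K,K')-quasiregular mapping on the unit disk 𝔻 with v(0) = 0. If sup_{0 ≤ r < 1} ∫₀^{2π} |u(r e^{iθ})| log⁺|u(r e^{iθ})| dθ < ∞, where log⁺ x = max{0, log x}, then v ∈ h¹. -/
open Complex MeasureTheory Set

/-- Integral mean `M_p(r,f)` of a function on the unit disk. -/
noncomputable def Mp {E : Type*} [NormedAddCommGroup E] (p r : ℝ) (f : ℂ → E) : ℝ :=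
  ((1 / (2 * Real.pi)) *
    ∫ θ in (0:ℝ)..(2 * Real.pi), ‖f ((r : ℂ) * Complex.exp ((θ : ℂ) * Complex.I))‖ ^ p) ^ (1 / p)

/-- Hardy-type norm `‖f‖_p = sup_{0 ≤ r < 1} M_p(r,f)`. -/
noncomputable def hardyNorm {E : Type*} [NormedAddCommGroup E] (p : ℝ) (f : ℂ → E) : ℝ :=
  sSup ((fun r => Mp p r f) '' Ico (0:ℝ) 1)

/-- Membership in the Hardy-type space `h^p` / `H^p_g`. -/
def MemHp {E : Type*} [NormedAddCommGroup E] (p : ℝ) (f : ℂ → E) : Prop :=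
  BddAbove ((fun r => Mp p r f) '' Ico (0:ℝ) 1)

/-- Differentiation under the integral sign for a jointly continuous derivative. -/
theorem hasDerivAt_intervalIntegral_of_continuousOn {s : Set ℝ} (hs : IsOpen s) {a b : ℝ}
    {p p' : ℝ → ℝ → ℝ} (hp : ∀ t ∈ s, ∀ θ, HasDerivAt (fun t => p t θ) (p' t θ) t)
    (hpc : ContinuousOn (fun q : ℝ × ℝ => p q.1 q.2) (s ×ˢ univ))
    (hpc' : ContinuousOn (fun q : ℝ × ℝ => p' q.1 q.2) (s ×ˢ univ)) {t : ℝ} (ht : t ∈ s) :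
    HasDerivAt (fun t => ∫ θ in a..b, p t θ) (∫ θ in a..b, p' t θ) t := by
  have slice : ∀ {k : ℝ → ℝ → ℝ}, ContinuousOn (fun q : ℝ × ℝ => k q.1 q.2) (s ×ˢ univ) →
      ∀ x ∈ s, Continuous (k x) := fun {k} hk x hx =>
    hk.comp_continuous (f := fun θ : ℝ => (x, θ)) (by fun_prop) (fun θ => ⟨hx, mem_univ θ⟩)
  obtain ⟨ε, hε, hball⟩ := Metric.nhds_basis_closedBall.mem_iff.1 (hs.mem_nhds ht)
  obtain ⟨B, hB⟩ := ((isCompact_closedBall t ε).prod (isCompact_uIcc (a := a) (b := b))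
    ).exists_bound_of_continuousOn (hpc'.mono (prod_mono hball (subset_univ _)))
  refine (intervalIntegral.hasDerivAt_integral_of_dominated_loc_of_deriv_le
    (F := p) (F' := p') (bound := fun _ => B) (Metric.closedBall_mem_nhds t hε) ?_
    ((slice hpc t ht).intervalIntegrable _ _) (slice hpc' t ht).aestronglyMeasurable ?_
    intervalIntegrable_const ?_).2
  · filter_upwards [hs.mem_nhds ht] with x hx using (slice hpc x hx).aestronglyMeasurable
  · exact .of_forall fun θ hθ x hx => hB (x, θ) ⟨hx, uIoc_subset_uIcc hθ⟩
  · exact .of_forall fun θ _ x hx => hp x (hball hx) θ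

/-- The integral over a period of a function with nonnegative Laplacian is convex in the
remaining variable. -/
theorem convexOn_intervalIntegral_of_laplacian_nonneg {s : Set ℝ} (hs : IsOpen s)
    (hsc : Convex ℝ s) {a b : ℝ} (hab : a ≤ b) {T T₁ T₁₁ T₂ T₂₂ : ℝ → ℝ → ℝ}
    (hT₁ : ∀ t ∈ s, ∀ θ, HasDerivAt (fun t => T t θ) (T₁ t θ) t)
    (hT₁₁ : ∀ t ∈ s, ∀ θ, HasDerivAt (fun t => T₁ t θ) (T₁₁ t θ) t)
    (hT₂₂ : ∀ t ∈ s, ∀ θ, HasDerivAt (T₂ t) (T₂₂ t θ) θ)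
    (hTc : ContinuousOn (fun q : ℝ × ℝ => T q.1 q.2) (s ×ˢ univ))
    (hTc₁ : ContinuousOn (fun q : ℝ × ℝ => T₁ q.1 q.2) (s ×ˢ univ))
    (hTc₁₁ : ContinuousOn (fun q : ℝ × ℝ => T₁₁ q.1 q.2) (s ×ˢ univ))
    (hTc₂₂ : ContinuousOn (fun q : ℝ × ℝ => T₂₂ q.1 q.2) (s ×ˢ univ))
    (hper : ∀ t ∈ s, T₂ t a = T₂ t b)
    (hlap : ∀ t ∈ s, ∀ θ, 0 ≤ T₁₁ t θ + T₂₂ t θ) :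
    ConvexOn ℝ s (fun t => ∫ θ in a..b, T t θ) := by
  have slice : ∀ {k : ℝ → ℝ → ℝ}, ContinuousOn (fun q : ℝ × ℝ => k q.1 q.2) (s ×ˢ univ) →
      ∀ x ∈ s, IntervalIntegrable (k x) volume a b := fun {k} hk x hx =>
    (hk.comp_continuous (f := fun θ : ℝ => (x, θ)) (by fun_prop)
      (fun θ => ⟨hx, mem_univ θ⟩)).intervalIntegrable _ _
  have h1 : ∀ t ∈ s, HasDerivAt (fun t => ∫ θ in a..b, T t θ) (∫ θ in a..b, T₁ t θ) t :=
    fun t ht => hasDerivAt_intervalIntegral_of_continuousOn hs hT₁ hTc hTc₁ ht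
  have h2 : ∀ t ∈ s, HasDerivAt (fun t => ∫ θ in a..b, T₁ t θ) (∫ θ in a..b, T₁₁ t θ) t :=
    fun t ht => hasDerivAt_intervalIntegral_of_continuousOn hs hT₁₁ hTc₁ hTc₁₁ ht
  refine convexOn_of_hasDerivWithinAt2_nonneg hsc
    (f' := fun t => ∫ θ in a..b, T₁ t θ) (f'' := fun t => ∫ θ in a..b, T₁₁ t θ)
    (fun t ht => (h1 t ht).continuousAt.continuousWithinAt) ?_ ?_ ?_ <;> rw [hs.interior_eq]
  · exact fun t ht => (h1 t ht).hasDerivWithinAt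
  · exact fun t ht => (h2 t ht).hasDerivWithinAt
  · intro t ht
    have h0 : ∫ θ in a..b, T₂₂ t θ = 0 := by
      rw [intervalIntegral.integral_eq_sub_of_hasDerivAt (fun θ _ => hT₂₂ t ht θ)
        (slice hTc₂₂ t ht), hper t ht, sub_self]
    calc (0 : ℝ) ≤ ∫ θ in a..b, (T₁₁ t θ + T₂₂ t θ) :=
          intervalIntegral.integral_nonneg hab fun θ _ => hlap t ht θ
      _ = ∫ θ in a..b, T₁₁ t θ := by
          rw [intervalIntegral.integral_add (slice hTc₁₁ t ht) (slice hTc₂₂ t ht), h0, add_zero]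

/-- A convex function on `(-∞, 0)` bounded above near `-∞` is nondecreasing. -/
theorem ConvexOn.le_of_bddAbove_left {M : ℝ → ℝ} (hM : ConvexOn ℝ (Iio 0) M) {a B t : ℝ}
    (hB : ∀ s ≤ a, M s ≤ B) (hat : a < t) (ht : t < 0) : M a ≤ M t := by
  by_contra! hlt
  have hpos : 0 < M a - M t := sub_pos.2 hlt
  set s := a - (B + 1 - M a) * (t - a) / (M a - M t) with hs
  have hMaB : M a ≤ B := hB a le_rfl
  have hsa : s < a := by
    have : 0 < (B + 1 - M a) * (t - a) / (M a - M t) :=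
      div_pos (mul_pos (by linarith) (sub_pos.2 hat)) hpos
    linarith
  have h1 := hM.slope_mono_adjacent (mem_Iio.2 (by linarith)) (mem_Iio.2 ht) hsa hat
  have hsa' : a - s = (B + 1 - M a) * (t - a) / (M a - M t) := by rw [hs]; ring
  rw [div_le_div_iff₀ (sub_pos.2 hsa) (sub_pos.2 hat), hsa', mul_div_assoc'] at h1
  have h2 : (M t - M a) * ((B + 1 - M a) * (t - a)) / (M a - M t) =
      -((B + 1 - M a) * (t - a)) := by
    field_simp
    ring
  rw [h2] at h1
  have h3 := hB s hsa.le
  nlinarith [sub_pos.2 hat]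

/-- The composite `c (Φ(x) + e) - √(1 + x² + y²)`, where `Φ'' = (1 + x²)^(-1/2)`. -/
noncomputable def zygmundAux (c x y e : ℝ) : ℝ :=
  c * (x * Real.arsinh x - √(1 + x ^ 2) + e) - √(1 + x ^ 2 + y ^ 2)

/-- First derivative of `zygmundAux` along a curve with velocity `(x₁, y₁, e₁)`. -/
noncomputable def zygmundAux₁ (c x y x₁ y₁ e₁ : ℝ) : ℝ :=
  c * (Real.arsinh x * x₁ + e₁) - (x * x₁ + y * y₁) / √(1 + x ^ 2 + y ^ 2)

/-- Second derivative of `zygmundAux` along a curve with velocity `(x₁, y₁, e₁)` and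
acceleration `(x₂, y₂, e₂)`. -/
noncomputable def zygmundAux₂ (c x y x₁ y₁ x₂ y₂ e₂ : ℝ) : ℝ :=
  c * (x₁ ^ 2 / √(1 + x ^ 2) + Real.arsinh x * x₂ + e₂) -
    ((x₁ ^ 2 + x * x₂ + y₁ ^ 2 + y * y₂) / √(1 + x ^ 2 + y ^ 2) -
      (x * x₁ + y * y₁) ^ 2 / √(1 + x ^ 2 + y ^ 2) ^ 3)

theorem hasDerivAt_zygmundAux (c : ℝ) {x y e : ℝ → ℝ} {x₁ y₁ e₁ s : ℝ} (hx : HasDerivAt x x₁ s)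
    (hy : HasDerivAt y y₁ s) (he : HasDerivAt e e₁ s) :
    HasDerivAt (fun s => zygmundAux c (x s) (y s) (e s))
      (zygmundAux₁ c (x s) (y s) x₁ y₁ e₁) s := by
  have hR : 0 < 1 + x s ^ 2 := by positivity
  have hW : 0 < 1 + x s ^ 2 + y s ^ 2 := by positivity
  have h := ((((hx.mul hx.arsinh).sub (((hx.pow 2).const_add 1).sqrt hR.ne')).add he).const_mul
    c).sub ((((hx.pow 2).const_add 1).add (hy.pow 2)).sqrt hW.ne')
  refine h.congr_deriv ?_
  have hR' := (Real.sqrt_pos.2 hR).ne'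
  have hW' := (Real.sqrt_pos.2 hW).ne'
  simp only [zygmundAux₁, smul_eq_mul, Pi.add_apply, Pi.pow_apply]
  field_simp
  ring

theorem hasDerivAt_zygmundAux₁ (c : ℝ) {x y x₁ y₁ e₁ : ℝ → ℝ} {x₂ y₂ e₂ s : ℝ}
    (hx : HasDerivAt x (x₁ s) s) (hy : HasDerivAt y (y₁ s) s)
    (hx₁ : HasDerivAt x₁ x₂ s) (hy₁ : HasDerivAt y₁ y₂ s) (he₁ : HasDerivAt e₁ e₂ s) :
    HasDerivAt (fun s => zygmundAux₁ c (x s) (y s) (x₁ s) (y₁ s) (e₁ s))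
      (zygmundAux₂ c (x s) (y s) (x₁ s) (y₁ s) x₂ y₂ e₂) s := by
  have hR : 0 < 1 + x s ^ 2 := by positivity
  have hW : 0 < 1 + x s ^ 2 + y s ^ 2 := by positivity
  have hR' := (Real.sqrt_pos.2 hR).ne'
  have hW' := (Real.sqrt_pos.2 hW).ne'
  have h := (((hx.arsinh.mul hx₁).add he₁).const_mul c).sub
    (((hx.mul hx₁).add (hy.mul hy₁)).div
      ((((hx.pow 2).const_add 1).add (hy.pow 2)).sqrt hW.ne') hW')
  refine h.congr_deriv ?_
  simp only [zygmundAux₂, smul_eq_mul, Pi.add_apply, Pi.pow_apply, Pi.mul_apply]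
  field_simp
  ring

/-- Laplacian estimate for `zygmundAux` along a pair of holomorphic functions with first
derivatives `p`, `q` and second derivatives `p₂`, `q₂`. -/
theorem zygmundAux_laplacian_nonneg {c x y ε : ℝ} {p q : ℂ} (p₂ q₂ : ℂ) (hε : 0 ≤ ε) (hc : 0 ≤ c)
    (hpq : ‖p‖ ^ 2 + ‖q‖ ^ 2 ≤ c * (‖p‖ ^ 2 + ε)) :
    0 ≤ zygmundAux₂ c x y p.re q.im p₂.re q₂.im ε +
      zygmundAux₂ c x y (-p.im) q.re (-p₂.re) (-q₂.im) 0 := by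
  have hR1 : 1 ≤ √(1 + x ^ 2) := Real.one_le_sqrt.2 (by nlinarith)
  have hRW : √(1 + x ^ 2) ≤ √(1 + x ^ 2 + y ^ 2) := Real.sqrt_le_sqrt (by nlinarith)
  set R := √(1 + x ^ 2)
  set W := √(1 + x ^ 2 + y ^ 2)
  have hR0 : 0 < R := by linarith
  have hW0 : 0 < W := by linarith
  have hp : ‖p‖ ^ 2 = p.re ^ 2 + p.im ^ 2 := by rw [Complex.sq_norm, Complex.normSq_apply]; ring
  have hq : ‖q‖ ^ 2 = q.re ^ 2 + q.im ^ 2 := by rw [Complex.sq_norm, Complex.normSq_apply]; ring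
  have h1 : (‖p‖ ^ 2 + ‖q‖ ^ 2) / W ≤ c * (‖p‖ ^ 2 / R + ε) := calc
    (‖p‖ ^ 2 + ‖q‖ ^ 2) / W ≤ (‖p‖ ^ 2 + ‖q‖ ^ 2) / R := by gcongr
    _ ≤ c * (‖p‖ ^ 2 + ε) / R := by gcongr
    _ = c * (‖p‖ ^ 2 / R + ε / R) := by ring
    _ ≤ c * (‖p‖ ^ 2 / R + ε) := by gcongr; exact div_le_self hε hR1
  have h2 : 0 ≤ (x * p.re + y * q.im) ^ 2 / W ^ 3 + (x * (-p.im) + y * q.re) ^ 2 / W ^ 3 := by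
    positivity
  have h3 : zygmundAux₂ c x y p.re q.im p₂.re q₂.im ε +
      zygmundAux₂ c x y (-p.im) q.re (-p₂.re) (-q₂.im) 0 =
      c * (‖p‖ ^ 2 / R + ε) - (‖p‖ ^ 2 + ‖q‖ ^ 2) / W +
      ((x * p.re + y * q.im) ^ 2 / W ^ 3 + (x * (-p.im) + y * q.re) ^ 2 / W ^ 3) := by
    rw [hp, hq]
    simp only [zygmundAux₂]
    ring
  linarith

/-- The `L log L` majorant of `x * arsinh x`. -/
theorem Real.mul_arsinh_le (x : ℝ) :
    x * Real.arsinh x ≤ 6 + 3 * (|x| * max 0 (Real.log |x|)) := by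
  have habs : x * Real.arsinh x = |x| * Real.arsinh |x| := by
    rcases abs_cases x with ⟨h, -⟩ | ⟨h, -⟩ <;> rw [h]
    rw [Real.arsinh_neg]
    ring
  rw [habs]
  generalize |x| = a, abs_nonneg x = ha
  have hsqrt : √(1 + a ^ 2) ≤ 1 + a := Real.sqrt_le_iff.2 ⟨by linarith, by nlinarith⟩
  have hpos : 0 < a + √(1 + a ^ 2) := by positivity
  have hlog3 : Real.log 3 ≤ 2 := by
    have := Real.log_le_sub_one_of_pos (show (0 : ℝ) < 3 by norm_num)
    linarith
  have hars : Real.arsinh a ≤ 2 + max 0 (Real.log a) := by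
    rw [Real.arsinh]
    rcases le_total a 1 with h | h
    · have := Real.log_le_log hpos (show a + √(1 + a ^ 2) ≤ 3 by linarith)
      linarith [le_max_left 0 (Real.log a)]
    · have h4 := Real.log_le_log hpos (show a + √(1 + a ^ 2) ≤ 3 * a by linarith)
      rw [Real.log_mul (by norm_num) (by linarith)] at h4
      linarith [le_max_right 0 (Real.log a)]
  have ha3 : a ≤ 3 + a * max 0 (Real.log a) := by
    rcases le_total a 3 with h | h
    · have : 0 ≤ a * max 0 (Real.log a) := by positivity
      linarith
    · have h1 : 1 ≤ Real.log a := by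
        rw [Real.le_log_iff_exp_le (by linarith)]
        linarith [Real.exp_one_lt_d9]
      nlinarith [le_max_right 0 (Real.log a)]
  nlinarith [mul_le_mul_of_nonneg_left hars ha]

/-- Logarithmic polar coordinates: convexity of circle integrals of `zygmundAux` in `log r`. -/
theorem convexOn_circle_zygmundAux {F G : ℂ → ℂ} {c : ℝ} (hc : 0 ≤ c)
    (hF : DifferentiableOn ℂ F (Metric.ball 0 1)) (hG : DifferentiableOn ℂ G (Metric.ball 0 1))
    (hFG : ∀ z ∈ Metric.ball (0 : ℂ) 1,
      ‖deriv F z‖ ^ 2 + ‖deriv G z‖ ^ 2 ≤ c * (‖deriv F z‖ ^ 2 + 4)) :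
    ConvexOn ℝ (Iio 0) (fun t : ℝ => ∫ θ in (0 : ℝ)..(2 * Real.pi),
      zygmundAux c (F (exp (t + θ * I))).re (G (exp (t + θ * I))).im (Real.exp (2 * t))) := by
  have hmem : ∀ t : ℝ, t ∈ Iio (0 : ℝ) → ∀ θ : ℝ, exp (t + θ * I) ∈ Metric.ball (0 : ℂ) 1 := by
    intro t ht θ
    simpa [Complex.norm_exp] using ht
  have hdt : ∀ t θ : ℝ, HasDerivAt (fun t : ℝ => exp (t + θ * I)) (exp (t + θ * I)) t := by
    intro t θ
    simpa using ((Complex.ofRealCLM.hasDerivAt (x := t)).add_const (θ * I)).cexp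
  have hdθ : ∀ t θ : ℝ, HasDerivAt (fun θ : ℝ => exp (t + θ * I)) (exp (t + θ * I) * I) θ := by
    intro t θ
    simpa using (((Complex.ofRealCLM.hasDerivAt (x := θ)).mul_const I).const_add (t : ℂ)).cexp
  have compt : ∀ {k : ℂ → ℂ}, DifferentiableOn ℂ k (Metric.ball 0 1) → ∀ t ∈ Iio (0 : ℝ),
      ∀ θ : ℝ, HasDerivAt (fun t : ℝ => k (exp (t + θ * I)))
        (deriv k (exp (t + θ * I)) * exp (t + θ * I)) t := fun hk t ht θ =>
    (hk.differentiableAt (Metric.isOpen_ball.mem_nhds (hmem t ht θ))).hasDerivAt.comp t (hdt t θ)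
  have compθ : ∀ {k : ℂ → ℂ}, DifferentiableOn ℂ k (Metric.ball 0 1) → ∀ t ∈ Iio (0 : ℝ),
      ∀ θ : ℝ, HasDerivAt (fun θ : ℝ => k (exp (t + θ * I)))
        (deriv k (exp (t + θ * I)) * (exp (t + θ * I) * I)) θ := fun hk t ht θ =>
    (hk.differentiableAt (Metric.isOpen_ball.mem_nhds (hmem t ht θ))).hasDerivAt.comp θ (hdθ t θ)
  have hre : ∀ {k : ℝ → ℂ} {k' : ℂ} {s : ℝ}, HasDerivAt k k' s →
      HasDerivAt (fun s => (k s).re) k'.re s := fun hk => reCLM.hasFDerivAt.comp_hasDerivAt _ hk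
  have him : ∀ {k : ℝ → ℂ} {k' : ℂ} {s : ℝ}, HasDerivAt k k' s →
      HasDerivAt (fun s => (k s).im) k'.im s := fun hk => imCLM.hasFDerivAt.comp_hasDerivAt _ hk
  set F₁ : ℂ → ℂ := fun z => deriv F z * z with hF₁
  set G₁ : ℂ → ℂ := fun z => deriv G z * z with hG₁
  set F₂ : ℂ → ℂ := fun z => deriv F₁ z * z with hF₂
  set G₂ : ℂ → ℂ := fun z => deriv G₁ z * z with hG₂
  have dF₁ : DifferentiableOn ℂ F₁ (Metric.ball 0 1) :=
    (hF.deriv Metric.isOpen_ball).mul differentiableOn_id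
  have dG₁ : DifferentiableOn ℂ G₁ (Metric.ball 0 1) :=
    (hG.deriv Metric.isOpen_ball).mul differentiableOn_id
  have dF₂ : DifferentiableOn ℂ F₂ (Metric.ball 0 1) :=
    (dF₁.deriv Metric.isOpen_ball).mul differentiableOn_id
  have dG₂ : DifferentiableOn ℂ G₂ (Metric.ball 0 1) :=
    (dG₁.deriv Metric.isOpen_ball).mul differentiableOn_id
  have cont : ∀ {k : ℂ → ℂ}, DifferentiableOn ℂ k (Metric.ball 0 1) →
      ContinuousOn (fun q : ℝ × ℝ => k (exp (q.1 + q.2 * I))) (Iio 0 ×ˢ univ) := fun hk =>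
    hk.continuousOn.comp (by fun_prop) fun q hq => hmem q.1 hq.1 q.2
  have cre : ∀ {k : ℂ → ℂ}, DifferentiableOn ℂ k (Metric.ball 0 1) →
      ContinuousOn (fun q : ℝ × ℝ => (k (exp (q.1 + q.2 * I))).re) (Iio 0 ×ˢ univ) := fun hk =>
    continuous_re.comp_continuousOn (cont hk)
  have cim : ∀ {k : ℂ → ℂ}, DifferentiableOn ℂ k (Metric.ball 0 1) →
      ContinuousOn (fun q : ℝ × ℝ => (k (exp (q.1 + q.2 * I))).im) (Iio 0 ×ˢ univ) := fun hk =>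
    continuous_im.comp_continuousOn (cont hk)
  have cars : ContinuousOn (fun q : ℝ × ℝ => Real.arsinh (F (exp (q.1 + q.2 * I))).re)
      (Iio 0 ×ˢ univ) := Real.continuous_arsinh.comp_continuousOn (cre hF)
  have he : ∀ t : ℝ, HasDerivAt (fun t => Real.exp (2 * t)) (2 * Real.exp (2 * t)) t := fun t => by
    simpa [mul_comm] using ((hasDerivAt_id t).const_mul 2).exp
  have he₁ : ∀ t : ℝ, HasDerivAt (fun t => 2 * Real.exp (2 * t)) (4 * Real.exp (2 * t)) t :=
    fun t => ((he t).const_mul 2).congr_deriv (by ring)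
  have mulI_re : ∀ z w : ℂ, (z * (w * I)).re = -(z * w).im := fun z w => by
    rw [← mul_assoc, mul_I_re]
  have mulI_im : ∀ z w : ℂ, (z * (w * I)).im = (z * w).re := fun z w => by
    rw [← mul_assoc, mul_I_im]
  have hR : ∀ x : ℝ, √(1 + x ^ 2) ≠ 0 := fun x => (Real.sqrt_pos.2 (by positivity)).ne'
  have hW : ∀ x y : ℝ, √(1 + x ^ 2 + y ^ 2) ≠ 0 := fun x y =>
    (Real.sqrt_pos.2 (by positivity)).ne'
  refine convexOn_intervalIntegral_of_laplacian_nonneg isOpen_Iio (convex_Iio 0)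
    (by positivity)
    (T₁ := fun t θ => zygmundAux₁ c (F (exp (t + θ * I))).re (G (exp (t + θ * I))).im
      (F₁ (exp (t + θ * I))).re (G₁ (exp (t + θ * I))).im (2 * Real.exp (2 * t)))
    (T₁₁ := fun t θ => zygmundAux₂ c (F (exp (t + θ * I))).re (G (exp (t + θ * I))).im
      (F₁ (exp (t + θ * I))).re (G₁ (exp (t + θ * I))).im
      (F₂ (exp (t + θ * I))).re (G₂ (exp (t + θ * I))).im (4 * Real.exp (2 * t)))
    (T₂ := fun t θ => zygmundAux₁ c (F (exp (t + θ * I))).re (G (exp (t + θ * I))).im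
      (-(F₁ (exp (t + θ * I))).im) (G₁ (exp (t + θ * I))).re 0)
    (T₂₂ := fun t θ => zygmundAux₂ c (F (exp (t + θ * I))).re (G (exp (t + θ * I))).im
      (-(F₁ (exp (t + θ * I))).im) (G₁ (exp (t + θ * I))).re
      (-(F₂ (exp (t + θ * I))).re) (-(G₂ (exp (t + θ * I))).im) 0)
    ?_ ?_ ?_ ?_ ?_ ?_ ?_ ?_ ?_
  · exact fun t ht θ =>
      hasDerivAt_zygmundAux c (hre (compt hF t ht θ)) (him (compt hG t ht θ)) (he t)
  · exact fun t ht θ =>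
      hasDerivAt_zygmundAux₁ c (hre (compt hF t ht θ)) (him (compt hG t ht θ))
        (hre (compt dF₁ t ht θ)) (him (compt dG₁ t ht θ)) (he₁ t)
  · intro t ht θ
    exact hasDerivAt_zygmundAux₁ c
      ((hre (compθ hF t ht θ)).congr_deriv (mulI_re _ _))
      ((him (compθ hG t ht θ)).congr_deriv (mulI_im _ _))
      ((him (compθ dF₁ t ht θ)).neg.congr_deriv (by rw [mulI_im]))
      ((hre (compθ dG₁ t ht θ)).congr_deriv (mulI_re _ _)) (hasDerivAt_const θ 0)
  · have := cre hF; have := cim hG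
    unfold zygmundAux
    fun_prop
  · have := cre hF; have := cim hG; have := cre dF₁; have := cim dG₁
    unfold zygmundAux₁
    fun_prop (disch := simp [hW])
  · have := cre hF; have := cim hG; have := cre dF₁; have := cim dG₁
    have := cre dF₂; have := cim dG₂
    unfold zygmundAux₂
    fun_prop (disch := simp [hW, hR])
  · have := cre hF; have := cim hG; have := cim dF₁; have := cre dG₁
    have := cre dF₂; have := cim dG₂
    unfold zygmundAux₂
    fun_prop (disch := simp [hW, hR])
  · intro t _
    have : exp (t + ((2 * Real.pi : ℝ) : ℂ) * I) = exp (t + ((0 : ℝ) : ℂ) * I) := by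
      push_cast
      rw [exp_add, exp_two_pi_mul_I]
      simp
    simp only [this]
  · intro t ht θ
    refine zygmundAux_laplacian_nonneg _ _ (by positivity) hc ?_
    have hn : ‖exp (t + θ * I)‖ = Real.exp t := by simp [Complex.norm_exp]
    have h2 : Real.exp (2 * t) = Real.exp t ^ 2 := by rw [← Real.exp_nat_mul]; norm_num
    simp only [hF₁, hG₁, norm_mul, hn, h2]
    nlinarith [mul_le_mul_of_nonneg_right (hFG _ (hmem t ht θ)) (sq_nonneg (Real.exp t))]

/-- Quantitative Zygmund estimate: the circle integrals of `|Im G|` are controlled by the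
`L log L` integrals of `Re F` whenever `|G'|² ≲ |F'|² + 1`. -/
theorem exists_bound_integral_abs_im {F G : ℂ → ℂ} {c M : ℝ} (hc : 0 ≤ c)
    (hF : DifferentiableOn ℂ F (Metric.ball 0 1)) (hG : DifferentiableOn ℂ G (Metric.ball 0 1))
    (hFG : ∀ z ∈ Metric.ball (0 : ℂ) 1,
      ‖deriv F z‖ ^ 2 + ‖deriv G z‖ ^ 2 ≤ c * (‖deriv F z‖ ^ 2 + 4))
    (hM : ∀ r : ℝ, 0 ≤ r → r < 1 → ∫ θ in (0 : ℝ)..(2 * Real.pi),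
      |(F (r * exp (θ * I))).re| * max 0 (Real.log |(F (r * exp (θ * I))).re|) ≤ M) :
    ∃ N : ℝ, ∀ r : ℝ, 0 ≤ r → r < 1 →
      ∫ θ in (0 : ℝ)..(2 * Real.pi), |(G (r * exp (θ * I))).im| ≤ N := by
  have hpi : (0 : ℝ) ≤ 2 * Real.pi := by positivity
  have hmem : ∀ r : ℝ, 0 ≤ r → ∀ θ : ℝ, ‖(r : ℂ) * exp (θ * I)‖ = r := fun r hr θ => by
    rw [norm_mul, norm_exp_ofReal_mul_I, mul_one, norm_real, Real.norm_of_nonneg hr]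
  have hball : ∀ r : ℝ, 0 ≤ r → r < 1 → ∀ θ : ℝ, (r : ℂ) * exp (θ * I) ∈ Metric.ball (0 : ℂ) 1 :=
    fun r hr hr1 θ => by rwa [mem_ball_zero_iff, hmem r hr]
  have hcirc : ∀ {k : ℂ → ℂ}, DifferentiableOn ℂ k (Metric.ball 0 1) → ∀ r : ℝ, 0 ≤ r → r < 1 →
      Continuous fun θ : ℝ => k (r * exp (θ * I)) := fun hk r hr hr1 =>
    hk.continuousOn.comp_continuous (by fun_prop) (hball r hr hr1)
  have hcre : ∀ r : ℝ, 0 ≤ r → r < 1 → Continuous fun θ : ℝ => (F (r * exp (θ * I))).re :=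
    fun r hr hr1 => continuous_re.comp (hcirc hF r hr hr1)
  have hcim : ∀ r : ℝ, 0 ≤ r → r < 1 → Continuous fun θ : ℝ => (G (r * exp (θ * I))).im :=
    fun r hr hr1 => continuous_im.comp (hcirc hG r hr hr1)
  set S : ℂ → ℝ := fun z => zygmundAux c (F z).re (G z).im (‖z‖ ^ 2) with hS
  have hScirc : ∀ r : ℝ, 0 ≤ r → r < 1 → Continuous fun θ : ℝ => S (r * exp (θ * I)) := by
    intro r hr hr1
    have := hcre r hr hr1
    have := hcim r hr hr1
    have := Real.continuous_arsinh.comp (hcre r hr hr1)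
    simp only [Function.comp_def] at this
    simp only [hS, zygmundAux]
    fun_prop
  have hr₀ : Real.exp (-1) < 1 := by simp
  obtain ⟨B, hB⟩ : ∃ B, ∀ z ∈ Metric.closedBall (0 : ℂ) (Real.exp (-1)), ‖S z‖ ≤ B := by
    refine (isCompact_closedBall _ _).exists_bound_of_continuousOn ?_
    have h1 := continuous_re.comp_continuousOn
      (hF.continuousOn.mono (Metric.closedBall_subset_ball hr₀))
    have h2 := continuous_im.comp_continuousOn
      (hG.continuousOn.mono (Metric.closedBall_subset_ball hr₀))
    have h3 := Real.continuous_arsinh.comp_continuousOn h1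
    simp only [hS, zygmundAux]
    simp only [Function.comp_def] at h1 h2 h3
    fun_prop
  set A : ℝ → ℝ := fun r => ∫ θ in (0 : ℝ)..(2 * Real.pi), S (r * exp (θ * I)) with hA
  have hAsmall : ∀ r : ℝ, 0 ≤ r → r ≤ Real.exp (-1) → |A r| ≤ B * (2 * Real.pi) := by
    intro r hr hr1
    have := intervalIntegral.norm_integral_le_of_norm_le_const (a := 0) (b := 2 * Real.pi)
      (f := fun θ : ℝ => S (r * exp (θ * I))) (C := B)
      fun θ _ => hB _ (by rwa [mem_closedBall_zero_iff, hmem r hr])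
    rwa [sub_zero, abs_of_nonneg hpi] at this
  have hconv : ConvexOn ℝ (Iio 0) (fun t : ℝ => A (Real.exp t)) := by
    refine (convexOn_circle_zygmundAux hc hF hG hFG).congr fun t _ => ?_
    refine intervalIntegral.integral_congr fun θ _ => ?_
    have h2 : Real.exp (2 * t) = Real.exp t ^ 2 := by rw [← Real.exp_nat_mul]; norm_num
    simp only [hS]
    rw [hmem _ (Real.exp_pos t).le, h2, exp_add, ofReal_exp]
  have hAlow : ∀ r : ℝ, 0 ≤ r → r < 1 → -(B * (2 * Real.pi)) ≤ A r := by
    intro r hr hr1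
    rcases le_or_gt r (Real.exp (-1)) with h | h
    · exact neg_le_of_abs_le (hAsmall r hr h)
    · have hr0 : 0 < r := (Real.exp_pos _).trans h
      have := hconv.le_of_bddAbove_left (a := -1) (B := B * (2 * Real.pi)) (t := Real.log r)
        (fun s hs => le_of_abs_le
          (hAsmall _ (Real.exp_pos s).le (Real.exp_le_exp.2 hs)))
        ((Real.lt_log_iff_exp_lt hr0).2 h) (Real.log_neg hr0 hr1)
      simp only [Real.exp_log hr0] at this
      exact (neg_le_of_abs_le (hAsmall _ (Real.exp_pos _).le le_rfl)).trans this
  have hpt : ∀ r : ℝ, 0 ≤ r → r < 1 → ∀ θ : ℝ, |(G (r * exp (θ * I))).im| ≤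
      c * 7 + c * 3 * (|(F (r * exp (θ * I))).re| *
        max 0 (Real.log |(F (r * exp (θ * I))).re|)) - S (r * exp (θ * I)) := by
    intro r hr hr1 θ
    simp only [hS, zygmundAux]
    rw [hmem r hr]
    generalize (F (r * exp (θ * I))).re = x
    generalize (G (r * exp (θ * I))).im = y
    have h1 : |y| ≤ √(1 + x ^ 2 + y ^ 2) := Real.abs_le_sqrt (by nlinarith [sq_nonneg x])
    have h2 : x * Real.arsinh x - √(1 + x ^ 2) + r ^ 2 ≤
        7 + 3 * (|x| * max 0 (Real.log |x|)) := by
      nlinarith [Real.mul_arsinh_le x, Real.sqrt_nonneg (1 + x ^ 2)]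
    nlinarith [mul_le_mul_of_nonneg_left h2 hc]
  refine ⟨c * 7 * (2 * Real.pi) + c * 3 * M + B * (2 * Real.pi), fun r hr hr1 => ?_⟩
  have hL : Continuous fun θ : ℝ => |(F (r * exp (θ * I))).re| *
      max 0 (Real.log |(F (r * exp (θ * I))).re|) := by
    have h := (continuous_const (y := (0 : ℝ))).max
      (Real.continuous_mul_log.comp (hcre r hr hr1).abs)
    refine h.congr fun θ => ?_
    simp [mul_max_of_nonneg]
  have hSi := (hScirc r hr hr1).intervalIntegrable (μ := volume) 0 (2 * Real.pi)
  have hLi := (hL.const_mul (c * 3)).intervalIntegrable (μ := volume) 0 (2 * Real.pi)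
  calc ∫ θ in (0 : ℝ)..(2 * Real.pi), |(G (r * exp (θ * I))).im|
      ≤ ∫ θ in (0 : ℝ)..(2 * Real.pi), (c * 7 + c * 3 * (|(F (r * exp (θ * I))).re| *
        max 0 (Real.log |(F (r * exp (θ * I))).re|)) - S (r * exp (θ * I))) :=
        intervalIntegral.integral_mono_on hpi ((hcim r hr hr1).abs.intervalIntegrable _ _)
          ((intervalIntegrable_const.add hLi).sub hSi) fun θ _ => hpt r hr hr1 θ
    _ = c * 7 * (2 * Real.pi) + c * 3 * (∫ θ in (0 : ℝ)..(2 * Real.pi),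
        |(F (r * exp (θ * I))).re| * max 0 (Real.log |(F (r * exp (θ * I))).re|)) - A r := by
        rw [intervalIntegral.integral_sub (intervalIntegrable_const.add hLi) hSi,
          intervalIntegral.integral_add intervalIntegrable_const hLi,
          intervalIntegral.integral_const_mul (c * 3), intervalIntegral.integral_const]
        simp only [hA, smul_eq_mul, sub_zero]
        ring
    _ ≤ c * 7 * (2 * Real.pi) + c * 3 * M + B * (2 * Real.pi) := by
        have := mul_le_mul_of_nonneg_left (hM r hr hr1) (mul_nonneg hc (by norm_num : (0 : ℝ) ≤ 3))
        linarith [hAlow r hr hr1]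

/-- Zygmund type theorem for harmonic (K,K')-quasiregular mappings. -/
theorem zygmund_type_harmonic_KKprime_qr
    (K K' : ℝ) (hK : 1 ≤ K) (hK' : 0 ≤ K')
    (f h g : ℂ → ℂ)
    (hh : DifferentiableOn ℂ h (Metric.ball 0 1))
    (hg : DifferentiableOn ℂ g (Metric.ball 0 1))
    (hg0 : g 0 = 0)
    (hfdec : ∀ z ∈ Metric.ball (0:ℂ) 1, f z = h z + (starRingEnd ℂ) (g z))
    (hqr : ∀ z ∈ Metric.ball (0:ℂ) 1,
      (‖deriv h z‖ + ‖deriv g z‖) ^ 2 ≤ K * (‖deriv h z‖ ^ 2 - ‖deriv g z‖ ^ 2) + K')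
    (hv0 : (f 0).im = 0)
    (hulogu : ∃ M : ℝ, ∀ r : ℝ, 0 ≤ r → r < 1 →
      (∫ θ in (0:ℝ)..(2 * Real.pi),
        |(f ((r : ℂ) * Complex.exp ((θ : ℂ) * Complex.I))).re| *
          max 0 (Real.log |(f ((r : ℂ) * Complex.exp ((θ : ℂ) * Complex.I))).re|)) ≤ M) :
    MemHp 1 (fun z => (f z).im) := by
  obtain ⟨M, hM⟩ := hulogu
  have hball : ∀ r : ℝ, 0 ≤ r → r < 1 → ∀ θ : ℝ, (r : ℂ) * exp (θ * I) ∈ Metric.ball (0 : ℂ) 1 :=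
    fun r hr hr1 θ => by
      rwa [mem_ball_zero_iff, norm_mul, norm_exp_ofReal_mul_I, mul_one, norm_real,
        Real.norm_of_nonneg hr]
  have hre : ∀ z ∈ Metric.ball (0 : ℂ) 1, (f z).re = ((h + g) z).re := fun z hz => by
    simp [hfdec z hz]
  have him : ∀ z ∈ Metric.ball (0 : ℂ) 1, (f z).im = ((h - g) z).im := fun z hz => by
    simp [hfdec z hz, sub_eq_add_neg]
  have hderiv : ∀ z ∈ Metric.ball (0 : ℂ) 1, ‖deriv (h + g) z‖ ^ 2 + ‖deriv (h - g) z‖ ^ 2 ≤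
      (1 + K ^ 2 + 2 * K') * (‖deriv (h + g) z‖ ^ 2 + 4) := by
    intro z hz
    have hhz := hh.differentiableAt (Metric.isOpen_ball.mem_nhds hz)
    have hgz := hg.differentiableAt (Metric.isOpen_ball.mem_nhds hz)
    rw [deriv_add hhz hgz, deriv_sub hhz hgz]
    have h1 := norm_sub_le (deriv h z) (deriv g z)
    have h2 := norm_sub_le_norm_add (deriv h z) (deriv g z)
    have h3 := hqr z hz
    have hP := norm_nonneg (deriv h z + deriv g z)
    have hQ := norm_nonneg (deriv h z - deriv g z)
    set P := ‖deriv h z + deriv g z‖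
    set Q := ‖deriv h z - deriv g z‖
    set L := ‖deriv h z‖ + ‖deriv g z‖
    have hL : 0 ≤ L := by positivity
    have h4 : L ^ 2 ≤ K * (L * P) + K' := by
      refine h3.trans ?_
      have : ‖deriv h z‖ ^ 2 - ‖deriv g z‖ ^ 2 = L * (‖deriv h z‖ - ‖deriv g z‖) := by ring
      rw [this]
      gcongr
    have h5 : Q ^ 2 ≤ L ^ 2 := by gcongr
    have h6 : L ^ 2 ≤ K ^ 2 * P ^ 2 + 2 * K' := by nlinarith [sq_nonneg (L - K * P)]
    nlinarith [mul_nonneg hK' (sq_nonneg P), sq_nonneg K]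
  obtain ⟨N, hN⟩ := exists_bound_integral_abs_im (by positivity) (hh.add hg) (hh.sub hg) hderiv
    (M := M) fun r hr hr1 => by
      simpa only [hre _ (hball r hr hr1 _)] using hM r hr hr1
  refine ⟨1 / (2 * Real.pi) * N, ?_⟩
  rintro _ ⟨r, ⟨hr, hr1⟩, rfl⟩
  simp only [Mp, Real.rpow_one, div_one, Real.norm_eq_abs, him _ (hball r hr hr1 _)]
  exact mul_le_mul_of_nonneg_left (hN r hr hr1) (by positivity)
end

section
/- (Hardy–Littlewood type growth theorem.) Let K ≥ 1, K' ≥ 0, 0 < p < 1, and let f = u + iv be a harmonic (K,K')-quasiregular mapping on the unit disk 𝔻 with v(0) = 0 and u ∈ h^p. Then there exists a constant C > 0 such that M_p(r,v) ≤ C (log(1/(1−r)))^{1/p} for all 1/2 ≤ r < 1. -/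
open Complex MeasureTheory Set

section

open Metric Real

lemma setIntegral_closedBall_add (φ : ℂ → ℝ) (z : ℂ) (R : ℝ) :
    ∫ w in closedBall 0 R, φ (z + w) = ∫ w in closedBall z R, φ w := by
  have := (measurePreserving_add_left (volume : Measure ℂ) z).setIntegral_preimage_emb
    (measurableEmbedding_addLeft z) φ (closedBall z R)
  simpa using this

lemma setIntegral_closedBall_mul_exp (φ : ℂ → ℝ) (a : ℂ) (ρ θ : ℝ) :
    ∫ w in closedBall a ρ, φ (w * Complex.exp (θ * I)) =
      ∫ w in closedBall (a * Complex.exp (θ * I)) ρ, φ w := by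
  have := (rotation (Circle.exp θ)).measurePreserving.setIntegral_preimage_emb
    (rotation (Circle.exp θ)).toHomeomorph.measurableEmbedding φ (closedBall (a * Complex.exp (θ * I)) ρ)
  have h2 : a * Complex.exp (θ * I) = rotation (Circle.exp θ) a := by
    simp [rotation_apply, mul_comm]
  rw [h2, LinearIsometryEquiv.preimage_closedBall, LinearIsometryEquiv.symm_apply_apply] at this
  rw [h2, ← this]
  simp [rotation_apply, mul_comm]

lemma integral_mul_exp_eq_circleAverage (φ : ℂ → ℝ) (w : ℂ) :
    ∫ θ in (0 : ℝ)..2 * π, φ (w * Complex.exp (θ * I)) = 2 * π * circleAverage φ 0 ‖w‖ := by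
  rw [circleAverage_eq_integral_add (Complex.arg w), smul_eq_mul, mul_inv_cancel_left₀ (by positivity)]
  congr! 3 with θ
  rw [circleMap_zero]
  conv_lhs => rw [← norm_mul_exp_arg_mul_I w]
  rw [mul_assoc, ← Complex.exp_add]
  push_cast; ring_nf

lemma integrable_rotation {φ : ℂ → ℝ} {R ρ : ℝ} {a : ℂ} (hφ : ContinuousOn φ (ball 0 R))
    (ha : ‖a‖ + ρ < R) :
    Integrable (fun q : ℝ × ℂ => φ (q.2 * Complex.exp (q.1 * I)))
      ((volume.restrict (Ioc 0 (2 * π))).prod (volume.restrict (closedBall a ρ))) := by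
  rw [Measure.prod_restrict]
  refine IntegrableOn.mono_set (t := Icc 0 (2 * π) ×ˢ closedBall a ρ) ?_
    (prod_mono Ioc_subset_Icc_self subset_rfl)
  refine ContinuousOn.integrableOn_compact (isCompact_Icc.prod (isCompact_closedBall _ _)) ?_
  refine hφ.comp (by fun_prop) ?_
  rintro ⟨θ, w⟩ ⟨-, hw⟩
  have h1 : ‖w‖ ≤ ‖a‖ + ρ := by
    have := norm_le_norm_add_norm_sub a w
    rw [mem_closedBall, dist_eq_norm] at hw
    rw [norm_sub_rev] at this; linarith
  simpa [Complex.norm_exp_ofReal_mul_I] using h1.trans_lt ha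

lemma integral_setIntegral_closedBall_mul_exp {φ : ℂ → ℝ} {R ρ : ℝ} {a : ℂ}
    (hφ : ContinuousOn φ (ball 0 R)) (ha : ‖a‖ + ρ < R) :
    ∫ θ in (0 : ℝ)..2 * π, ∫ w in closedBall (a * Complex.exp (θ * I)) ρ, φ w =
      2 * π * ∫ w in closedBall a ρ, circleAverage φ 0 ‖w‖ := by
  rw [intervalIntegral.integral_of_le (by positivity)]
  simp_rw [← setIntegral_closedBall_mul_exp]
  rw [integral_integral_swap (integrable_rotation hφ ha), ← integral_const_mul]
  simp_rw [← integral_mul_exp_eq_circleAverage, intervalIntegral.integral_of_le two_pi_pos.le]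

lemma intervalIntegrable_setIntegral_closedBall_mul_exp {φ : ℂ → ℝ} {R ρ : ℝ} {a : ℂ}
    (hφ : ContinuousOn φ (ball 0 R)) (ha : ‖a‖ + ρ < R) :
    IntervalIntegrable (fun θ : ℝ => ∫ w in closedBall (a * Complex.exp (θ * I)) ρ, φ w) volume
      0 (2 * π) := by
  rw [intervalIntegrable_iff_integrableOn_Ioc_of_le two_pi_pos.le]
  simp_rw [← setIntegral_closedBall_mul_exp]
  exact (integrable_rotation hφ ha).integral_prod_left

lemma integrableOn_circleAverage {φ : ℂ → ℝ} {R ρ : ℝ} {a : ℂ}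
    (hφ : ContinuousOn φ (ball 0 R)) (ha : ‖a‖ + ρ < R) :
    IntegrableOn (fun w : ℂ => circleAverage φ 0 ‖w‖) (closedBall a ρ) := by
  have := (integrable_rotation hφ ha).integral_prod_right.const_mul (2 * π)⁻¹
  simp_rw [← intervalIntegral.integral_of_le two_pi_pos.le,
    integral_mul_exp_eq_circleAverage] at this
  refine this.congr (ae_of_all _ fun w => ?_)
  field_simp

lemma volume_real_closedBall (a : ℂ) {ρ : ℝ} (hρ : 0 ≤ ρ) :
    volume.real (closedBall a ρ) = π * ρ ^ 2 := by
  simp [Measure.real, Complex.volume_closedBall, hρ, mul_comm]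

lemma abs_re_le_setIntegral_closedBall {F : ℂ → ℂ} {z : ℂ} {R R' : ℝ}
    (hF : DifferentiableOn ℂ F (ball z R')) (hR : 0 ≤ R) (hRR : R < R') :
    π * R ^ 2 * |(F z).re| ≤ ∫ w in closedBall z R, |(F w).re| := by
  have hmap : MapsTo (fun w => z + w) (ball 0 R') (ball z R') := fun w hw => by
    simpa [dist_eq_norm] using hw
  have hG : DifferentiableOn ℂ (fun w => F (z + w)) (ball 0 R') :=
    hF.comp (by fun_prop) hmap
  have hφ : ContinuousOn (fun w => |(F (z + w)).re|) (ball 0 R') :=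
    (continuous_re.comp_continuousOn hG.continuousOn).abs
  have key : ∀ w ∈ closedBall (0 : ℂ) R,
      |(F z).re| ≤ circleAverage (fun w => |(F (z + w)).re|) 0 ‖w‖ := by
    intro w hw
    have hwR : ‖w‖ < R' := (mem_closedBall_zero_iff.1 hw).trans_lt hRR
    have hsub : closedBall (0 : ℂ) ‖w‖ ⊆ ball 0 R' := closedBall_subset_ball hwR
    have h1 : circleAverage (fun w => F (z + w)) 0 ‖w‖ = F z := by
      have := (hG.diffContOnCl_ball (c := 0) (R := |‖w‖|) (by simpa using hsub)).circleAverage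
      simpa using this
    have hci : CircleIntegrable (fun w => F (z + w)) 0 ‖w‖ :=
      (hG.continuousOn.mono ((sphere_subset_closedBall).trans hsub)).circleIntegrable
        (norm_nonneg w)
    have h2 : circleAverage (fun w => (F (z + w)).re) 0 ‖w‖ = (F z).re := by
      rw [← h1]
      exact (reCLM.circleAverage_comp_comm hci)
    rw [← h2]
    exact abs_circleAverage_le_circleAverage_abs
  have h3 := integral_setIntegral_closedBall_mul_exp (a := 0) (ρ := R) hφ (by simpa using hRR)
  have h5 := integrableOn_circleAverage (a := 0) (ρ := R) hφ (by simpa using hRR)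
  simp only [zero_mul] at h3
  rw [intervalIntegral.integral_const, smul_eq_mul, sub_zero] at h3
  have h3' := mul_left_cancel₀ two_pi_pos.ne' h3
  rw [setIntegral_closedBall_add (fun w => |(F w).re|)] at h3'
  rw [h3', ← volume_real_closedBall 0 hR, ← smul_eq_mul, ← setIntegral_const]
  exact setIntegral_mono_on (integrableOn_const measure_closedBall_lt_top.ne) h5 measurableSet_closedBall key

lemma continuousOn_abs_re_rpow {F : ℂ → ℂ} {s : Set ℂ} {p : ℝ} (hp : 0 < p)
    (hF : DifferentiableOn ℂ F s) : ContinuousOn (fun w => |(F w).re| ^ p) s :=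
  (continuous_re.comp_continuousOn hF.continuousOn).abs.rpow_const fun _ _ => Or.inr hp.le

lemma exists_abs_re_rpow_le_setIntegral {p : ℝ} (hp0 : 0 < p) (hp1 : p < 1) :
    ∃ C : ℝ, 0 ≤ C ∧ ∀ (F : ℂ → ℂ) (z : ℂ) (R R' : ℝ), DifferentiableOn ℂ F (ball z R') →
      0 ≤ R → R < R' → R ^ 2 * |(F z).re| ^ p ≤ C * ∫ w in closedBall z R, |(F w).re| ^ p := by
  set c : ℝ := (4 : ℝ) ^ (1 / p) with hc
  have hc0 : 0 < c := by positivity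
  refine ⟨4 * c ^ (1 - p) / π, by positivity, fun F z R R' hF hR hRR => ?_⟩
  have hcont : ContinuousOn (fun w => |(F w).re| ^ p) (closedBall z R) :=
    (continuousOn_abs_re_rpow hp0 hF).mono (closedBall_subset_ball hRR)
  have hint : IntegrableOn (fun w => |(F w).re| ^ p) (closedBall z R) :=
    hcont.integrableOn_compact (isCompact_closedBall _ _)
  obtain ⟨w₀, hw₀, hmax⟩ := (isCompact_closedBall z R).exists_isMaxOn ⟨z, by simpa⟩
    (f := fun w => (R - dist w z) ^ 2 * |(F w).re| ^ p) (by fun_prop)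
  rw [isMaxOn_iff] at hmax
  refine (by simpa using hmax z (by simpa) :
    R ^ 2 * |(F z).re| ^ p ≤ (R - dist w₀ z) ^ 2 * |(F w₀).re| ^ p).trans ?_
  have hI : 0 ≤ ∫ w in closedBall z R, |(F w).re| ^ p :=
    integral_nonneg fun _ => by positivity
  rw [mem_closedBall] at hw₀
  set δ := R - dist w₀ z with hδ
  have hδ0 : 0 ≤ δ := by linarith
  set m := |(F w₀).re| with hm
  have hm0 : 0 ≤ m := abs_nonneg _
  rcases hδ0.eq_or_lt with h0 | hδ0
  · rw [← h0]; simp only [ne_eq, OfNat.ofNat_ne_zero, not_false_eq_true, zero_pow, zero_mul]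
    positivity
  rcases hm0.eq_or_lt with h0 | hm0
  · rw [← h0, zero_rpow hp0.ne', mul_zero]; positivity
  have hsub : closedBall w₀ (δ / 2) ⊆ closedBall z R :=
    closedBall_subset_closedBall' (by linarith)
  have hbd : ∀ w ∈ closedBall w₀ (δ / 2), |(F w).re| ≤ m * c := by
    intro w hw
    have h1 := hmax w (hsub hw)
    have h2 : δ / 2 ≤ R - dist w z := by
      have := dist_triangle w w₀ z
      rw [mem_closedBall] at hw
      linarith
    have h3 : (δ / 2) ^ 2 * |(F w).re| ^ p ≤ δ ^ 2 * m ^ p :=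
      le_trans (by gcongr) h1
    have h4 : |(F w).re| ^ p ≤ (m * c) ^ p := by
      rw [mul_rpow hm0.le hc0.le, hc, ← rpow_mul (by norm_num), one_div_mul_cancel hp0.ne',
        rpow_one]
      have : 0 < δ ^ 2 := by positivity
      nlinarith
    exact (rpow_le_rpow_iff (abs_nonneg _) (by positivity) hp0).1 h4
  have hmv := abs_re_le_setIntegral_closedBall (F := F) (z := w₀) (R := δ / 2)
    (R' := R' - dist w₀ z) (hF.mono (ball_subset_ball' (by linarith))) (by positivity)
    (by linarith)
  have hle : ∫ w in closedBall w₀ (δ / 2), |(F w).re| ≤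
      (m * c) ^ (1 - p) * ∫ w in closedBall z R, |(F w).re| ^ p := by
    calc ∫ w in closedBall w₀ (δ / 2), |(F w).re|
        ≤ ∫ w in closedBall w₀ (δ / 2), (m * c) ^ (1 - p) * |(F w).re| ^ p := by
          refine setIntegral_mono_on ?_ ((hint.mono_set hsub).const_mul _)
            measurableSet_closedBall fun w hw => ?_
          · exact (((continuous_re.comp_continuousOn hF.continuousOn).abs).mono
              (hsub.trans (closedBall_subset_ball hRR))).integrableOn_compact
              (isCompact_closedBall _ _)
          · rcases (abs_nonneg (F w).re).eq_or_lt with h0 | h0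
            · rw [← h0]; positivity
            · calc |(F w).re| = |(F w).re| ^ (1 - p) * |(F w).re| ^ p := by
                    rw [← rpow_add h0]; simp
                _ ≤ _ := by gcongr; exact hbd w hw
      _ = (m * c) ^ (1 - p) * ∫ w in closedBall w₀ (δ / 2), |(F w).re| ^ p :=
          integral_const_mul _ _
      _ ≤ _ := by
          gcongr ?_ * ?_
          exact setIntegral_mono_set hint (ae_of_all _ fun _ => by positivity)
            hsub.eventuallyLE
  have h5 := hmv.trans hle
  rw [← hm, mul_rpow hm0.le hc0.le] at h5
  have h6 : m = m ^ (1 - p) * m ^ p := by rw [← rpow_add hm0]; simp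
  have h7 : 0 < m ^ (1 - p) := by positivity
  have h8 : m ^ (1 - p) * (π * (δ / 2) ^ 2 * m ^ p) ≤
      m ^ (1 - p) * (c ^ (1 - p) * ∫ w in closedBall z R, |(F w).re| ^ p) := by
    calc _ = π * (δ / 2) ^ 2 * (m ^ (1 - p) * m ^ p) := by ring
      _ ≤ _ := by rw [← h6]; linarith
  have h9 := le_of_mul_le_mul_left h8 h7
  rw [div_mul_eq_mul_div, le_div_iff₀ pi_pos]
  linarith

lemma norm_deriv_le_of_abs_re_le {F : ℂ → ℂ} {z : ℂ} {R M : ℝ} (hR : 0 < R)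
    (hF : DifferentiableOn ℂ F (ball z R)) (hM : 0 ≤ M)
    (hb : ∀ w ∈ ball z R, |(F w).re| ≤ M) : ‖deriv F z‖ ≤ 8 * M / R := by
  refine le_of_forall_pos_le_add fun ε hε => ?_
  set M' := M + ε * R / 8 with hM'
  have hM0 : 0 < M' := by positivity
  have hmap : MapsTo (fun w => z + w) (ball 0 R) (ball z R) := fun w hw => by
    simpa [dist_eq_norm] using hw
  have hG : DifferentiableOn ℂ (fun w => F (z + w) - F z) (ball 0 R) :=
    (hF.comp (by fun_prop) hmap).sub_const _
  have hbc : ∀ w ∈ sphere (0 : ℂ) (R / 2), ‖F (z + w) - F z‖ ≤ 4 * M' := by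
    intro w hw
    rw [mem_sphere_zero_iff_norm] at hw
    have := borelCaratheodory_zero (f := fun w => F (z + w) - F z) (M := 2 * M') (R := R)
      (z := w) (by positivity) hG (fun v hv => ?_) hR (by simp [hw]; linarith) (by simp)
    · rw [hw] at this
      convert! this using 1
      field_simp
      ring
    · have h1 := hb _ (hmap hv)
      have h2 := hb z (mem_ball_self hR)
      rw [abs_le] at h1 h2
      have : 0 ≤ ε * R / 8 := by positivity
      simp only [mem_ofPred_eq, sub_re]
      linarith
  have := norm_deriv_le_of_forall_mem_sphere_norm_le (c := 0) (half_pos hR)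
    (hG.diffContOnCl_ball (closedBall_subset_ball (by linarith))) hbc
  rw [deriv_sub_const, deriv_comp_const_add, add_zero] at this
  refine this.trans (le_of_eq ?_)
  rw [hM']
  field_simp
  ring

lemma exists_norm_deriv_rpow_le_setIntegral {p : ℝ} (hp0 : 0 < p) (hp1 : p < 1) :
    ∃ C : ℝ, 0 ≤ C ∧ ∀ (F : ℂ → ℂ) (z : ℂ) (R R' : ℝ), DifferentiableOn ℂ F (ball z R') →
      0 < R → R < R' →
      R ^ 2 * (R * ‖deriv F z‖) ^ p ≤ C * ∫ w in closedBall z R, |(F w).re| ^ p := by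
  obtain ⟨C, hC, H⟩ := exists_abs_re_rpow_le_setIntegral hp0 hp1
  refine ⟨4 * 16 ^ p * C, by positivity, fun F z R R' hF hR hRR => ?_⟩
  have hint : IntegrableOn (fun w => |(F w).re| ^ p) (closedBall z R) :=
    ((continuousOn_abs_re_rpow hp0 hF).mono
      (closedBall_subset_ball hRR)).integrableOn_compact (isCompact_closedBall _ _)
  set J := ∫ w in closedBall z R, |(F w).re| ^ p with hJ
  have hJ0 : 0 ≤ J := integral_nonneg fun _ => by positivity
  set M := (4 * C * J / R ^ 2) ^ (1 / p) with hM
  have hMp : M ^ p = 4 * C * J / R ^ 2 := by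
    rw [hM, ← rpow_mul (by positivity), one_div_mul_cancel hp0.ne', rpow_one]
  have hb : ∀ w ∈ ball z (R / 2), |(F w).re| ≤ M := by
    intro w hw
    rw [mem_ball] at hw
    rw [← rpow_le_rpow_iff (abs_nonneg _) (by positivity) hp0, hMp, le_div_iff₀ (by positivity)]
    have h1 := H F w (R / 2) (R' - R / 2) (hF.mono (ball_subset_ball' (by linarith)))
      (by positivity) (by linarith)
    have h2 : ∫ v in closedBall w (R / 2), |(F v).re| ^ p ≤ J :=
      setIntegral_mono_set hint (ae_of_all _ fun _ => by positivity)
        (closedBall_subset_closedBall' (by linarith)).eventuallyLE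
    have h3 := mul_le_mul_of_nonneg_left h2 hC
    linarith
  have h4 := norm_deriv_le_of_abs_re_le (half_pos hR)
    (hF.mono (ball_subset_ball (by linarith))) (by positivity) hb
  have h5 : R * ‖deriv F z‖ ≤ 16 * M := by
    calc _ ≤ R * (8 * M / (R / 2)) := by gcongr
      _ = 16 * M := by field_simp; ring
  calc R ^ 2 * (R * ‖deriv F z‖) ^ p ≤ R ^ 2 * (16 * M) ^ p := by gcongr
    _ = _ := by
      rw [mul_rpow (by norm_num) (by positivity), hMp]
      field_simp

lemma abs_sum_rpow_le_sum {p : ℝ} (hp0 : 0 < p) (hp1 : p ≤ 1) (x : ℕ → ℝ) (N : ℕ) :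
    |∑ k ∈ Finset.range N, x k| ^ p ≤ ∑ k ∈ Finset.range N, |x k| ^ p := by
  induction N with
  | zero => simp [hp0.ne']
  | succ n ih =>
    rw [Finset.sum_range_succ, Finset.sum_range_succ]
    calc _ ≤ (|∑ k ∈ Finset.range n, x k| + |x n|) ^ p := by gcongr; exact abs_add_le _ _
      _ ≤ |∑ k ∈ Finset.range n, x k| ^ p + |x n| ^ p :=
        Real.rpow_add_le_add_rpow (abs_nonneg _) (abs_nonneg _) hp0.le hp1
      _ ≤ _ := by gcongr

lemma norm_ofReal_mul_exp {r : ℝ} (hr : 0 ≤ r) (θ : ℝ) :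
    ‖(r : ℂ) * Complex.exp (θ * I)‖ = r := by
  rw [norm_mul, Complex.norm_exp_ofReal_mul_I, mul_one, norm_real, norm_of_nonneg hr]

lemma continuous_comp_ofReal_mul_exp {φ : ℂ → ℝ} {r : ℝ} (hφ : ContinuousOn φ (ball 0 1))
    (hr : 0 ≤ r) (hr1 : r < 1) : Continuous fun θ : ℝ => φ (r * Complex.exp (θ * I)) :=
  hφ.comp_continuous (by fun_prop) fun θ => by
    rwa [mem_ball_zero_iff, norm_ofReal_mul_exp hr]

lemma norm_sub_rpow_le_of_norm_deriv_le {p : ℝ} (hp0 : 0 < p) (hp1 : p ≤ 1) {F G : ℂ → ℂ}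
    {K κ C J d : ℝ} {c x y : ℂ} (hK : 0 ≤ K) (hκ : 0 ≤ κ) (hC : 0 ≤ C) (hJ : 0 ≤ J)
    (hd : 0 < d) (hd1 : d ≤ 1)
    (hG : ∀ z ∈ closedBall c (2 * d), DifferentiableAt ℂ G z)
    (hFG : ∀ z ∈ closedBall c (2 * d), ‖deriv G z‖ ≤ K * ‖deriv F z‖ + κ)
    (hF : ∀ z ∈ closedBall c (2 * d), d ^ 2 * (d * ‖deriv F z‖) ^ p ≤ C * J)
    (hx : x ∈ closedBall c (2 * d)) (hy : y ∈ closedBall c (2 * d))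
    (hxy : ‖y - x‖ ≤ 2 * d) :
    ‖G y - G x‖ ^ p ≤ (2 * K) ^ p * C / d ^ 2 * J + (2 * κ) ^ p := by
  set M := (C * J / d ^ 2) ^ (1 / p) with hM
  have hM0 : 0 ≤ M := by positivity
  have hMp : M ^ p = C * J / d ^ 2 := by
    rw [hM, ← rpow_mul (by positivity), one_div_mul_cancel hp0.ne', rpow_one]
  have hFM : ∀ z ∈ closedBall c (2 * d), ‖deriv F z‖ ≤ M / d := by
    intro z hz
    rw [le_div_iff₀' hd, ← rpow_le_rpow_iff (by positivity) hM0 hp0, hMp,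
      le_div_iff₀' (by positivity)]
    exact hF z hz
  have h1 : ‖G y - G x‖ ≤ (K * (M / d) + κ) * ‖y - x‖ :=
    (convex_closedBall c (2 * d)).norm_image_sub_le_of_norm_deriv_le hG
      (fun z hz => (hFG z hz).trans (by gcongr; exact hFM z hz)) hx hy
  have h2 : ‖G y - G x‖ ≤ 2 * K * M + 2 * κ :=
    calc _ ≤ (K * (M / d) + κ) * (2 * d) := h1.trans (by gcongr)
      _ = 2 * K * M + 2 * κ * d := by field_simp
      _ ≤ _ := add_le_add_right (mul_le_of_le_one_right (by positivity) hd1) _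
  calc _ ≤ (2 * K * M + 2 * κ) ^ p := by gcongr
    _ ≤ (2 * K * M) ^ p + (2 * κ) ^ p :=
      Real.rpow_add_le_add_rpow (by positivity) (by positivity) hp0.le hp1
    _ = _ := by rw [mul_rpow (by positivity) hM0, hMp]; ring

lemma exists_integral_abs_im_sub_rpow_le {p : ℝ} (hp0 : 0 < p) (hp1 : p < 1) {F G : ℂ → ℂ}
    (hF : DifferentiableOn ℂ F (ball 0 1)) (hG : DifferentiableOn ℂ G (ball 0 1))
    {K κ L : ℝ} (hK : 0 ≤ K) (hκ : 0 ≤ κ) (hL0 : 0 ≤ L)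
    (hFG : ∀ z ∈ ball (0 : ℂ) 1, ‖deriv G z‖ ≤ K * ‖deriv F z‖ + κ)
    (hL : ∀ r : ℝ, 0 ≤ r → r < 1 → circleAverage (fun z => |(F z).re| ^ p) 0 r ≤ L) :
    ∃ D : ℝ, 0 ≤ D ∧ ∀ a d s t : ℝ, 0 ≤ a → 0 < d → a + 4 * d ≤ 1 → a ≤ s → s ≤ t →
      t ≤ a + 2 * d →
      ∫ θ in (0 : ℝ)..2 * π,
        |(G (t * Complex.exp (θ * I))).im - (G (s * Complex.exp (θ * I))).im| ^ p ≤ D := by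
  obtain ⟨C, hC, H⟩ := exists_norm_deriv_rpow_le_setIntegral hp0 hp1
  refine ⟨(2 * K) ^ p * C * (18 * π ^ 2 * L) + 2 * π * (2 * κ) ^ p, by positivity,
    fun a d s t ha hd had has hst hta => ?_⟩
  have hφ := continuousOn_abs_re_rpow hp0 hF
  have had' : ‖(a : ℂ)‖ + 3 * d < 1 := by
    rw [norm_real, norm_of_nonneg ha]; linarith
  set J : ℝ → ℝ := fun θ => ∫ w in closedBall ((a : ℂ) * Complex.exp (θ * I)) (3 * d),
    |(F w).re| ^ p with hJ
  have hJint : IntervalIntegrable J volume 0 (2 * π) :=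
    intervalIntegrable_setIntegral_closedBall_mul_exp hφ had'
  have hdist : ∀ r θ : ℝ, a ≤ r → r ≤ a + 2 * d →
      (r : ℂ) * Complex.exp (θ * I) ∈ closedBall ((a : ℂ) * Complex.exp (θ * I)) (2 * d) := by
    intro r θ h1 h2
    rw [mem_closedBall, dist_eq_norm, ← sub_mul, ← ofReal_sub,
      norm_ofReal_mul_exp (by linarith)]
    linarith
  have hball : ∀ θ : ℝ, ∀ z ∈ closedBall ((a : ℂ) * Complex.exp (θ * I)) (2 * d),
      ‖z‖ ≤ a + 2 * d := by
    intro θ z hz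
    rw [mem_closedBall, dist_eq_norm] at hz
    have := norm_le_norm_add_norm_sub' z ((a : ℂ) * Complex.exp (θ * I))
    rw [norm_ofReal_mul_exp ha] at this
    linarith
  have hpt : ∀ θ : ℝ,
      |(G (t * Complex.exp (θ * I))).im - (G (s * Complex.exp (θ * I))).im| ^ p ≤
        (2 * K) ^ p * C / d ^ 2 * J θ + (2 * κ) ^ p := by
    intro θ
    have hsub : closedBall ((a : ℂ) * Complex.exp (θ * I)) (3 * d) ⊆ ball 0 1 :=
      fun z hz => by
        rw [mem_closedBall, dist_eq_norm] at hz
        have := norm_le_norm_add_norm_sub' z ((a : ℂ) * Complex.exp (θ * I))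
        rw [norm_ofReal_mul_exp ha] at this
        rw [mem_ball_zero_iff]
        linarith
    have hint : IntegrableOn (fun w => |(F w).re| ^ p)
        (closedBall ((a : ℂ) * Complex.exp (θ * I)) (3 * d)) :=
      (hφ.mono hsub).integrableOn_compact (isCompact_closedBall _ _)
    have hmem : ∀ z ∈ closedBall ((a : ℂ) * Complex.exp (θ * I)) (2 * d),
        z ∈ ball (0 : ℂ) 1 := fun z hz => by
      rw [mem_ball_zero_iff]; linarith [hball θ z hz]
    have := norm_sub_rpow_le_of_norm_deriv_le hp0 hp1.le (F := F) (G := G) hK hκ hC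
      (integral_nonneg fun _ => by positivity : 0 ≤ J θ) hd (by linarith)
      (fun z hz => hG.differentiableAt (isOpen_ball.mem_nhds (hmem z hz)))
      (fun z hz => hFG z (hmem z hz)) (fun z hz => ?_)
      (hdist s θ has (by linarith)) (hdist t θ (by linarith) hta)
      (by rw [← sub_mul, ← ofReal_sub, norm_ofReal_mul_exp (by linarith)]; linarith)
    · refine le_trans ?_ this
      rw [← sub_im]
      gcongr
      exact abs_im_le_norm _
    · have h1 := hball θ z hz
      refine (H F z d (2 * d) (hF.mono (ball_subset_ball' ?_)) hd (by linarith)).trans ?_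
      · rw [dist_zero_right]; linarith
      · gcongr ?_ * ?_
        refine setIntegral_mono_set hint (ae_of_all _ fun _ => by positivity)
          (closedBall_subset_closedBall' ?_).eventuallyLE
        rw [mem_closedBall] at hz
        linarith
  have hcont : Continuous fun θ : ℝ =>
      |(G (t * Complex.exp (θ * I))).im - (G (s * Complex.exp (θ * I))).im| ^ p := by
    have hGim : ContinuousOn (fun z => (G z).im) (ball 0 1) :=
      continuous_im.comp_continuousOn hG.continuousOn
    refine Continuous.rpow_const ?_ fun _ => Or.inr hp0.le
    exact ((continuous_comp_ofReal_mul_exp hGim (by linarith) (by linarith)).sub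
      (continuous_comp_ofReal_mul_exp hGim (by linarith) (by linarith))).abs
  have hJle : ∫ θ in (0 : ℝ)..2 * π, J θ ≤ 18 * π ^ 2 * L * d ^ 2 := by
    rw [hJ, integral_setIntegral_closedBall_mul_exp hφ had']
    have : ∫ w in closedBall (a : ℂ) (3 * d), circleAverage (fun z => |(F z).re| ^ p) 0 ‖w‖ ≤
        ∫ w in closedBall (a : ℂ) (3 * d), L := by
      refine setIntegral_mono_on (integrableOn_circleAverage hφ had')
        (integrableOn_const measure_closedBall_lt_top.ne) measurableSet_closedBall
        fun w hw => hL _ (norm_nonneg w) ?_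
      rw [mem_closedBall, dist_eq_norm] at hw
      linarith [norm_le_norm_add_norm_sub' w (a : ℂ)]
    rw [setIntegral_const, volume_real_closedBall _ (by positivity), smul_eq_mul] at this
    calc _ ≤ 2 * π * (π * (3 * d) ^ 2 * L) := by gcongr
      _ = _ := by ring
  calc _ ≤ ∫ θ in (0 : ℝ)..2 * π, ((2 * K) ^ p * C / d ^ 2 * J θ + (2 * κ) ^ p) :=
        intervalIntegral.integral_mono two_pi_pos.le (hcont.intervalIntegrable _ _)
          ((hJint.const_mul _).add intervalIntegrable_const) hpt
    _ = (2 * K) ^ p * C / d ^ 2 * (∫ θ in (0 : ℝ)..2 * π, J θ) + 2 * π * (2 * κ) ^ p := by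
        rw [intervalIntegral.integral_add (hJint.const_mul _) intervalIntegrable_const,
          intervalIntegral.integral_const_mul, intervalIntegral.integral_const, sub_zero,
          smul_eq_mul]
    _ ≤ (2 * K) ^ p * C / d ^ 2 * (18 * π ^ 2 * L * d ^ 2) + 2 * π * (2 * κ) ^ p := by gcongr
    _ = _ := by field_simp

lemma Mp_eq_circleAverage_rpow {E : Type*} [NormedAddCommGroup E] (p r : ℝ) (f : ℂ → E) :
    Mp p r f = (circleAverage (fun z => ‖f z‖ ^ p) 0 r) ^ (1 / p) := by
  simp [Mp, circleAverage, circleMap]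

lemma add_le_of_sq_add_le {a b K K' : ℝ} (hK : 0 ≤ K) (hK' : 0 ≤ K')
    (h : (a + b) ^ 2 ≤ K * (a ^ 2 - b ^ 2) + K') : a + b ≤ K * |a - b| + √K' := by
  rcases le_or_gt (a + b) (√K') with h1 | h1
  · have : 0 ≤ K * |a - b| := by positivity
    linarith
  · have h2 : 0 < a + b := (sqrt_nonneg _).trans_lt h1
    have h3 := sq_sqrt hK'
    have h4 : (a + b) * (a + b - K * (a - b) - √K') ≤ 0 := by
      nlinarith [sqrt_nonneg K']
    have h5 : a + b - K * (a - b) - √K' ≤ 0 := nonpos_of_mul_nonpos_right h4 h2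
    have h6 : K * (a - b) ≤ K * |a - b| := by gcongr; exact le_abs_self _
    linarith

lemma integral_abs_im_rpow_le {p : ℝ} (hp0 : 0 < p) (hp1 : p < 1) {G : ℂ → ℂ} {D : ℝ}
    (hG : DifferentiableOn ℂ G (ball 0 1)) (hG0 : (G 0).im = 0) (hD0 : 0 ≤ D)
    (hD : ∀ a d s t : ℝ, 0 ≤ a → 0 < d → a + 4 * d ≤ 1 → a ≤ s → s ≤ t → t ≤ a + 2 * d →
      ∫ θ in (0 : ℝ)..2 * π,
        |(G (t * Complex.exp (θ * I))).im - (G (s * Complex.exp (θ * I))).im| ^ p ≤ D)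
    {r : ℝ} {N : ℕ} (hr0 : 0 ≤ r) (hr1 : r < 1) (hN : r ≤ 1 - (1 / 2) ^ N) :
    ∫ θ in (0 : ℝ)..2 * π, |(G (r * Complex.exp (θ * I))).im| ^ p ≤ N * D := by
  set s : ℕ → ℝ := fun k => min (1 - (1 / 2) ^ k) r with hs
  have hpow : ∀ k : ℕ, (1 / 2 : ℝ) ^ k ≤ 1 := fun k => pow_le_one₀ (by norm_num) (by norm_num)
  have hs0 : ∀ k, 0 ≤ s k := fun k => le_min (by linarith [hpow k]) hr0
  have hs1 : ∀ k, s k < 1 := fun k => (min_le_right _ _).trans_lt hr1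
  have hzero : s 0 = 0 := by simp [hs, hr0]
  have hlast : s N = r := min_eq_right hN
  have hGim : ContinuousOn (fun z => (G z).im) (ball 0 1) :=
    continuous_im.comp_continuousOn hG.continuousOn
  have hc := fun k => continuous_comp_ofReal_mul_exp hGim (hs0 k) (hs1 k)
  have hcd : ∀ k, Continuous fun θ : ℝ => |(G (s (k + 1) * Complex.exp (θ * I))).im -
      (G (s k * Complex.exp (θ * I))).im| ^ p := fun k =>
    ((hc (k + 1)).sub (hc k)).abs.rpow_const fun _ => Or.inr hp0.le
  have hstep : ∀ k, ∫ θ in (0 : ℝ)..2 * π, |(G (s (k + 1) * Complex.exp (θ * I))).im -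
      (G (s k * Complex.exp (θ * I))).im| ^ p ≤ D := by
    intro k
    have hk : (1 / 2 : ℝ) ^ (k + 1) = (1 / 2) ^ k / 2 := by rw [pow_succ]; ring
    have hk0 : (0 : ℝ) < (1 / 2) ^ k := by positivity
    rcases le_or_gt r (1 - (1 / 2) ^ k) with h | h
    · have h1 : s k = r := min_eq_right h
      have h2 : s (k + 1) = r := min_eq_right (by linarith)
      simpa [h1, h2, zero_rpow hp0.ne'] using hD0
    · have h1 : s k = 1 - (1 / 2) ^ k := min_eq_left h.le
      refine hD (1 - (1 / 2) ^ k) ((1 / 2) ^ k / 4) _ _ (by linarith [hpow k]) (by positivity)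
        (by linarith) h1.ge ?_ ((min_le_left _ _).trans (by linarith))
      rw [h1]
      exact le_min (by linarith) h.le
  calc ∫ θ in (0 : ℝ)..2 * π, |(G (r * Complex.exp (θ * I))).im| ^ p
      ≤ ∫ θ in (0 : ℝ)..2 * π, ∑ k ∈ Finset.range N,
        |(G (s (k + 1) * Complex.exp (θ * I))).im - (G (s k * Complex.exp (θ * I))).im| ^ p := by
        refine intervalIntegral.integral_mono two_pi_pos.le ?_ ?_ fun θ => ?_
        · exact ((continuous_comp_ofReal_mul_exp hGim hr0 hr1).abs.rpow_const
            fun _ => Or.inr hp0.le).intervalIntegrable _ _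
        · exact (continuous_finsetSum _ fun k _ => hcd k).intervalIntegrable _ _
        · refine le_trans (le_of_eq ?_) (abs_sum_rpow_le_sum hp0 hp1.le _ N)
          rw [Finset.sum_range_sub (fun k => (G (s k * Complex.exp (θ * I))).im), hlast, hzero]
          simp [hG0]
    _ = ∑ k ∈ Finset.range N, ∫ θ in (0 : ℝ)..2 * π,
        |(G (s (k + 1) * Complex.exp (θ * I))).im - (G (s k * Complex.exp (θ * I))).im| ^ p :=
        intervalIntegral.integral_finsetSum fun k _ => (hcd k).intervalIntegrable _ _
    _ ≤ ∑ k ∈ Finset.range N, D := Finset.sum_le_sum fun k _ => hstep k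
    _ = N * D := by simp

lemma exists_nat_le_one_sub_pow {r : ℝ} (hr : 1 / 2 ≤ r) (hr1 : r < 1) :
    ∃ N : ℕ, r ≤ 1 - (1 / 2) ^ N ∧ (N : ℝ) ≤ 2 / Real.log 2 * Real.log (1 / (1 - r)) := by
  have hl2 : 0 < Real.log 2 := log_pos one_lt_two
  have h1r : 0 < 1 - r := by linarith
  have hlog : Real.log 2 ≤ Real.log (1 / (1 - r)) :=
    log_le_log two_pos (by rw [le_div_iff₀ h1r]; linarith)
  have hlog0 : 0 ≤ Real.log (1 / (1 - r)) / Real.log 2 := div_nonneg (hl2.le.trans hlog) hl2.le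
  refine ⟨⌈Real.log (1 / (1 - r)) / Real.log 2⌉₊, ?_, ?_⟩
  · have h := Nat.le_ceil (Real.log (1 / (1 - r)) / Real.log 2)
    rw [div_le_iff₀ hl2, ← log_pow, log_le_log_iff (by positivity) (by positivity),
      div_le_iff₀ h1r] at h
    rw [one_div, inv_pow, le_sub_comm, inv_le_iff_one_le_mul₀ (by positivity)]
    linarith
  · refine (Nat.ceil_lt_add_one hlog0).le.trans ?_
    have : 1 ≤ Real.log (1 / (1 - r)) / Real.log 2 := (one_le_div hl2).2 hlog
    calc _ ≤ 2 * (Real.log (1 / (1 - r)) / Real.log 2) := by linarith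
      _ = _ := by ring

end

/-- Hardy–Littlewood type growth theorem for harmonic (K,K')-quasiregular mappings. -/
theorem hardy_littlewood_type_growth
    (K K' p : ℝ) (hK : 1 ≤ K) (hK' : 0 ≤ K') (hp0 : 0 < p) (hp1 : p < 1)
    (f h g : ℂ → ℂ)
    (hh : DifferentiableOn ℂ h (Metric.ball 0 1))
    (hg : DifferentiableOn ℂ g (Metric.ball 0 1))
    (hg0 : g 0 = 0)
    (hfdec : ∀ z ∈ Metric.ball (0:ℂ) 1, f z = h z + (starRingEnd ℂ) (g z))
    (hqr : ∀ z ∈ Metric.ball (0:ℂ) 1,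
      (‖deriv h z‖ + ‖deriv g z‖) ^ 2 ≤ K * (‖deriv h z‖ ^ 2 - ‖deriv g z‖ ^ 2) + K')
    (hv0 : (f 0).im = 0)
    (hu : MemHp p (fun z => (f z).re)) :
    ∃ C : ℝ, 0 < C ∧ ∀ r : ℝ, 1 / 2 ≤ r → r < 1 →
      Mp p r (fun z => (f z).im) ≤ C * (Real.log (1 / (1 - r))) ^ (1 / p) := by
  open Real Metric in
  set F : ℂ → ℂ := fun z => h z + g z with hFdef
  set G : ℂ → ℂ := fun z => h z - g z with hGdef
  have hF : DifferentiableOn ℂ F (ball 0 1) := hh.add hg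
  have hG : DifferentiableOn ℂ G (ball 0 1) := hh.sub hg
  have hre : ∀ z ∈ ball (0 : ℂ) 1, (f z).re = (F z).re := fun z hz => by
    simp [hfdec z hz, hFdef]
  have him : ∀ z ∈ ball (0 : ℂ) 1, (f z).im = (G z).im := fun z hz => by
    simp [hfdec z hz, hGdef, sub_eq_add_neg]
  have hsphere : ∀ r : ℝ, 0 ≤ r → r < 1 → ∀ z ∈ sphere (0 : ℂ) |r|, z ∈ ball (0 : ℂ) 1 := by
    intro r hr hr1 z hz
    rw [mem_sphere_zero_iff_norm, abs_of_nonneg hr] at hz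
    rwa [mem_ball_zero_iff, hz]
  have hFG : ∀ z ∈ ball (0 : ℂ) 1, ‖deriv G z‖ ≤ K * ‖deriv F z‖ + √K' := by
    intro z hz
    have hhz := hh.differentiableAt (isOpen_ball.mem_nhds hz)
    have hgz := hg.differentiableAt (isOpen_ball.mem_nhds hz)
    rw [show deriv G z = deriv h z - deriv g z from deriv_fun_sub hhz hgz,
      show deriv F z = deriv h z + deriv g z from deriv_fun_add hhz hgz]
    calc _ ≤ ‖deriv h z‖ + ‖deriv g z‖ := norm_sub_le _ _
      _ ≤ K * |‖deriv h z‖ - ‖deriv g z‖| + √K' :=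
        add_le_of_sq_add_le (by linarith) hK' (hqr z hz)
      _ ≤ _ := by
        gcongr
        simpa using abs_norm_sub_norm_le (deriv h z) (-deriv g z)
  obtain ⟨B, hB⟩ := hu
  have hL : ∀ r : ℝ, 0 ≤ r → r < 1 →
      circleAverage (fun z => |(F z).re| ^ p) 0 r ≤ (max B 0) ^ p := by
    intro r hr hr1
    have h1 := hB (mem_image_of_mem _ (mem_Ico.2 ⟨hr, hr1⟩))
    rw [Mp_eq_circleAverage_rpow] at h1
    have h2 : circleAverage (fun z => ‖(f z).re‖ ^ p) 0 r =
        circleAverage (fun z => |(F z).re| ^ p) 0 r :=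
      circleAverage_congr_sphere fun z hz => by
        simp [hre z (hsphere r hr hr1 z hz)]
    have h3 : 0 ≤ circleAverage (fun z => |(F z).re| ^ p) 0 r :=
      circleAverage_nonneg_of_nonneg fun _ _ => by positivity
    rw [h2, one_div] at h1
    exact (rpow_inv_le_iff_of_pos h3 (by positivity) hp0).1 (h1.trans (le_max_left _ _))
  obtain ⟨D, hD0, hD⟩ := exists_integral_abs_im_sub_rpow_le hp0 hp1 hF hG
    (by linarith : 0 ≤ K) (sqrt_nonneg K') (by positivity) hFG hL
  refine ⟨(2 / Real.log 2 * D + 1) ^ (1 / p), ?_, fun r hr hr1 => ?_⟩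
  · have : 0 < Real.log 2 := log_pos one_lt_two
    positivity
  have hl2 : 0 < Real.log 2 := log_pos one_lt_two
  have hr0 : 0 ≤ r := by linarith
  obtain ⟨N, hrN, hN⟩ := exists_nat_le_one_sub_pow hr hr1
  have hG0 : (G 0).im = 0 := by rw [← him 0 (by simp), hv0]
  have hlog : 0 ≤ Real.log (1 / (1 - r)) :=
    log_nonneg (by rw [le_div_iff₀ (by linarith)]; linarith)
  have hint := integral_abs_im_rpow_le hp0 hp1 hG hG0 hD0 hD hr0 hr1 hrN
  rw [Mp_eq_circleAverage_rpow, ← mul_rpow (by positivity) hlog]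
  refine rpow_le_rpow (circleAverage_nonneg_of_nonneg fun _ _ => by positivity) ?_
    (by positivity)
  have hcongr : circleAverage (fun z => ‖(f z).im‖ ^ p) 0 r =
      circleAverage (fun z => |(G z).im| ^ p) 0 r :=
    circleAverage_congr_sphere fun z hz => by simp [him z (hsphere r hr0 hr1 z hz)]
  have hI0 : 0 ≤ ∫ θ in (0 : ℝ)..2 * π, |(G (r * Complex.exp (θ * I))).im| ^ p :=
    intervalIntegral.integral_nonneg two_pi_pos.le fun _ _ => by positivity
  rw [hcongr, circleAverage]
  simp only [circleMap_zero, smul_eq_mul]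
  calc _ ≤ 1 * ∫ θ in (0 : ℝ)..2 * π, |(G (r * Complex.exp (θ * I))).im| ^ p := by
        gcongr
        exact inv_le_one_of_one_le₀ (by linarith [pi_gt_three])
    _ ≤ N * D := by rw [one_mul]; exact hint
    _ ≤ 2 / Real.log 2 * Real.log (1 / (1 - r)) * D := by gcongr
    _ ≤ _ := by nlinarith
end

section
/- (Sharpness of the logarithmic growth rate.) Fix an integer j ≥ 0 and a constant K ≥ 1, let h_j(z) = e^{ijπ/2} (1 − z)^{−(j+1)} and f_j(z) = (2K/(K+1)) Re(h_j(z)) + i (2/(K+1)) Im(h_j(z)) for z in the unit disk 𝔻. Then f_j is a harmonic K-quasiregular mapping on 𝔻 whose real part Re f_j lies in h^{1/(1+j)}, and there are constants 0 < c ≤ C and r₀ ∈ (0,1) such that c·log(1/(1−r)) ≤ (1/(2π)) ∫₀^{2π} |Im f_j(r e^{iθ})|^{1/(1+j)} dθ ≤ C·log(1/(1−r)) for all r ∈ (r₀, 1). -/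
open Complex MeasureTheory Set

/-- The integral of a periodic function over `[0, 2π]`, folded to `[0, π]`. -/
lemma integral_two_pi_eq_fold {F : ℝ → ℝ} (hF : Continuous F)
    (hper : Function.Periodic F (2 * Real.pi)) :
    ∫ θ in (0 : ℝ)..(2 * Real.pi), F θ = ∫ θ in (0 : ℝ)..Real.pi, (F θ + F (-θ)) := by
  have h1 := hper.intervalIntegral_add_eq 0 (-Real.pi)
  rw [zero_add, show -Real.pi + 2 * Real.pi = Real.pi by ring] at h1
  have hneg : Continuous fun θ => F (-θ) := hF.comp continuous_neg
  rw [h1, intervalIntegral.integral_add (hF.intervalIntegrable _ _)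
    (hneg.intervalIntegrable _ _), intervalIntegral.integral_comp_neg, neg_zero,
    add_comm, intervalIntegral.integral_add_adjacent_intervals (hF.intervalIntegrable _ _)
    (hF.intervalIntegrable _ _)]

lemma integral_two_pi_le_of_abs {F G : ℝ → ℝ} (hF : Continuous F)
    (hper : Function.Periodic F (2 * Real.pi))
    (hG : IntervalIntegrable G volume 0 Real.pi)
    (h : ∀ θ : ℝ, 0 < |θ| → |θ| ≤ Real.pi → F θ ≤ G |θ|) :
    ∫ θ in (0 : ℝ)..(2 * Real.pi), F θ ≤ 2 * ∫ θ in (0 : ℝ)..Real.pi, G θ := by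
  rw [integral_two_pi_eq_fold hF hper, ← intervalIntegral.integral_const_mul]
  refine intervalIntegral.integral_mono_on_of_le_Ioo Real.pi_pos.le
    ((hF.add (hF.comp continuous_neg)).intervalIntegrable _ _) (hG.const_mul 2) ?_
  intro θ hθ
  have e : |θ| = θ := abs_of_pos hθ.1
  have h1 := h θ (by rw [e]; exact hθ.1) (by rw [e]; exact hθ.2.le)
  have h2 := h (-θ) (by rw [abs_neg, e]; exact hθ.1) (by rw [abs_neg, e]; exact hθ.2.le)
  rw [abs_neg] at h2
  rw [e] at h1 h2
  linarith

lemma le_integral_two_pi_of_abs {F G : ℝ → ℝ} (hF : Continuous F)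
    (hper : Function.Periodic F (2 * Real.pi))
    (hG : IntervalIntegrable G volume 0 Real.pi)
    (h : ∀ θ : ℝ, 0 < |θ| → |θ| ≤ Real.pi → G |θ| ≤ F θ) :
    2 * ∫ θ in (0 : ℝ)..Real.pi, G θ ≤ ∫ θ in (0 : ℝ)..(2 * Real.pi), F θ := by
  have := integral_two_pi_le_of_abs (F := fun θ => -F θ) (G := fun θ => -G θ) hF.neg
    (fun θ => by simp only [hper θ]) hG.neg (fun θ h1 h2 => neg_le_neg (h θ h1 h2))
  simp only [intervalIntegral.integral_neg] at this
  linarith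

lemma one_sub_circle_ne_zero {r : ℝ} (hr0 : 0 ≤ r) (hr1 : r < 1) (θ : ℝ) :
    1 - (r : ℂ) * Complex.exp (θ * I) ≠ 0 := by
  intro h
  have h1 := congrArg norm (sub_eq_zero.mp h)
  rw [norm_mul, norm_exp_ofReal_mul_I, norm_one, Complex.norm_of_nonneg hr0] at h1
  linarith

lemma norm_one_sub_circle_le {r : ℝ} (hr0 : 0 ≤ r) (hr1 : r < 1) (θ : ℝ) :
    ‖1 - (r : ℂ) * Complex.exp (θ * I)‖ ≤ 1 - r + |θ| := by
  have h1 : ‖Complex.exp (I * θ) - 1‖ ≤ |θ| := Real.norm_exp_I_mul_ofReal_sub_one_le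
  have h2 : 1 - (r : ℂ) * Complex.exp (θ * I)
      = ((1 - r : ℝ) : ℂ) - (r : ℂ) * (Complex.exp (I * θ) - 1) := by
    rw [mul_comm I]; push_cast; ring
  rw [h2]
  refine (norm_sub_le _ _).trans ?_
  rw [norm_mul, Complex.norm_of_nonneg hr0, Complex.norm_of_nonneg (by linarith)]
  nlinarith [norm_nonneg (Complex.exp (I * θ) - 1)]

lemma le_norm_one_sub_circle {r : ℝ} (hr0 : 0 ≤ r) (hr1 : r < 1) {θ : ℝ} (hθ : |θ| ≤ Real.pi) :
    (1 - r + |θ|) / (2 * Real.pi) ≤ ‖1 - (r : ℂ) * Complex.exp (θ * I)‖ := by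
  set w := 1 - (r : ℂ) * Complex.exp (θ * I) with hw
  have hpi := Real.pi_gt_three
  have h1 : 1 - r ≤ ‖w‖ := by
    have := norm_sub_norm_le (1 : ℂ) ((r : ℂ) * Complex.exp (θ * I))
    rwa [norm_mul, norm_exp_ofReal_mul_I, norm_one, Complex.norm_of_nonneg hr0, mul_one] at this
  have h2 : ‖Complex.exp (I * θ) - 1‖ ≤ 2 * ‖w‖ := by
    have : Complex.exp (I * θ) - 1 = ((1 - r : ℝ) : ℂ) * Complex.exp (θ * I) - w := by
      rw [hw, mul_comm I]; push_cast; ring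
    rw [this]
    refine (norm_sub_le _ _).trans ?_
    rw [norm_mul, norm_exp_ofReal_mul_I, Complex.norm_of_nonneg (by linarith)]
    linarith
  rw [Complex.norm_exp_I_mul_ofReal_sub_one, Real.norm_eq_abs, abs_mul, abs_two] at h2
  have h3 : |θ / 2| ≤ Real.pi / 2 := by rw [abs_div, abs_two]; linarith
  have h4 := Real.mul_abs_le_abs_sin h3
  rw [abs_div, abs_two] at h4
  have h5 : |θ| ≤ ‖w‖ * Real.pi := by
    rw [← div_le_iff₀ Real.pi_pos]
    calc |θ| / Real.pi = 2 / Real.pi * (|θ| / 2) := by ring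
      _ ≤ ‖w‖ := by linarith
  rw [div_le_iff₀ (by positivity)]
  nlinarith [norm_nonneg w]

lemma re_one_sub_circle {r : ℝ} (hr0 : 0 ≤ r) (hr1 : r < 1) (θ : ℝ) :
    0 ≤ (1 - (r : ℂ) * Complex.exp (θ * I)).re ∧
    (1 - (r : ℂ) * Complex.exp (θ * I)).re ≤ 1 - r + |θ| ^ 2 := by
  rw [sub_re, one_re, re_ofReal_mul, exp_ofReal_mul_I_re]
  have := Real.one_sub_sq_div_two_le_cos (x := θ)
  have := Real.cos_le_one θ
  rw [sq_abs]
  constructor <;> nlinarith [sq_nonneg θ]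

lemma abs_re_I_pow_mul_pow_le (j : ℕ) (u : ℂ) :
    |(I ^ j * u ^ (j + 1)).re| ≤ (j + 1) * |u.re| * ‖u‖ ^ j := by
  induction j with
  | zero => simp
  | succ j ih =>
    have e : I ^ (j + 1) * u ^ (j + 1 + 1) = (I ^ j * u ^ (j + 1)) * (I * u) := by ring
    have him : |(I ^ j * u ^ (j + 1)).im| ≤ ‖u‖ ^ (j + 1) := by
      refine (abs_im_le_norm _).trans ?_
      simp
    rw [e, mul_re]
    have e1 : (I * u).re = -u.im := by simp
    have e2 : (I * u).im = u.re := by simp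
    rw [e1, e2]
    refine (abs_sub _ _).trans ?_
    rw [abs_mul, abs_mul, abs_neg]
    have h1 := mul_le_mul ih (abs_im_le_norm u) (abs_nonneg _) (by positivity)
    have h2 := mul_le_mul_of_nonneg_right him (abs_nonneg u.re)
    push_cast
    calc _ ≤ (j + 1) * |u.re| * ‖u‖ ^ j * ‖u‖ + ‖u‖ ^ (j + 1) * |u.re| := add_le_add h1 h2
      _ = _ := by ring

lemma abs_re_I_pow_mul_inv_pow_le (j : ℕ) (w : ℂ) :
    |(I ^ j * (w ^ (j + 1))⁻¹).re| ≤ (j + 1) * |w.re| * ‖w‖⁻¹ ^ (j + 2) := by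
  have h := abs_re_I_pow_mul_pow_le j w⁻¹
  rw [inv_pow] at h
  refine h.trans (le_of_eq ?_)
  rw [inv_re, abs_div, norm_inv, normSq_eq_norm_sq, abs_of_nonneg (sq_nonneg ‖w‖)]
  ring

lemma norm_I_pow_mul_inv_pow_rpow (j : ℕ) (w : ℂ) :
    ‖I ^ j * (w ^ (j + 1))⁻¹‖ ^ (1 / (1 + (j : ℝ))) = ‖w‖⁻¹ := by
  rw [norm_mul, norm_pow, norm_I, one_pow, one_mul, norm_inv, norm_pow, ← inv_pow,
    ← Real.rpow_natCast, ← Real.rpow_mul (by positivity)]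
  have : ((j + 1 : ℕ) : ℝ) * (1 / (1 + (j : ℝ))) = 1 := by
    push_cast; field_simp; ring
  rw [this, Real.rpow_one]

/-- Pointwise bound for the `p`-th power of the real part, `p = 1 / (1 + j)`. -/
lemma abs_re_rpow_le (j : ℕ) {r : ℝ} (hr0 : 0 ≤ r) (hr1 : r < 1) {θ p : ℝ}
    (hp : p = 1 / (1 + (j : ℝ))) (h0 : 0 < |θ|) (hθ : |θ| ≤ Real.pi) :
    |(I ^ j * ((1 - (r : ℂ) * Complex.exp (θ * I)) ^ (j + 1))⁻¹).re| ^ p ≤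
      ((j + 1) ^ p * (2 * Real.pi) ^ (1 + p)) *
        ((1 - r) ^ p * (1 - r + |θ|) ^ (-(1 + p)) + |θ| ^ (p - 1)) := by
  have hp0 : 0 < p := by rw [hp]; positivity
  have hp1 : p ≤ 1 := by
    rw [hp, div_le_one (by positivity)]; linarith [(Nat.cast_nonneg j : (0 : ℝ) ≤ j)]
  have hpi := Real.pi_pos
  have hlow := le_norm_one_sub_circle hr0 hr1 hθ
  obtain ⟨hre0, hre⟩ := re_one_sub_circle hr0 hr1 θ
  have hb := abs_re_I_pow_mul_inv_pow_le j (1 - (r : ℂ) * Complex.exp (θ * I))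
  set w := 1 - (r : ℂ) * Complex.exp (θ * I)
  rw [abs_of_nonneg hre0] at hb
  set t := |θ|
  have hδ : 0 < 1 - r := by linarith
  have hs : 0 < 1 - r + t := by positivity
  have hinv : ‖w‖⁻¹ ≤ (2 * Real.pi) * (1 - r + t)⁻¹ := by
    refine (inv_anti₀ (by positivity) hlow).trans (le_of_eq ?_)
    rw [inv_div]; ring
  have hexp : ∀ x : ℝ, 0 ≤ x → (x ^ (j + 2)) ^ p = x ^ (1 + p) := by
    intro x hx
    rw [← Real.rpow_natCast, ← Real.rpow_mul hx]
    congr 1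
    rw [hp]; push_cast; field_simp; ring
  calc _ ≤ ((j + 1) * (1 - r + t ^ 2) * ((2 * Real.pi) * (1 - r + t)⁻¹) ^ (j + 2)) ^ p := by
        refine Real.rpow_le_rpow (abs_nonneg _) (hb.trans ?_) hp0.le
        gcongr
    _ = ((j + 1) ^ p * (2 * Real.pi) ^ (1 + p)) *
          ((1 - r + t ^ 2) ^ p * (1 - r + t) ^ (-(1 + p))) := by
        rw [Real.mul_rpow (by positivity) (by positivity), Real.mul_rpow (by positivity)
          (by positivity), hexp _ (by positivity), Real.mul_rpow (by positivity) (by positivity),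
          Real.inv_rpow hs.le, Real.rpow_neg hs.le]
        ring
    _ ≤ _ := by
        gcongr
        calc _ ≤ ((1 - r) ^ p + (t ^ 2) ^ p) * (1 - r + t) ^ (-(1 + p)) := by
              gcongr
              exact Real.rpow_add_le_add_rpow hδ.le (by positivity) hp0.le hp1
          _ = (1 - r) ^ p * (1 - r + t) ^ (-(1 + p)) + (t ^ 2) ^ p * (1 - r + t) ^ (-(1 + p)) := by
              ring
          _ ≤ (1 - r) ^ p * (1 - r + t) ^ (-(1 + p)) + (t ^ 2) ^ p * t ^ (-(1 + p)) := by
              have : (1 - r + t) ^ (-(1 + p)) ≤ t ^ (-(1 + p)) :=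
                Real.rpow_le_rpow_of_nonpos h0 (by linarith) (by linarith)
              gcongr
          _ = _ := by
              rw [← Real.rpow_natCast, ← Real.rpow_mul h0.le, ← Real.rpow_add h0]
              congr 2
              push_cast; ring

lemma integral_majorant {δ p : ℝ} (hδ : 0 < δ) (hp : 0 < p) :
    IntervalIntegrable (fun t : ℝ => δ ^ p * (δ + t) ^ (-(1 + p)) + t ^ (p - 1)) volume 0 Real.pi ∧
    ∫ t in (0 : ℝ)..Real.pi, (δ ^ p * (δ + t) ^ (-(1 + p)) + t ^ (p - 1)) ≤
      1 / p + Real.pi ^ p / p := by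
  have hpi := Real.pi_pos
  have h1 : IntervalIntegrable (fun t : ℝ => δ ^ p * (δ + t) ^ (-(1 + p))) volume 0 Real.pi := by
    refine ContinuousOn.intervalIntegrable (ContinuousOn.mul continuousOn_const
      (ContinuousOn.rpow_const (by fun_prop) fun t ht => Or.inl ?_))
    rw [uIcc_of_le hpi.le] at ht
    linarith [ht.1]
  have h2 : IntervalIntegrable (fun t : ℝ => t ^ (p - 1)) volume 0 Real.pi :=
    intervalIntegral.intervalIntegrable_rpow' (by linarith)
  refine ⟨h1.add h2, ?_⟩
  have h3 : ∫ t in δ..(δ + Real.pi), t ^ (-(1 + p)) =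
      ((δ + Real.pi) ^ (-(1 + p) + 1) - δ ^ (-(1 + p) + 1)) / (-(1 + p) + 1) := by
    refine integral_rpow (Or.inr ⟨by linarith, ?_⟩)
    rw [uIcc_of_le (by linarith)]
    intro h
    linarith [h.1]
  rw [intervalIntegral.integral_add h1 h2, intervalIntegral.integral_const_mul,
    intervalIntegral.integral_comp_add_left (fun t => t ^ (-(1 + p))) δ, add_zero, h3,
    integral_rpow (Or.inl (by linarith)), sub_add_cancel, Real.zero_rpow hp.ne', sub_zero]
  refine add_le_add ?_ le_rfl
  rw [show -(1 + p) + 1 = -p by ring, Real.rpow_neg hδ.le, ← mul_div_assoc, div_neg, ← neg_div]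
  gcongr
  have := mul_inv_cancel₀ (Real.rpow_pos_of_pos hδ p).ne'
  have : 0 ≤ δ ^ p * (δ + Real.pi) ^ (-p) := by positivity
  linarith

lemma integral_inv_add {δ : ℝ} (hδ : 0 < δ) :
    IntervalIntegrable (fun t : ℝ => (δ + t)⁻¹) volume 0 Real.pi ∧
    ∫ t in (0 : ℝ)..Real.pi, (δ + t)⁻¹ = Real.log (1 / δ) + Real.log (δ + Real.pi) := by
  have hpi := Real.pi_pos
  constructor
  · refine ContinuousOn.intervalIntegrable (ContinuousOn.inv₀ (by fun_prop) fun t ht => ?_)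
    rw [uIcc_of_le hpi.le] at ht
    linarith [ht.1]
  · rw [intervalIntegral.integral_comp_add_left (fun t => t⁻¹) δ, add_zero,
      integral_inv_of_pos hδ (by linarith), Real.log_div (by linarith) hδ.ne', one_div,
      Real.log_inv]
    ring

lemma periodic_comp_circle {α : Type*} (φ : ℂ → α) (r : ℝ) :
    Function.Periodic (fun θ : ℝ => φ ((r : ℂ) * Complex.exp (θ * I))) (2 * Real.pi) := by
  intro θ
  have := Complex.exp_mul_I_periodic (θ : ℂ)
  simp only at this
  simp only [ofReal_add, ofReal_mul, ofReal_ofNat, this]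

lemma continuous_I_pow_mul_inv_circle (j : ℕ) {r : ℝ} (hr0 : 0 ≤ r) (hr1 : r < 1) :
    Continuous fun θ : ℝ => I ^ j * ((1 - (r : ℂ) * Complex.exp (θ * I)) ^ (j + 1))⁻¹ := by
  refine continuous_const.mul (Continuous.inv₀ (by fun_prop) fun θ => ?_)
  exact pow_ne_zero _ (one_sub_circle_ne_zero hr0 hr1 θ)

lemma exists_integral_re_rpow_le (j : ℕ) :
    ∃ M : ℝ, 0 ≤ M ∧ ∀ r : ℝ, 0 ≤ r → r < 1 →
      ∫ θ in (0 : ℝ)..(2 * Real.pi),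
        |(I ^ j * ((1 - (r : ℂ) * Complex.exp (θ * I)) ^ (j + 1))⁻¹).re| ^ (1 / (1 + (j : ℝ))) ≤ M := by
  obtain ⟨p, hp⟩ : ∃ p : ℝ, p = 1 / (1 + (j : ℝ)) := ⟨_, rfl⟩
  have hp0 : 0 < p := by rw [hp]; positivity
  have hpi := Real.pi_pos
  rw [← hp]
  refine ⟨2 * (((j + 1) ^ p * (2 * Real.pi) ^ (1 + p)) * (1 / p + Real.pi ^ p / p)), by positivity,
    fun r hr0 hr1 => ?_⟩
  obtain ⟨hint, hle⟩ := integral_majorant (sub_pos.mpr hr1) hp0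
  refine (integral_two_pi_le_of_abs ?_ ?_
    (hint.const_mul ((j + 1) ^ p * (2 * Real.pi) ^ (1 + p)))
    fun θ h0 hθ => abs_re_rpow_le j hr0 hr1 hp h0 hθ).trans ?_
  · exact (continuous_re.comp (continuous_I_pow_mul_inv_circle j hr0 hr1)).abs.rpow_const
      fun _ => Or.inr hp0.le
  · exact periodic_comp_circle (fun z => |(I ^ j * ((1 - z) ^ (j + 1))⁻¹).re| ^ p) r
  · rw [intervalIntegral.integral_const_mul]
    gcongr

lemma integral_inv_norm_one_sub_circle {r : ℝ} (hr0 : 0 ≤ r) (hr1 : r < 1) :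
    2 * Real.log (1 / (1 - r)) ≤
      ∫ θ in (0 : ℝ)..(2 * Real.pi), ‖1 - (r : ℂ) * Complex.exp (θ * I)‖⁻¹ ∧
    ∫ θ in (0 : ℝ)..(2 * Real.pi), ‖1 - (r : ℂ) * Complex.exp (θ * I)‖⁻¹ ≤
      4 * Real.pi * (Real.log (1 / (1 - r)) + Real.pi) := by
  have hpi := Real.pi_gt_three
  have hδ : 0 < 1 - r := sub_pos.mpr hr1
  obtain ⟨hint, heq⟩ := integral_inv_add hδ
  have hc : Continuous fun θ : ℝ => ‖1 - (r : ℂ) * Complex.exp (θ * I)‖⁻¹ :=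
    Continuous.inv₀ (by fun_prop) fun θ => norm_ne_zero_iff.mpr (one_sub_circle_ne_zero hr0 hr1 θ)
  have hper := periodic_comp_circle (fun z => ‖1 - z‖⁻¹) r
  have hlog0 : 0 ≤ Real.log (1 - r + Real.pi) := Real.log_nonneg (by linarith)
  have hlog1 : Real.log (1 - r + Real.pi) ≤ Real.pi := by
    have := Real.log_le_sub_one_of_pos (show 0 < 1 - r + Real.pi by linarith)
    linarith
  constructor
  · refine le_trans ?_ (le_integral_two_pi_of_abs hc hper hint fun θ h0 hθ => ?_)
    · rw [heq]; linarith
    · exact inv_anti₀ (norm_pos_iff.mpr (one_sub_circle_ne_zero hr0 hr1 θ))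
        (norm_one_sub_circle_le hr0 hr1 θ)
  · refine (integral_two_pi_le_of_abs hc hper (hint.const_mul (2 * Real.pi)) fun θ h0 hθ => ?_).trans
      ?_
    · refine (inv_anti₀ (by positivity) (le_norm_one_sub_circle hr0 hr1 hθ)).trans (le_of_eq ?_)
      rw [inv_div]; ring
    · rw [intervalIntegral.integral_const_mul, heq]
      nlinarith

lemma integral_im_rpow_bounds (j : ℕ) {r : ℝ} (hr0 : 0 ≤ r) (hr1 : r < 1) :
    (∫ θ in (0 : ℝ)..(2 * Real.pi), ‖1 - (r : ℂ) * Complex.exp (θ * I)‖⁻¹) -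
      (∫ θ in (0 : ℝ)..(2 * Real.pi),
        |(I ^ j * ((1 - (r : ℂ) * Complex.exp (θ * I)) ^ (j + 1))⁻¹).re| ^ (1 / (1 + (j : ℝ)))) ≤
      ∫ θ in (0 : ℝ)..(2 * Real.pi),
        |(I ^ j * ((1 - (r : ℂ) * Complex.exp (θ * I)) ^ (j + 1))⁻¹).im| ^ (1 / (1 + (j : ℝ))) ∧
    ∫ θ in (0 : ℝ)..(2 * Real.pi),
        |(I ^ j * ((1 - (r : ℂ) * Complex.exp (θ * I)) ^ (j + 1))⁻¹).im| ^ (1 / (1 + (j : ℝ))) ≤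
      ∫ θ in (0 : ℝ)..(2 * Real.pi), ‖1 - (r : ℂ) * Complex.exp (θ * I)‖⁻¹ := by
  have hp0 : 0 < 1 / (1 + (j : ℝ)) := by positivity
  have hp1 : 1 / (1 + (j : ℝ)) ≤ 1 := by
    rw [div_le_one (by positivity)]; linarith [(Nat.cast_nonneg j : (0 : ℝ) ≤ j)]
  have hpi := Real.pi_pos
  have hc : Continuous fun θ : ℝ => ‖1 - (r : ℂ) * Complex.exp (θ * I)‖⁻¹ :=
    Continuous.inv₀ (by fun_prop) fun θ => norm_ne_zero_iff.mpr (one_sub_circle_ne_zero hr0 hr1 θ)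
  have hk := continuous_I_pow_mul_inv_circle j hr0 hr1
  have hre : Continuous fun θ : ℝ =>
      |(I ^ j * ((1 - (r : ℂ) * Complex.exp (θ * I)) ^ (j + 1))⁻¹).re| ^ (1 / (1 + (j : ℝ))) :=
    (continuous_re.comp hk).abs.rpow_const
      fun _ => Or.inr hp0.le
  have him : Continuous fun θ : ℝ =>
      |(I ^ j * ((1 - (r : ℂ) * Complex.exp (θ * I)) ^ (j + 1))⁻¹).im| ^ (1 / (1 + (j : ℝ))) :=
    (continuous_im.comp hk).abs.rpow_const
      fun _ => Or.inr hp0.le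
  constructor
  · rw [← intervalIntegral.integral_sub (hc.intervalIntegrable _ _) (hre.intervalIntegrable _ _)]
    refine intervalIntegral.integral_mono (by positivity) ((hc.sub hre).intervalIntegrable _ _)
      (him.intervalIntegrable _ _) fun θ => ?_
    beta_reduce
    rw [← norm_I_pow_mul_inv_pow_rpow j, sub_le_iff_le_add']
    exact (Real.rpow_le_rpow (norm_nonneg _) (norm_le_abs_re_add_abs_im _) hp0.le).trans
      (Real.rpow_add_le_add_rpow (abs_nonneg _) (abs_nonneg _) hp0.le hp1)
  · refine intervalIntegral.integral_mono (by positivity) (him.intervalIntegrable _ _)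
      (hc.intervalIntegrable _ _) fun θ => ?_
    beta_reduce
    rw [← norm_I_pow_mul_inv_pow_rpow j]
    exact Real.rpow_le_rpow (abs_nonneg _) (abs_im_le_norm _) hp0.le

lemma harmonic_quasiregular_of_holomorphic {K : ℝ} (hK : 1 ≤ K) {H f : ℂ → ℂ} {s : Set ℂ}
    (hs : IsOpen s) (hH : DifferentiableOn ℂ H s)
    (hf : ∀ z, f z = ((2 * K / (K + 1) : ℝ) : ℂ) * ((H z).re : ℂ) +
      Complex.I * ((2 / (K + 1) : ℝ) : ℂ) * ((H z).im : ℂ)) :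
    ∃ h g : ℂ → ℂ, DifferentiableOn ℂ h s ∧ DifferentiableOn ℂ g s ∧
      (∀ z ∈ s, f z = h z + (starRingEnd ℂ) (g z)) ∧
      ∀ z ∈ s, (‖deriv h z‖ + ‖deriv g z‖) ^ 2 ≤ K * (‖deriv h z‖ ^ 2 - ‖deriv g z‖ ^ 2) := by
  have hK1 : 0 < K + 1 := by linarith
  refine ⟨H, fun z => (((K - 1) / (K + 1) : ℝ) : ℂ) * H z, hH, hH.const_mul _, fun z _ => ?_,
    fun z hz => ?_⟩
  · have e1 : 2 * K / (K + 1) = 1 + (K - 1) / (K + 1) := by field_simp; ring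
    have e2 : 2 / (K + 1) = 1 - (K - 1) / (K + 1) := by field_simp; ring
    rw [hf, map_mul, conj_ofReal, e1, e2]
    generalize (K - 1) / (K + 1) = c
    apply Complex.ext <;> simp <;> ring
  · rw [deriv_const_mul _ (hH.differentiableAt (hs.mem_nhds hz)), norm_mul,
      Complex.norm_of_nonneg (div_nonneg (by linarith) hK1.le)]
    refine le_of_eq ?_
    field_simp
    ring

/-- Sharpness of the logarithmic growth rate: the examples
`f_j = (2K/(K+1)) Re h_j + i (2/(K+1)) Im h_j` with `h_j(z) = e^{ijπ/2}(1-z)^{-(j+1)}`. -/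
theorem log_growth_sharpness
    (j : ℕ) (K : ℝ) (hK : 1 ≤ K) (hj fj : ℂ → ℂ)
    (hhj : ∀ z : ℂ, hj z = Complex.exp ((j : ℂ) * (Real.pi : ℂ) / 2 * Complex.I) *
      ((1 - z) ^ (j + 1))⁻¹)
    (hfj : ∀ z : ℂ, fj z = ((2 * K / (K + 1) : ℝ) : ℂ) * ((hj z).re : ℂ) +
      Complex.I * ((2 / (K + 1) : ℝ) : ℂ) * ((hj z).im : ℂ)) :
    (∃ h g : ℂ → ℂ,
      DifferentiableOn ℂ h (Metric.ball 0 1) ∧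
      DifferentiableOn ℂ g (Metric.ball 0 1) ∧
      (∀ z ∈ Metric.ball (0:ℂ) 1, fj z = h z + (starRingEnd ℂ) (g z)) ∧
      ∀ z ∈ Metric.ball (0:ℂ) 1,
        (‖deriv h z‖ + ‖deriv g z‖) ^ 2 ≤ K * (‖deriv h z‖ ^ 2 - ‖deriv g z‖ ^ 2)) ∧
    MemHp (1 / (1 + (j : ℝ))) (fun z => (fj z).re) ∧
    ∃ c C r₀ : ℝ, 0 < c ∧ c ≤ C ∧ 0 < r₀ ∧ r₀ < 1 ∧
      ∀ r : ℝ, r₀ < r → r < 1 →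
        c * Real.log (1 / (1 - r)) ≤
          (1 / (2 * Real.pi)) * (∫ θ in (0:ℝ)..(2 * Real.pi),
            |(fj ((r : ℂ) * Complex.exp ((θ : ℂ) * Complex.I))).im| ^ (1 / (1 + (j : ℝ)))) ∧
        (1 / (2 * Real.pi)) * (∫ θ in (0:ℝ)..(2 * Real.pi),
            |(fj ((r : ℂ) * Complex.exp ((θ : ℂ) * Complex.I))).im| ^ (1 / (1 + (j : ℝ)))) ≤
          C * Real.log (1 / (1 - r)) := by
  have hK1 : 0 < K + 1 := by linarith
  have hpi := Real.pi_pos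
  have hh : ∀ z, hj z = I ^ j * ((1 - z) ^ (j + 1))⁻¹ := by
    intro z
    rw [hhj, mul_div_assoc, mul_assoc, Complex.exp_nat_mul, exp_pi_div_two_mul_I]
  have hre : ∀ z, (fj z).re = 2 * K / (K + 1) * (hj z).re := by
    intro z
    rw [hfj]
    generalize 2 * K / (K + 1) = a
    generalize 2 / (K + 1) = b
    simp
  have him : ∀ z, (fj z).im = 2 / (K + 1) * (hj z).im := by
    intro z
    rw [hfj]
    generalize 2 * K / (K + 1) = a
    generalize 2 / (K + 1) = b
    simp
  obtain ⟨M, hM0, hM⟩ := exists_integral_re_rpow_le j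
  refine ⟨harmonic_quasiregular_of_holomorphic hK Metric.isOpen_ball ?_ hfj, ?_, ?_⟩
  · rw [funext hh]
    refine (differentiableOn_const _).mul (DifferentiableOn.inv (by fun_prop) fun z hz => ?_)
    refine pow_ne_zero _ fun h => ?_
    rw [← sub_eq_zero.mp h] at hz
    simp at hz
  · refine ⟨((1 / (2 * Real.pi)) * ((2 * K / (K + 1)) ^ (1 / (1 + (j : ℝ))) * M)) ^
      (1 / (1 / (1 + (j : ℝ)))), ?_⟩
    rintro _ ⟨r, ⟨hr0, hr1⟩, rfl⟩
    have hA : 0 ≤ 2 * K / (K + 1) := by positivity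
    have e : ∀ θ : ℝ, ‖(fj ((r : ℂ) * Complex.exp ((θ : ℂ) * Complex.I))).re‖ ^ (1 / (1 + (j : ℝ)))
        = (2 * K / (K + 1)) ^ (1 / (1 + (j : ℝ))) *
          |(I ^ j * ((1 - (r : ℂ) * Complex.exp (θ * I)) ^ (j + 1))⁻¹).re| ^
            (1 / (1 + (j : ℝ))) := by
      intro θ
      rw [Real.norm_eq_abs, hre, hh, abs_mul, abs_of_nonneg hA, Real.mul_rpow hA (abs_nonneg _)]
    simp only [Mp, e]
    rw [intervalIntegral.integral_const_mul]
    have hint0 : 0 ≤ ∫ θ in (0 : ℝ)..(2 * Real.pi),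
        |(I ^ j * ((1 - (r : ℂ) * Complex.exp (θ * I)) ^ (j + 1))⁻¹).re| ^ (1 / (1 + (j : ℝ))) :=
      intervalIntegral.integral_nonneg (by positivity) fun θ _ => by positivity
    have := hM r hr0 hr1
    gcongr
  · set B := (2 / (K + 1)) ^ (1 / (1 + (j : ℝ))) with hBdef
    have hB0 : 0 < 2 / (K + 1) := by positivity
    have hB : 0 < B := by positivity
    have e : ∀ r θ : ℝ, |(fj ((r : ℂ) * Complex.exp ((θ : ℂ) * Complex.I))).im| ^
          (1 / (1 + (j : ℝ))) = B *
          |(I ^ j * ((1 - (r : ℂ) * Complex.exp (θ * I)) ^ (j + 1))⁻¹).im| ^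
            (1 / (1 + (j : ℝ))) := by
      intro r θ
      rw [him, hh, abs_mul, abs_of_pos hB0, Real.mul_rpow hB0.le (abs_nonneg _)]
    simp only [e, intervalIntegral.integral_const_mul]
    have hc : 0 < 1 / (2 * Real.pi) * B := by positivity
    refine ⟨1 / (2 * Real.pi) * B, 1 / (2 * Real.pi) * B * (8 * Real.pi),
      1 - Real.exp (-(M + Real.pi)), hc, ?_, ?_, ?_, fun r hr hr1 => ?_⟩
    · nlinarith [Real.pi_gt_three]
    · rw [sub_pos, Real.exp_lt_one_iff]
      linarith
    · linarith [Real.exp_pos (-(M + Real.pi))]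
    · have hexp : Real.exp (-(M + Real.pi)) < 1 := by
        rw [Real.exp_lt_one_iff]
        linarith
      have hr0 : 0 ≤ r := by linarith
      have hlog : M + Real.pi ≤ Real.log (1 / (1 - r)) := by
        rw [one_div, Real.log_inv, le_neg]
        exact ((Real.log_lt_iff_lt_exp (by linarith)).mpr (by linarith)).le
      obtain ⟨h1, h2⟩ := integral_inv_norm_one_sub_circle hr0 hr1
      obtain ⟨h3, h4⟩ := integral_im_rpow_bounds j hr0 hr1
      have h5 := hM r hr0 hr1
      rw [← mul_assoc, mul_assoc (1 / (2 * Real.pi) * B)]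
      constructor
      · gcongr
        linarith
      · gcongr
        nlinarith
end

section
/- Let K ≥ 1, K' ≥ 0, 0 < p < 1, and let f = u + iv be a harmonic (K,K')-quasiregular mapping on the unit disk 𝔻 with v(0) = 0, written f = h + conj(g) with h, g holomorphic and g(0) = 0. If the gradient of u satisfies |∇u| = |h' + g'| ∈ H^p_g, i.e. sup_{0 ≤ r < 1} M_p(r, h' + g') < ∞, then both v and f belong to h^q, where q = p/(1 − p). -/
open Complex MeasureTheory Set

open scoped ENNReal NNReal

/-- The Cauchy–Schwarz inequality for the Lebesgue integral. -/
theorem sq_lintegral_mul_le {X : Type*} [MeasurableSpace X] (μ : Measure X) {f g : X → ℝ≥0∞}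
    (hf : AEMeasurable f μ) (hg : AEMeasurable g μ) :
    (∫⁻ x, f x * g x ∂μ) ^ 2 ≤ (∫⁻ x, f x ^ 2 ∂μ) * ∫⁻ x, g x ^ 2 ∂μ := by
  have h := ENNReal.lintegral_mul_le_Lp_mul_Lq μ Real.HolderConjugate.two_two hf hg
  simp only [Pi.mul_apply, ENNReal.rpow_two] at h
  have e : ∀ a : ℝ≥0∞, (a ^ (1 / 2 : ℝ)) ^ 2 = a := fun a => by
    rw [← ENNReal.rpow_natCast, ← ENNReal.rpow_mul]; norm_num
  calc _ ≤ _ := pow_le_pow_left' h 2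
    _ = _ := by rw [mul_pow, e, e]

/-- The self-improving step of the `T T*` argument. -/
theorem lintegral_sq_kernel_le_step {X : Type*} [MeasurableSpace X] (μ : Measure X) [SFinite μ]
    {k : X → X → ℝ≥0∞} (hk : Measurable (Function.uncurry k)) {C A : ℝ≥0}
    (hC : ∀ x y, ∫⁻ t, k x t * k y t ∂μ ≤ C * (k x y + k y x))
    (hA : ∀ f : X → ℝ≥0∞, Measurable f → ∫⁻ x, f x ^ 2 ∂μ ≠ ⊤ →
      ∫⁻ x, (∫⁻ t, k x t * f t ∂μ) ^ 2 ∂μ ≤ (A ^ 2 : ℝ≥0) * ∫⁻ x, f x ^ 2 ∂μ)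
    {f : X → ℝ≥0∞} (hf : Measurable f) (hI : ∫⁻ x, f x ^ 2 ∂μ ≠ ⊤) :
    ∫⁻ x, (∫⁻ t, k x t * f t ∂μ) ^ 2 ∂μ ≤ (2 * C * A : ℝ≥0) * ∫⁻ x, f x ^ 2 ∂μ := by
  have hmeas : ∀ φ : X → ℝ≥0∞, Measurable φ → Measurable fun x => ∫⁻ t, k x t * φ t ∂μ :=
    fun φ hφ => Measurable.lintegral_prod_right (hk.mul (hφ.comp measurable_snd))
  have hkl : ∀ x, Measurable fun t => k x t := fun x => hk.comp measurable_prodMk_left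
  have hkr : ∀ t, Measurable fun x => k x t := fun t => hk.comp measurable_prodMk_right
  set g : X → ℝ≥0∞ := fun x => ∫⁻ t, k x t * f t ∂μ with hg_def
  have hg : Measurable g := hmeas f hf
  set J := ∫⁻ x, g x ^ 2 ∂μ with hJ
  have hJtop : J ≠ ⊤ :=
    ne_top_of_le_ne_top (ENNReal.mul_ne_top ENNReal.coe_ne_top hI) (hA f hf hI)
  set h : X → ℝ≥0∞ := fun t => ∫⁻ x, k x t * g x ∂μ with hh_def
  have hh : Measurable h :=
    Measurable.lintegral_prod_left (hk.mul (hg.comp measurable_fst))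
  have h1 : J = ∫⁻ t, f t * h t ∂μ := by
    calc J = ∫⁻ x, ∫⁻ t, g x * (k x t * f t) ∂μ ∂μ := by
          refine lintegral_congr fun x => ?_
          rw [lintegral_const_mul _ (by fun_prop), sq]
      _ = ∫⁻ t, ∫⁻ x, g x * (k x t * f t) ∂μ ∂μ := by
          refine lintegral_lintegral_swap ?_
          exact ((hg.comp measurable_fst).mul (hk.mul (hf.comp measurable_snd))).aemeasurable
      _ = _ := by
          refine lintegral_congr fun t => ?_
          rw [hh_def, ← lintegral_const_mul _ (by fun_prop)]
          exact lintegral_congr fun x => by ring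
  set Q := ∫⁻ x, g x * ∫⁻ y, k x y * g y ∂μ ∂μ with hQ
  have h2 : ∫⁻ t, h t ^ 2 ∂μ ≤ 2 * C * Q := by
    have m3 : Measurable fun q : X × X × X => k q.2.1 q.1 * g q.2.1 * (k q.2.2 q.1 * g q.2.2) := by
      refine Measurable.mul (Measurable.mul ?_ ?_) (Measurable.mul ?_ ?_)
      · exact hk.comp (by fun_prop : Measurable fun q : X × X × X => (q.2.1, q.1))
      · fun_prop
      · exact hk.comp (by fun_prop : Measurable fun q : X × X × X => (q.2.2, q.1))
      · fun_prop
    calc ∫⁻ t, h t ^ 2 ∂μ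
        = ∫⁻ t, ∫⁻ q : X × X, k q.1 t * g q.1 * (k q.2 t * g q.2) ∂(μ.prod μ) ∂μ := by
          refine lintegral_congr fun t => ?_
          have mt : Measurable fun x => k x t * g x := by fun_prop
          rw [lintegral_prod_mul mt.aemeasurable mt.aemeasurable, sq]
      _ = ∫⁻ q : X × X, ∫⁻ t, k q.1 t * g q.1 * (k q.2 t * g q.2) ∂μ ∂(μ.prod μ) :=
          lintegral_lintegral_swap m3.aemeasurable
      _ ≤ ∫⁻ q : X × X, C * (g q.1 * g q.2 * k q.1 q.2 + g q.1 * g q.2 * k q.2 q.1)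
            ∂(μ.prod μ) := by
          refine lintegral_mono fun q => ?_
          calc ∫⁻ t, k q.1 t * g q.1 * (k q.2 t * g q.2) ∂μ
              = ∫⁻ t, g q.1 * g q.2 * (k q.1 t * k q.2 t) ∂μ :=
                lintegral_congr fun t => by ring
            _ = g q.1 * g q.2 * ∫⁻ t, k q.1 t * k q.2 t ∂μ :=
                lintegral_const_mul _ (by fun_prop)
            _ ≤ g q.1 * g q.2 * (C * (k q.1 q.2 + k q.2 q.1)) := by gcongr; exact hC _ _
            _ = _ := by ring
      _ = C * (Q + Q) := by
          have hk' : Measurable fun q : X × X => k q.2 q.1 := hk.comp measurable_swap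
          have hk1 : Measurable fun q : X × X => k q.1 q.2 := hk
          have ma : Measurable fun q : X × X => g q.1 * g q.2 * k q.1 q.2 := by fun_prop
          have mb : Measurable fun q : X × X => g q.1 * g q.2 * k q.2 q.1 := by fun_prop
          have hx : ∀ x, ∫⁻ y, g x * g y * k x y ∂μ = g x * ∫⁻ y, k x y * g y ∂μ := fun x => by
            rw [← lintegral_const_mul _ (by fun_prop)]
            exact lintegral_congr fun y => by ring
          have ea : ∫⁻ q : X × X, g q.1 * g q.2 * k q.1 q.2 ∂(μ.prod μ) = Q := by
            rw [lintegral_prod _ ma.aemeasurable]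
            exact lintegral_congr hx
          have eb : ∫⁻ q : X × X, g q.1 * g q.2 * k q.2 q.1 ∂(μ.prod μ) = Q := by
            rw [lintegral_prod_symm _ mb.aemeasurable]
            refine lintegral_congr fun x => ?_
            rw [← hx]
            exact lintegral_congr fun y => by ring
          rw [lintegral_const_mul _ (by fun_prop), lintegral_add_left ma, ea, eb]
      _ = _ := by ring
  have h3 : Q ≤ A * J := by
    have := (sq_lintegral_mul_le μ hg.aemeasurable (hmeas g hg).aemeasurable).trans
      (mul_le_mul_right (hA g hg hJtop) _)
    refine (ENNReal.pow_le_pow_left_iff (two_ne_zero)).1 (this.trans_eq ?_)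
    push_cast; ring
  by_cases hJ0 : J = 0
  · rw [hJ0]; exact zero_le
  have h4 : J * J ≤ J * ((2 * C * A : ℝ≥0) * ∫⁻ x, f x ^ 2 ∂μ) := by
    calc J * J = (∫⁻ t, f t * h t ∂μ) ^ 2 := by rw [← h1, sq]
      _ ≤ (∫⁻ x, f x ^ 2 ∂μ) * ∫⁻ x, h x ^ 2 ∂μ :=
        sq_lintegral_mul_le μ hf.aemeasurable hh.aemeasurable
      _ ≤ (∫⁻ x, f x ^ 2 ∂μ) * (2 * C * (A * J)) := by gcongr; exact h2.trans (by gcongr)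
      _ = _ := by push_cast; ring
  exact (ENNReal.mul_le_mul_iff_right hJ0 hJtop).1 h4

/-- A bounded positive kernel whose `T T*` kernel is dominated by a multiple of its symmetrization
acts on `L²` with a norm controlled by that multiple only. -/
theorem lintegral_sq_kernel_le {X : Type*} [MeasurableSpace X] (μ : Measure X) [IsFiniteMeasure μ]
    {k : X → X → ℝ≥0∞} (hk : Measurable (Function.uncurry k)) {B C : ℝ≥0}
    (hB : ∀ x y, k x y ≤ B)
    (hC : ∀ x y, ∫⁻ t, k x t * k y t ∂μ ≤ C * (k x y + k y x))
    {f : X → ℝ≥0∞} (hf : Measurable f) (hI : ∫⁻ x, f x ^ 2 ∂μ ≠ ⊤) :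
    ∫⁻ x, (∫⁻ t, k x t * f t ∂μ) ^ 2 ∂μ ≤ ((2 * C + 1) ^ 2 : ℝ≥0) * ∫⁻ x, f x ^ 2 ∂μ := by
  let S : Set ℝ≥0 := {A | ∀ f : X → ℝ≥0∞, Measurable f → ∫⁻ x, f x ^ 2 ∂μ ≠ ⊤ →
      ∫⁻ x, (∫⁻ t, k x t * f t ∂μ) ^ 2 ∂μ ≤ (A ^ 2 : ℝ≥0) * ∫⁻ x, f x ^ 2 ∂μ}
  have hne : S.Nonempty := by
    refine ⟨B * (μ univ).toNNReal, fun f hf _ => ?_⟩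
    have hμ : ((μ univ).toNNReal : ℝ≥0∞) = μ univ := ENNReal.coe_toNNReal (measure_ne_top _ _)
    calc ∫⁻ x, (∫⁻ t, k x t * f t ∂μ) ^ 2 ∂μ
        ≤ ∫⁻ x, (B ^ 2 * μ univ) * ∫⁻ x, f x ^ 2 ∂μ ∂μ := by
          refine lintegral_mono fun x => ?_
          refine (sq_lintegral_mul_le μ (hk.comp measurable_prodMk_left).aemeasurable
            hf.aemeasurable).trans ?_
          gcongr
          rw [← lintegral_const]
          exact lintegral_mono fun t => by gcongr; exact hB _ _
      _ = _ := by rw [lintegral_const]; push_cast; rw [hμ]; ring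
  have hstep : ∀ A ∈ S, NNReal.sqrt (2 * C * A) ∈ S := fun A hA f hf hI => by
    rw [NNReal.sq_sqrt]
    exact lintegral_sq_kernel_le_step μ hk hC hA hf hI
  set a := sInf S with ha
  have hle : ∀ A ∈ S, a ≤ A := fun A hA => csInf_le (OrderBot.bddBelow S) hA
  have h1 : ∀ A ∈ S, a ^ 2 ≤ 2 * C * A := fun A hA => by
    have := hle _ (hstep A hA)
    rwa [NNReal.le_sqrt_iff_sq_le] at this
  have h2 : a < 2 * C + 1 := by
    by_contra! hcon
    obtain ⟨A, hA, hAlt⟩ := exists_lt_of_csInf_lt hne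
      (show sInf S < a * (1 + 1 / (2 * (2 * C + 1))) by
        rw [← ha]
        have : 0 < a := lt_of_lt_of_le (by positivity) hcon
        calc a = a * 1 := (mul_one a).symm
          _ < _ := by gcongr; simp)
    have h3 := h1 A hA
    have ha0 : (0 : ℝ) < a := lt_of_lt_of_le (by positivity) (NNReal.coe_le_coe.2 hcon)
    have hcon' : 2 * (C : ℝ) + 1 ≤ a := by exact_mod_cast hcon
    have h3' : (a : ℝ) ^ 2 ≤ 2 * C * A := by exact_mod_cast h3
    have hA' : (A : ℝ) < a * (1 + 1 / (2 * (2 * C + 1))) := by exact_mod_cast hAlt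
    have hC0 : (0 : ℝ) ≤ C := C.2
    have h5 : (a : ℝ) ^ 2 ≤ a * (2 * C * (1 + 1 / (2 * (2 * C + 1)))) := by
      nlinarith
    have h6 : (a : ℝ) ≤ 2 * C * (1 + 1 / (2 * (2 * C + 1))) := by nlinarith
    have h7 : 2 * (C : ℝ) * (1 / (2 * (2 * C + 1))) ≤ 1 / 2 := by
      rw [mul_one_div, div_le_div_iff₀ (by positivity) (by positivity)]; linarith
    nlinarith
  obtain ⟨A, hA, hAlt⟩ := exists_lt_of_csInf_lt hne h2
  refine (hA f hf hI).trans ?_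
  gcongr

theorem norm_circleMap_zero_one (θ : ℝ) : ‖circleMap 0 1 θ‖ = 1 := by simp

/-- The Poisson kernel of the unit disk is nonnegative. -/
theorem poissonKernel_circleMap_nonneg {z : ℂ} (hz : ‖z‖ < 1) (θ : ℝ) :
    0 ≤ poissonKernel 0 z (circleMap 0 1 θ) := by
  rw [poissonKernel_def]
  have : ‖z‖ ^ 2 ≤ 1 := by nlinarith [norm_nonneg z]
  refine div_nonneg ?_ (by positivity)
  simpa using this

theorem circleMap_sub_ne_zero {z : ℂ} (hz : ‖z‖ < 1) (θ : ℝ) : circleMap 0 1 θ - z ≠ 0 := by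
  intro h
  rw [sub_eq_zero] at h
  rw [← h, norm_circleMap_zero_one] at hz
  exact lt_irrefl _ hz

theorem continuous_poissonKernel_circleMap {z : ℂ} (hz : ‖z‖ < 1) :
    Continuous fun θ => poissonKernel 0 z (circleMap 0 1 θ) := by
  simp only [poissonKernel_def, sub_zero]
  refine Continuous.div (by fun_prop) (by fun_prop) fun θ => ?_
  have := circleMap_sub_ne_zero hz θ
  positivity

/-- Powers of the modulus of a zero-free holomorphic function are dominated by their Poisson
integral. -/
theorem norm_rpow_le_poisson_of_ne_zero {H : ℂ → ℂ} (hc : ContinuousOn H (Metric.closedBall 0 1))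
    (hd : DifferentiableOn ℂ H (Metric.ball 0 1)) (h0 : ∀ z ∈ Metric.ball (0 : ℂ) 1, H z ≠ 0)
    {s : ℝ} (hs : 0 < s) {z : ℂ} (hz : ‖z‖ < 1) :
    ‖H z‖ ^ s ≤ (2 * Real.pi)⁻¹ * ∫ θ in (0 : ℝ)..2 * Real.pi,
      poissonKernel 0 z (circleMap 0 1 θ) * ‖H (circleMap 0 1 θ)‖ ^ s := by
  have hharm : InnerProductSpace.HarmonicOnNhd (fun z => Real.log ‖H z‖) (Metric.ball 0 1) :=
    fun w hw => AnalyticAt.harmonicAt_log_norm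
      (hd.analyticAt (Metric.isOpen_ball.mem_nhds hw)) (h0 w hw)
  obtain ⟨L, hL, hLre⟩ := hharm.exists_analyticOnNhd_ball_re_eq
  have hE : ∀ w ∈ Metric.ball (0 : ℂ) 1, ‖exp (s * L w)‖ = ‖H w‖ ^ s := fun w hw => by
    have h1 : (L w).re = Real.log ‖H w‖ := hLre hw
    rw [norm_exp, re_ofReal_mul, h1, Real.rpow_def_of_pos (norm_pos_iff.2 (h0 w hw)), mul_comm]
  have key : ∀ t ∈ Ioo (0 : ℝ) 1, ‖H (t * z)‖ ^ s ≤ (2 * Real.pi)⁻¹ * ∫ θ in (0 : ℝ)..2 * Real.pi,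
      poissonKernel 0 z (circleMap 0 1 θ) * ‖H (t * circleMap 0 1 θ)‖ ^ s := by
    intro t ht
    have hmem : ∀ w ∈ Metric.closedBall (0 : ℂ) 1, (t : ℂ) * w ∈ Metric.ball (0 : ℂ) 1 := by
      intro w hw
      rw [mem_closedBall_zero_iff] at hw
      rw [mem_ball_zero_iff, norm_mul, norm_real, Real.norm_of_nonneg ht.1.le]
      nlinarith [ht.1, ht.2, norm_nonneg w]
    have hdc : DiffContOnCl ℂ (fun w => exp (s * L (t * w))) (Metric.ball 0 1) := by
      refine DifferentiableOn.diffContOnCl ?_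
      rw [closure_ball _ one_ne_zero]
      intro w hw
      have := (hL _ (hmem w hw)).differentiableAt
      refine DifferentiableAt.differentiableWithinAt ?_
      refine ((DifferentiableAt.comp w this (by fun_prop)).const_mul (s : ℂ)).cexp
    have hP := hdc.circleAverage_poissonKernel_smul (w := z) (by simpa using hz)
    have hz' : z ∈ Metric.closedBall (0 : ℂ) 1 := by simpa using hz.le
    rw [← hE _ (hmem z hz'), ← hP, Real.circleAverage, norm_smul,
      Real.norm_of_nonneg (by positivity)]
    refine mul_le_mul_of_nonneg_left ?_ (by positivity)
    refine (intervalIntegral.norm_integral_le_integral_norm (by positivity)).trans_eq ?_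
    refine intervalIntegral.integral_congr fun θ _ => ?_
    simp only [Pi.smul_apply', norm_smul]
    rw [hE _ (hmem _ (by simp)), Real.norm_of_nonneg (poissonKernel_circleMap_nonneg hz θ)]
  have hmaps : ∀ (t : Icc (0 : ℝ) 1) (w : ℂ), ‖w‖ ≤ 1 →
      (t : ℂ) * w ∈ Metric.closedBall (0 : ℂ) 1 := by
    intro t w hw
    rw [mem_closedBall_zero_iff, norm_mul, norm_real, Real.norm_of_nonneg t.2.1]
    exact mul_le_one₀ t.2.2 (norm_nonneg _) hw
  have hcl : Continuous fun t : Icc (0 : ℝ) 1 => ‖H (t * z)‖ ^ s := by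
    refine Continuous.rpow_const ?_ fun _ => Or.inr hs.le
    refine (hc.comp_continuous (by fun_prop) fun t => hmaps t z hz.le).norm
  have hcr : Continuous fun t : Icc (0 : ℝ) 1 => (2 * Real.pi)⁻¹ * ∫ θ in (0 : ℝ)..2 * Real.pi,
      poissonKernel 0 z (circleMap 0 1 θ) * ‖H (t * circleMap 0 1 θ)‖ ^ s := by
    refine continuous_const.mul
      (intervalIntegral.continuous_parametric_intervalIntegral_of_continuous' ?_ _ _)
    refine Continuous.mul ((continuous_poissonKernel_circleMap hz).comp continuous_snd) ?_
    refine Continuous.rpow_const ?_ fun _ => Or.inr hs.le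
    exact (hc.comp_continuous (by fun_prop) fun q : Icc (0 : ℝ) 1 × ℝ =>
      hmaps q.1 (circleMap 0 1 q.2) (by simp)).norm
  have hcl' : IsClosed {t : Icc (0 : ℝ) 1 | ‖H (t * z)‖ ^ s ≤ (2 * Real.pi)⁻¹ *
      ∫ θ in (0 : ℝ)..2 * Real.pi,
      poissonKernel 0 z (circleMap 0 1 θ) * ‖H (t * circleMap 0 1 θ)‖ ^ s} := isClosed_le hcl hcr
  have hseq : Filter.Tendsto (fun n : ℕ => (⟨1 - 1 / ((n : ℝ) + 2), by
      have : (0 : ℝ) < n + 2 := by positivity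
      constructor
      · rw [sub_nonneg, div_le_one this]; linarith [n.cast_nonneg (α := ℝ)]
      · simp only [sub_le_self_iff]; positivity⟩ : Icc (0 : ℝ) 1)) Filter.atTop
      (nhds ⟨1, by simp⟩) := by
    rw [tendsto_subtype_rng]
    have h2 : Filter.Tendsto (fun n : ℕ => 1 / ((n : ℝ) + 2)) Filter.atTop (nhds 0) := by
      refine Filter.Tendsto.div_atTop tendsto_const_nhds ?_
      exact Filter.tendsto_atTop_add_const_right _ _ tendsto_natCast_atTop_atTop
    simpa using h2.const_sub 1
  have := hcl'.mem_of_tendsto hseq (Filter.Eventually.of_forall fun n => key _ ⟨?_, ?_⟩)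
  · simpa using this
  · have : (0 : ℝ) < n + 2 := by positivity
    simp only
    rw [sub_pos, div_lt_one this]; linarith [n.cast_nonneg (α := ℝ)]
  · simp only [sub_lt_self_iff]; positivity

/-- A holomorphic function that does not vanish identically near the closed unit disk is the product
of a polynomial with roots in the closed disk and a zero-free holomorphic function. -/
theorem exists_finset_prod_mul_eqOn {G : ℂ → ℂ} (hG : AnalyticOnNhd ℂ G (Metric.closedBall 0 1))
    (hne : ∀ u ∈ Metric.closedBall (0 : ℂ) 1, meromorphicOrderAt G u ≠ ⊤) :
    ∃ (S : Finset ℂ) (n : ℂ → ℕ) (g : ℂ → ℂ), (∀ u ∈ S, ‖u‖ ≤ 1) ∧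
      AnalyticOnNhd ℂ g (Metric.closedBall 0 1) ∧ (∀ z ∈ Metric.closedBall (0 : ℂ) 1, g z ≠ 0) ∧
      EqOn G (fun z => (∏ u ∈ S, (z - u) ^ n u) * g z) (Metric.closedBall 0 1) := by
  set U := Metric.closedBall (0 : ℂ) 1 with hU
  set D := MeromorphicOn.divisor G U with hD
  have hfin : (Function.support D).Finite := D.finiteSupport (isCompact_closedBall 0 1)
  obtain ⟨g, hg, hg0, hGg⟩ := hG.meromorphicOn.extract_zeros_poles (fun u => hne u u.2) hfin
  have hDn : ∀ u, ((D u).toNat : ℤ) = D u := fun u =>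
    Int.toNat_of_nonneg (MeromorphicOn.AnalyticOnNhd.divisor_nonneg hG u)
  have hprod : (∏ᶠ u, (· - u) ^ D u : ℂ → ℂ) =
      fun z => ∏ u ∈ hfin.toFinset, (z - u) ^ (D u).toNat := by
    rw [finprod_eq_prod_of_mulSupport_subset (s := hfin.toFinset)]
    · ext z
      rw [Finset.prod_apply]
      refine Finset.prod_congr rfl fun u _ => ?_
      rw [Pi.pow_apply, ← zpow_natCast, hDn]
    · intro u hu
      rw [Finite.coe_toFinset, Function.mem_support]
      intro h0
      rw [Function.mem_mulSupport, h0, zpow_zero] at hu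
      exact hu rfl
  rw [hprod] at hGg
  have hP : ∀ z ∈ U, AnalyticAt ℂ
      ((fun z => ∏ u ∈ hfin.toFinset, (z - u) ^ (D u).toNat) • g) z := fun z hz => by
    refine AnalyticAt.smul ?_ (hg z hz)
    fun_prop
  refine ⟨hfin.toFinset, fun u => (D u).toNat, g, fun u hu => ?_, hg, fun z hz => hg0 ⟨z, hz⟩, ?_⟩
  · rw [Finite.mem_toFinset] at hu
    have : u ∈ U := D.supportWithinDomain hu
    simpa [hU] using this
  have hball : EqOn G ((fun z => ∏ u ∈ hfin.toFinset, (z - u) ^ (D u).toNat) • g)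
      (Metric.ball 0 1) := by
    intro z hz
    have hzU : z ∈ U := Metric.ball_subset_closedBall hz
    have hacc : AccPt z (Filter.principal U) := by
      refine accPt_iff_frequently_nhdsNE.2 (Filter.Eventually.frequently ?_)
      refine mem_nhdsWithin_of_mem_nhds (Filter.mem_of_superset
        (Metric.isOpen_ball.mem_nhds hz) Metric.ball_subset_closedBall)
    have h1 := (hG z hzU).meromorphicAt.eventuallyEq_nhdsNE_of_eventuallyEq_codiscreteWithin
      (hP z hzU).meromorphicAt hzU hacc hGg
    exact (((hG z hzU).continuousAt.eventuallyEq_nhds_iff_eventuallyEq_nhdsNE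
      (hP z hzU).continuousAt).1 h1).eq_of_nhds
  refine EqOn.of_subset_closure hball hG.continuousOn
    (fun z hz => (hP z hz).continuousAt.continuousWithinAt) Metric.ball_subset_closedBall ?_
  rw [closure_ball _ one_ne_zero]

theorem normSq_one_sub_conj_mul (u z : ℂ) : ‖1 - (starRingEnd ℂ) u * z‖ ^ 2 =
    ‖z - u‖ ^ 2 + (1 - ‖u‖ ^ 2) * (1 - ‖z‖ ^ 2) := by
  simp only [← normSq_eq_norm_sq, normSq_apply]
  simp
  ring

/-- Powers of the modulus of a holomorphic function are dominated by their Poisson integral. -/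
theorem norm_rpow_le_poisson {G : ℂ → ℂ} (hG : AnalyticOnNhd ℂ G (Metric.closedBall 0 1))
    {s : ℝ} (hs : 0 < s) {z : ℂ} (hz : ‖z‖ < 1) :
    ‖G z‖ ^ s ≤ (2 * Real.pi)⁻¹ * ∫ θ in (0 : ℝ)..2 * Real.pi,
      poissonKernel 0 z (circleMap 0 1 θ) * ‖G (circleMap 0 1 θ)‖ ^ s := by
  have hnn : 0 ≤ (2 * Real.pi)⁻¹ * ∫ θ in (0 : ℝ)..2 * Real.pi,
      poissonKernel 0 z (circleMap 0 1 θ) * ‖G (circleMap 0 1 θ)‖ ^ s := by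
    refine mul_nonneg (by positivity) (intervalIntegral.integral_nonneg (by positivity) ?_)
    exact fun θ _ => mul_nonneg (poissonKernel_circleMap_nonneg hz θ) (by positivity)
  by_cases hne : ∀ u ∈ Metric.closedBall (0 : ℂ) 1, meromorphicOrderAt G u ≠ ⊤
  swap
  · push Not at hne
    obtain ⟨u, hu, hut⟩ := hne
    rw [meromorphicOrderAt_eq_top_iff] at hut
    have h1 : G =ᶠ[nhds u] 0 := ((hG u hu).continuousAt.eventuallyEq_nhds_iff_eventuallyEq_nhdsNE
      continuousAt_const).1 hut
    have h2 := hG.eqOn_zero_of_preconnected_of_eventuallyEq_zero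
      (convex_closedBall (0 : ℂ) 1).isPreconnected hu h1
    have h3 : G z = 0 := h2 (by simpa using hz.le)
    rwa [h3, norm_zero, Real.zero_rpow hs.ne']
  obtain ⟨S, n, g, hS, hg, hg0, hGg⟩ := exists_finset_prod_mul_eqOn hG hne
  have hfac : ∀ u ∈ S, ∀ w : ℂ, ‖w‖ ≤ 1 → ‖w - u‖ ≤ ‖1 - (starRingEnd ℂ) u * w‖ := by
    intro u hu w hw
    refine (sq_le_sq₀ (norm_nonneg _) (norm_nonneg _)).1 ?_
    rw [normSq_one_sub_conj_mul]
    have h1 : ‖u‖ ^ 2 ≤ 1 := pow_le_one₀ (norm_nonneg _) (hS u hu)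
    have h2 : ‖w‖ ^ 2 ≤ 1 := pow_le_one₀ (norm_nonneg _) hw
    nlinarith
  set H : ℂ → ℂ := fun z => (∏ u ∈ S, (1 - (starRingEnd ℂ) u * z) ^ n u) * g z with hH
  have hHan : AnalyticOnNhd ℂ H (Metric.closedBall 0 1) := fun z hz => by
    refine AnalyticAt.mul ?_ (hg z hz)
    fun_prop
  have hH0 : ∀ w ∈ Metric.ball (0 : ℂ) 1, H w ≠ 0 := fun w hw => by
    refine mul_ne_zero (Finset.prod_ne_zero_iff.2 fun u hu => pow_ne_zero _ fun h0 => ?_)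
      (hg0 w (Metric.ball_subset_closedBall hw))
    rw [mem_ball_zero_iff] at hw
    have h1 : ‖(starRingEnd ℂ) u * w‖ = 1 := by rw [← sub_eq_zero.1 h0, norm_one]
    rw [norm_mul, RCLike.norm_conj] at h1
    nlinarith [norm_nonneg u, norm_nonneg w, hS u hu]
  have hHG : ∀ w : ℂ, ‖w‖ ≤ 1 → ‖G w‖ ≤ ‖H w‖ := fun w hw => by
    rw [hGg (by simpa using hw : w ∈ Metric.closedBall (0 : ℂ) 1)]
    simp only [hH, norm_mul, norm_prod, norm_pow]
    gcongr with u hu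
    exact hfac u hu w hw
  have hHG' : ∀ w : ℂ, ‖w‖ = 1 → ‖G w‖ = ‖H w‖ := fun w hw => by
    rw [hGg (by simpa using hw.le : w ∈ Metric.closedBall (0 : ℂ) 1)]
    simp only [hH, norm_mul, norm_prod, norm_pow]
    congr 1
    refine Finset.prod_congr rfl fun u _ => ?_
    have := normSq_one_sub_conj_mul u w
    rw [hw, one_pow, sub_self, mul_zero, add_zero] at this
    rw [(sq_eq_sq₀ (norm_nonneg _) (norm_nonneg _)).1 this]
  refine (Real.rpow_le_rpow (norm_nonneg _) (hHG z hz.le) hs.le).trans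
    ((norm_rpow_le_poisson_of_ne_zero hHan.continuousOn
      (hHan.differentiableOn.mono Metric.ball_subset_closedBall) hH0 hs hz).trans_eq ?_)
  congr 1
  refine intervalIntegral.integral_congr fun θ _ => ?_
  rw [hHG' _ (norm_circleMap_zero_one θ)]

/-- The Poisson integral of a Poisson kernel. -/
theorem integral_poissonKernel_mul_poissonKernel {a b : ℂ} (ha : ‖a‖ < 1) (hb : ‖b‖ < 1) :
    (2 * Real.pi)⁻¹ * ∫ θ in (0 : ℝ)..2 * Real.pi,
      poissonKernel 0 a (circleMap 0 1 θ) * poissonKernel 0 b (circleMap 0 1 θ) =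
      (1 - ‖a‖ ^ 2 * ‖b‖ ^ 2) / ‖1 - (starRingEnd ℂ) b * a‖ ^ 2 := by
  have hre : ∀ z : ℂ, ((1 + (starRingEnd ℂ) b * z) / (1 - (starRingEnd ℂ) b * z)).re =
      (1 - ‖z‖ ^ 2 * ‖b‖ ^ 2) / ‖1 - (starRingEnd ℂ) b * z‖ ^ 2 := fun z => by
    rw [div_re, normSq_eq_norm_sq, ← add_div]
    congr 1
    simp only [← normSq_eq_norm_sq, normSq_apply]
    simp
    ring
  have hne : ∀ z : ℂ, ‖z‖ ≤ 1 → 1 - (starRingEnd ℂ) b * z ≠ 0 := fun z hz h0 => by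
    have h1 : ‖(starRingEnd ℂ) b * z‖ = 1 := by rw [← sub_eq_zero.1 h0, norm_one]
    rw [norm_mul, RCLike.norm_conj] at h1
    nlinarith [norm_nonneg b, norm_nonneg z]
  have hharm : InnerProductSpace.HarmonicOnNhd
      (fun z => ((1 + (starRingEnd ℂ) b * z) / (1 - (starRingEnd ℂ) b * z)).re)
      (Metric.closedBall 0 1) := fun z hz => by
    refine AnalyticAt.harmonicAt_re (f := fun z => (1 + (starRingEnd ℂ) b * z) /
      (1 - (starRingEnd ℂ) b * z)) ?_
    refine AnalyticAt.div (by fun_prop) (by fun_prop) (hne z (by simpa using hz))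
  have h := hharm.circleAverage_poissonKernel_smul (w := a) (by simpa using ha)
  rw [hre] at h
  rw [← h, Real.circleAverage, smul_eq_mul]
  congr 1
  refine intervalIntegral.integral_congr fun θ _ => ?_
  simp only [Pi.smul_apply', smul_eq_mul, hre]
  congr 1
  have h1 := normSq_one_sub_conj_mul b (circleMap 0 1 θ)
  rw [norm_circleMap_zero_one, one_pow, sub_self, mul_zero, add_zero] at h1
  rw [norm_circleMap_zero_one, h1, poissonKernel_def]
  simp

theorem poisson_symmetrization_aux {A B : ℂ} (hA : ‖A‖ = 1) (hB : ‖B‖ = 1) {r s : ℝ}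
    (hr : 0 ≤ r) (hrs : r ≤ s) (hs : s < 1) :
    (1 - ‖r * A‖ ^ 2 * ‖s * B‖ ^ 2) / ‖1 - (starRingEnd ℂ) (s * B) * (r * A)‖ ^ 2 ≤
      8 * poissonKernel 0 (r * A) B := by
  have hnr : ‖(r : ℂ) * A‖ = r := by rw [norm_mul, hA, norm_real, Real.norm_of_nonneg hr, mul_one]
  have hns : ‖(s : ℂ) * B‖ = s := by
    rw [norm_mul, hB, norm_real, Real.norm_of_nonneg (hr.trans hrs), mul_one]
  have h1 := normSq_one_sub_conj_mul B (r * A)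
  rw [hB, one_pow, sub_self, zero_mul, add_zero] at h1
  have h1' : ‖B - r * A‖ = ‖1 - (starRingEnd ℂ) B * (r * A)‖ := by
    rw [norm_sub_rev]
    exact ((sq_eq_sq₀ (norm_nonneg _) (norm_nonneg _)).1 h1).symm
  have h2 : ‖(starRingEnd ℂ) (s * B) * (r * A)‖ = s * r := by
    rw [norm_mul, RCLike.norm_conj, hns, hnr]
  have h3 : 1 - s * r ≤ ‖1 - (starRingEnd ℂ) (s * B) * (r * A)‖ := by
    have := norm_sub_norm_le 1 ((starRingEnd ℂ) (s * B) * (r * A))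
    rwa [norm_one, h2] at this
  have h4 : ‖B - r * A‖ ≤ 2 * ‖1 - (starRingEnd ℂ) (s * B) * (r * A)‖ := by
    have e : 1 - (starRingEnd ℂ) B * (r * A) = (1 - (starRingEnd ℂ) (s * B) * (r * A)) -
        ((1 - s : ℝ) : ℂ) * ((starRingEnd ℂ) B * (r * A)) := by
      rw [map_mul, conj_ofReal]; push_cast; ring
    have h5 : ‖((1 - s : ℝ) : ℂ) * ((starRingEnd ℂ) B * (r * A))‖ = (1 - s) * r := by
      rw [norm_mul, norm_mul, RCLike.norm_conj, hnr, hB, norm_real,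
        Real.norm_of_nonneg (by linarith), one_mul]
    rw [h1', e]
    refine (norm_sub_le _ _).trans ?_
    rw [h5]
    nlinarith
  have hpos : 0 < ‖1 - (starRingEnd ℂ) (s * B) * (r * A)‖ := lt_of_lt_of_le (by nlinarith) h3
  have hpos' : 0 < ‖B - r * A‖ := by
    have := norm_sub_norm_le B (r * A)
    rw [hB, hnr] at this
    linarith
  have hsq : ‖B - r * A‖ ^ 2 ≤ 4 * ‖1 - (starRingEnd ℂ) (s * B) * (r * A)‖ ^ 2 := by
    nlinarith
  have hr2 : r ^ 2 ≤ s ^ 2 := by gcongr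
  rw [poissonKernel_def, sub_zero, sub_zero, hnr, hns, hB, mul_div_assoc',
    div_le_div_iff₀ (by positivity) (by positivity)]
  have h6 : 1 - r ^ 2 * s ^ 2 ≤ 2 * (1 - r ^ 2) := by
    nlinarith [mul_le_mul_of_nonneg_left hr2 (sq_nonneg r), sq_nonneg (1 - r ^ 2)]
  have h7 : 0 ≤ 1 - r ^ 2 := by nlinarith
  calc _ ≤ 2 * (1 - r ^ 2) * (4 * ‖1 - (starRingEnd ℂ) (s * B) * (r * A)‖ ^ 2) := by gcongr
    _ = _ := by ring

/-- The Poisson kernel at the product radius is dominated by the symmetrized Poisson kernel. -/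
theorem poisson_symmetrization {A B : ℂ} (hA : ‖A‖ = 1) (hB : ‖B‖ = 1) {r s : ℝ}
    (hr : 0 ≤ r) (hr1 : r < 1) (hs : 0 ≤ s) (hs1 : s < 1) :
    (1 - ‖r * A‖ ^ 2 * ‖s * B‖ ^ 2) / ‖1 - (starRingEnd ℂ) (s * B) * (r * A)‖ ^ 2 ≤
      8 * (poissonKernel 0 (r * A) B + poissonKernel 0 (s * B) A) := by
  have hnn : ∀ {A B : ℂ}, ‖A‖ = 1 → ‖B‖ = 1 → ∀ {r : ℝ}, 0 ≤ r → r < 1 →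
      0 ≤ poissonKernel 0 (r * A) B := by
    intro A B hA hB r hr hr1
    rw [poissonKernel_def, sub_zero, sub_zero, hB, norm_mul, hA, norm_real, Real.norm_of_nonneg hr]
    refine div_nonneg (by nlinarith) (by positivity)
  rcases le_total r s with h | h
  · have := poisson_symmetrization_aux hA hB hr h hs1
    linarith [hnn hB hA hs hs1]
  · have := poisson_symmetrization_aux hB hA hs h hr1
    have e : ‖1 - (starRingEnd ℂ) (s * B) * (r * A)‖ = ‖1 - (starRingEnd ℂ) (r * A) * (s * B)‖ := by
      rw [← RCLike.norm_conj]
      simp only [map_sub, map_one, map_mul, conj_conj]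
      congr 1; ring
    rw [e, mul_comm (‖(r : ℂ) * A‖ ^ 2)]
    linarith [hnn hA hB hr hr1]

/-- Measurable selection of almost maximal points. -/
theorem exists_measurable_le_add_one {T : Type*} [TopologicalSpace T] [CompactSpace T] [Nonempty T]
    [SecondCountableTopology T] [MeasurableSpace T] {u : T → ℝ → ℝ}
    (hu : Continuous (Function.uncurry u)) :
    ∃ ρ : ℝ → T, Measurable ρ ∧ ∀ r θ, u r θ ≤ u (ρ θ) θ + 1 := by
  classical
  let d := TopologicalSpace.denseSeq T
  have hul : ∀ θ, Continuous fun r => u r θ := fun θ => by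
    exact hu.comp (by fun_prop : Continuous fun r : T => (r, θ))
  have hur : ∀ r, Continuous fun θ => u r θ := fun r => by
    exact hu.comp (by fun_prop : Continuous fun θ : ℝ => (r, θ))
  have hex : ∀ θ, ∃ n, ∀ r, u r θ ≤ u (d n) θ + 1 := fun θ => by
    obtain ⟨m, -, hm⟩ := isCompact_univ.exists_isMaxOn univ_nonempty (hul θ).continuousOn
    obtain ⟨n, hn⟩ := (TopologicalSpace.denseRange_denseSeq T).exists_mem_open
      (isOpen_lt continuous_const (hul θ) : IsOpen {r | u m θ - 1 < u r θ}) ⟨m, by simp⟩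
    refine ⟨n, fun r => ?_⟩
    have h1 : u r θ ≤ u m θ := hm (mem_univ r)
    have h2 : u m θ - 1 < u (d n) θ := hn
    linarith
  refine ⟨fun θ => d (Nat.find (hex θ)), ?_, fun r θ => Nat.find_spec (hex θ) r⟩
  refine (measurable_from_nat (f := d)).comp (measurable_find hex fun n => ?_)
  refine IsClosed.measurableSet ?_
  simp only [ofPred_forall]
  exact isClosed_iInter fun r => isClosed_le (hur r) ((hur _).add continuous_const)

theorem circleMap_zero_eq_mul (r θ : ℝ) : circleMap 0 r θ = r * circleMap 0 1 θ := by
  simp [circleMap]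

theorem lintegral_ofReal_Ioc_two_pi (φ : ℝ → ℝ) (hφ : Continuous φ) (h0 : ∀ t, 0 ≤ φ t) :
    ∫⁻ t in Ioc 0 (2 * Real.pi), ENNReal.ofReal (φ t) =
      ENNReal.ofReal (∫ t in (0 : ℝ)..2 * Real.pi, φ t) := by
  rw [intervalIntegral.integral_of_le (by positivity),
    ofReal_integral_eq_lintegral_ofReal (hφ.integrableOn_Ioc) (Filter.Eventually.of_forall h0)]

/-- A linearized form of the `L²` bound for the radial maximal function of `‖G‖ ^ s`. -/
theorem lintegral_sq_norm_rpow_radial_le {G : ℂ → ℂ}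
    (hG : AnalyticOnNhd ℂ G (Metric.closedBall 0 1)) {s : ℝ} (hs : 0 < s) {R : ℝ} (hR : R < 1)
    {ρ : ℝ → ℝ} (hρ : Measurable ρ) (hρR : ∀ θ, ρ θ ∈ Icc 0 R) :
    ∫⁻ θ in Ioc 0 (2 * Real.pi), ENNReal.ofReal (‖G (circleMap 0 (ρ θ) θ)‖ ^ s) ^ 2 ≤
      289 * ∫⁻ θ in Ioc 0 (2 * Real.pi), ENNReal.ofReal (‖G (circleMap 0 1 θ)‖ ^ s) ^ 2 := by
  have hρ1 : ∀ θ, ‖circleMap 0 (ρ θ) θ‖ < 1 := fun θ => by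
    rw [norm_circleMap_zero, abs_of_nonneg (hρR θ).1]
    exact (hρR θ).2.trans_lt hR
  have hGc : Continuous fun θ => ‖G (circleMap 0 1 θ)‖ ^ s := by
    refine Continuous.rpow_const ?_ fun _ => Or.inr hs.le
    exact (hG.continuousOn.comp_continuous (by fun_prop) fun θ => by simp).norm
  set f : ℝ → ℝ≥0∞ := fun θ => ENNReal.ofReal (‖G (circleMap 0 1 θ)‖ ^ s) with hf
  have hfm : Measurable f := hGc.measurable.ennreal_ofReal
  set P : ℝ → ℝ → ℝ := fun x t => poissonKernel 0 (circleMap 0 (ρ x) x) (circleMap 0 1 t) with hP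
  have hP0 : ∀ x t, 0 ≤ P x t := fun x t => poissonKernel_circleMap_nonneg (hρ1 x) t
  have hPc : ∀ x, Continuous (P x) := fun x => continuous_poissonKernel_circleMap (hρ1 x)
  set k : ℝ → ℝ → ℝ≥0∞ := fun x t => ENNReal.ofReal ((2 * Real.pi)⁻¹ * P x t) with hk
  have hkm : Measurable (Function.uncurry k) := by
    refine Measurable.ennreal_ofReal (Measurable.const_mul ?_ _)
    simp only [hP, poissonKernel_def, circleMap]
    fun_prop
  have hI : ∫⁻ θ in Ioc 0 (2 * Real.pi), f θ ^ 2 ≠ ⊤ := by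
    simp only [hf, ← ENNReal.ofReal_pow (Real.rpow_nonneg (norm_nonneg _) s)]
    rw [lintegral_ofReal_Ioc_two_pi (fun t => (‖G (circleMap 0 1 t)‖ ^ s) ^ 2) (hGc.pow 2)
      fun t => by positivity]
    exact ENNReal.ofReal_ne_top
  have hB : ∀ x y, k x y ≤ (((2 * Real.pi)⁻¹ * (1 / (1 - R) ^ 2)).toNNReal : ℝ≥0) := by
    intro x t
    refine ENNReal.ofReal_le_ofReal (mul_le_mul_of_nonneg_left ?_ (by positivity))
    have h1 : 1 - R ≤ ‖circleMap 0 1 t - circleMap 0 (ρ x) x‖ := by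
      have := norm_sub_norm_le (circleMap 0 1 t) (circleMap 0 (ρ x) x)
      rw [norm_circleMap_zero_one, norm_circleMap_zero, abs_of_nonneg (hρR x).1] at this
      linarith [(hρR x).2]
    simp only [hP, poissonKernel_def, sub_zero, norm_circleMap_zero_one, one_pow]
    have h2 : 0 < 1 - R := by linarith
    gcongr
    linarith [sq_nonneg ‖circleMap 0 (ρ x) x‖]
  have hC : ∀ x y, ∫⁻ t in Ioc 0 (2 * Real.pi), k x t * k y t ≤ (8 : ℝ≥0) * (k x y + k y x) := by
    intro x y
    have hpi : 0 ≤ (2 * Real.pi)⁻¹ := by positivity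
    have e1 : ∀ t, k x t * k y t =
        ENNReal.ofReal ((2 * Real.pi)⁻¹ * ((2 * Real.pi)⁻¹ * (P x t * P y t))) := fun t => by
      simp only [hk]
      rw [← ENNReal.ofReal_mul (mul_nonneg hpi (hP0 x t))]
      congr 1; ring
    simp only [e1]
    rw [lintegral_ofReal_Ioc_two_pi
      (fun t => (2 * Real.pi)⁻¹ * ((2 * Real.pi)⁻¹ * (P x t * P y t)))
      (((hPc x).mul (hPc y)).const_mul _ |>.const_mul _) fun t =>
        mul_nonneg hpi (mul_nonneg hpi (mul_nonneg (hP0 x t) (hP0 y t))),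
      intervalIntegral.integral_const_mul, intervalIntegral.integral_const_mul,
      integral_poissonKernel_mul_poissonKernel (hρ1 x) (hρ1 y)]
    have h1 := poisson_symmetrization (norm_circleMap_zero_one x) (norm_circleMap_zero_one y)
      (hρR x).1 ((hρR x).2.trans_lt hR) (hρR y).1 ((hρR y).2.trans_lt hR)
    rw [← circleMap_zero_eq_mul, ← circleMap_zero_eq_mul] at h1
    calc _ ≤ ENNReal.ofReal (8 * ((2 * Real.pi)⁻¹ * P x y + (2 * Real.pi)⁻¹ * P y x)) := by
          refine ENNReal.ofReal_le_ofReal ?_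
          refine (mul_le_mul_of_nonneg_left h1 hpi).trans_eq ?_
          simp only [hP]; ring
      _ = _ := by
          rw [ENNReal.ofReal_mul (by norm_num), ENNReal.ofReal_add (mul_nonneg hpi (hP0 x y))
            (mul_nonneg hpi (hP0 y x))]
          simp [hk]
  have hmain := lintegral_sq_kernel_le (volume.restrict (Ioc 0 (2 * Real.pi))) hkm hB hC hfm hI
  refine (lintegral_mono fun x => ?_).trans (hmain.trans_eq ?_)
  · refine pow_le_pow_left' ?_ 2
    have e2 : ∀ t, k x t * f t = ENNReal.ofReal ((2 * Real.pi)⁻¹ *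
        (P x t * ‖G (circleMap 0 1 t)‖ ^ s)) := fun t => by
      simp only [hk, hf]
      rw [← ENNReal.ofReal_mul (mul_nonneg (by positivity) (hP0 x t))]
      congr 1; ring
    simp only [e2]
    rw [lintegral_ofReal_Ioc_two_pi
      (fun t => (2 * Real.pi)⁻¹ * (P x t * ‖G (circleMap 0 1 t)‖ ^ s))
      (((hPc x).mul hGc).const_mul _) fun t => mul_nonneg (by positivity)
      (mul_nonneg (hP0 x t) (by positivity)), intervalIntegral.integral_const_mul]
    exact ENNReal.ofReal_le_ofReal (norm_rpow_le_poisson hG hs (hρ1 x))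
  · norm_num [hf]

/-- The growth of a holomorphic function in terms of the integral of `‖G‖ ^ p` over the circle. -/
theorem norm_rpow_le_div_one_sub {G : ℂ → ℂ} (hG : AnalyticOnNhd ℂ G (Metric.closedBall 0 1))
    {p M : ℝ} (hp : 0 < p) (hM : ∫ θ in (0 : ℝ)..2 * Real.pi, ‖G (circleMap 0 1 θ)‖ ^ p ≤ M)
    {z : ℂ} (hz : ‖z‖ < 1) : ‖G z‖ ^ p ≤ M / (1 - ‖z‖) := by
  have hpos : 0 < 1 - ‖z‖ := by linarith
  have hGc : Continuous fun θ => ‖G (circleMap 0 1 θ)‖ ^ p := by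
    refine Continuous.rpow_const ?_ fun _ => Or.inr hp.le
    exact (hG.continuousOn.comp_continuous (by fun_prop) fun θ => by simp).norm
  have hP : ∀ θ, poissonKernel 0 z (circleMap 0 1 θ) ≤ 2 / (1 - ‖z‖) := fun θ => by
    have h1 := norm_sub_norm_le (circleMap 0 1 θ) z
    rw [norm_circleMap_zero_one] at h1
    rw [poissonKernel_def, sub_zero, sub_zero, norm_circleMap_zero_one,
      div_le_div_iff₀ (by nlinarith) hpos]
    have h2 : (1 - ‖z‖) ^ 2 ≤ ‖circleMap 0 1 θ - z‖ ^ 2 := by gcongr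
    nlinarith [norm_nonneg z, mul_nonneg (norm_nonneg z) hpos.le]
  have hI : 0 ≤ ∫ θ in (0 : ℝ)..2 * Real.pi, ‖G (circleMap 0 1 θ)‖ ^ p :=
    intervalIntegral.integral_nonneg (by positivity) fun θ _ => by positivity
  refine (norm_rpow_le_poisson hG hp hz).trans ?_
  calc _ ≤ (2 * Real.pi)⁻¹ * ∫ θ in (0 : ℝ)..2 * Real.pi,
        2 / (1 - ‖z‖) * ‖G (circleMap 0 1 θ)‖ ^ p := by
        refine mul_le_mul_of_nonneg_left ?_ (by positivity)
        refine intervalIntegral.integral_mono_on (by positivity)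
          (((continuous_poissonKernel_circleMap hz).mul hGc).intervalIntegrable _ _)
          ((hGc.const_mul _).intervalIntegrable _ _) fun θ _ => ?_
        exact mul_le_mul_of_nonneg_right (hP θ) (by positivity)
    _ = Real.pi⁻¹ * ((∫ θ in (0 : ℝ)..2 * Real.pi, ‖G (circleMap 0 1 θ)‖ ^ p) / (1 - ‖z‖)) := by
        rw [intervalIntegral.integral_const_mul]
        field_simp
    _ ≤ 1 * (M / (1 - ‖z‖)) := by
        gcongr
        exact inv_le_one_of_one_le₀ (by linarith [Real.pi_gt_three])
    _ = _ := one_mul _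

/-- Integration along a radius of a derivative controlled both by a constant and by a power of the
distance to the boundary. -/
theorem norm_le_mul_rpow_of_radial_bounds {Φ : ℂ → ℂ} {e : ℂ} (he : ‖e‖ = 1) {p m N R A : ℝ}
    (hp : 0 < p) (hp1 : p < 1) (hm : 1 ≤ m) (hN : 1 ≤ N) (hR0 : 0 ≤ R) (hR1 : R < 1)
    (hA : ‖Φ 0‖ ≤ A) (hd : ∀ r ∈ Icc 0 R, DifferentiableAt ℂ Φ (r * e))
    (h1 : ∀ r ∈ Icc 0 R, ‖deriv Φ (r * e)‖ ^ p ≤ N ^ 2)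
    (h2 : ∀ r ∈ Icc 0 R, ‖deriv Φ (r * e)‖ ^ p ≤ m / (1 - r)) :
    ‖Φ (R * e)‖ ≤ (A + (2 * m) ^ (1 / p) / (1 / p - 1)) * (N ^ 2) ^ (1 / p - 1) := by
  set α := 1 / p with hα
  have hα1 : 1 < α := by rw [hα, lt_div_iff₀ hp]; linarith
  have hα1' : 0 < α - 1 := by linarith
  set σ := (N ^ 2)⁻¹ with hσ
  have hN0 : 0 < N := by linarith
  have hσ0 : 0 < σ := by positivity
  have hpos : ∀ r ∈ Icc 0 R, 0 < σ + 1 - r := fun r hr => by linarith [hr.2]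
  have hA0 : 0 ≤ A := (norm_nonneg _).trans hA
  have hbd : ∀ r ∈ Icc 0 R, ‖deriv Φ (r * e)‖ ≤ (2 * m) ^ α * (σ + 1 - r) ^ (-α) := by
    intro r hr
    have h3 : ‖deriv Φ (r * e)‖ ^ p ≤ 2 * m / (σ + 1 - r) := by
      rcases le_total (1 - r) σ with h | h
      · refine (h1 r hr).trans ?_
        rw [le_div_iff₀ (hpos r hr)]
        have : N ^ 2 * σ = 1 := mul_inv_cancel₀ (by positivity)
        nlinarith [mul_le_mul_of_nonneg_left h (sq_nonneg N)]
      · refine (h2 r hr).trans ?_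
        have : 0 < 1 - r := by linarith [hr.2]
        rw [div_le_div_iff₀ this (hpos r hr)]
        nlinarith
    have h4 := Real.rpow_le_rpow (by positivity) h3 (by linarith : 0 ≤ α)
    rw [← Real.rpow_mul (norm_nonneg _), hα, mul_one_div_cancel hp.ne', Real.rpow_one,
      Real.div_rpow (by positivity) (hpos r hr).le] at h4
    rwa [Real.rpow_neg (hpos r hr).le, ← div_eq_mul_inv]
  have hray : ∀ r ∈ Icc 0 R, HasDerivAt (fun r : ℝ => Φ (r * e)) (deriv Φ (r * e) * e) r := by
    intro r hr
    have h3 : HasDerivAt (fun r : ℝ => (r : ℂ) * e) (1 * e) r :=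
      (hasDerivAt_id (r : ℂ)).comp_ofReal.mul_const e
    rw [one_mul] at h3
    exact (hd r hr).hasDerivAt.comp r h3
  have hΨ : ∀ r ∈ Icc 0 R, HasDerivAt
      (fun r => A + (2 * m) ^ α / (α - 1) * (σ + 1 - r) ^ (1 - α))
      ((2 * m) ^ α * (σ + 1 - r) ^ (-α)) r := by
    intro r hr
    have h3 : HasDerivAt (fun r => σ + 1 - r) (-1) r := (hasDerivAt_id r).const_sub _
    have h4 := ((h3.rpow_const (p := 1 - α) (Or.inl (hpos r hr).ne')).const_mul
      ((2 * m) ^ α / (α - 1))).const_add A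
    refine h4.congr_deriv ?_
    rw [show 1 - α - 1 = -α by ring]
    field_simp
    ring
  have hmain := image_norm_le_of_norm_deriv_right_le_deriv_boundary'
    (fun r hr => (hray r hr).continuousAt.continuousWithinAt)
    (fun r hr => (hray r (Ico_subset_Icc_self hr)).hasDerivWithinAt)
    (B := fun r => A + (2 * m) ^ α / (α - 1) * (σ + 1 - r) ^ (1 - α))
    (by
      simp only [ofReal_zero, zero_mul]
      have h3 : 0 ≤ (σ + 1 - 0) ^ (1 - α) := Real.rpow_nonneg (by linarith) _
      have h4 : 0 ≤ (2 * m) ^ α / (α - 1) := by positivity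
      nlinarith [mul_nonneg h4 h3])
    (fun r hr => (hΨ r hr).continuousAt.continuousWithinAt)
    (fun r hr => (hΨ r (Ico_subset_Icc_self hr)).hasDerivWithinAt)
    (fun r hr => by
      rw [norm_mul, he, mul_one]
      exact hbd r (Ico_subset_Icc_self hr))
    (right_mem_Icc.2 hR0)
  refine hmain.trans ?_
  have h5 : (σ + 1 - R) ^ (1 - α) ≤ (N ^ 2) ^ (α - 1) := by
    calc (σ + 1 - R) ^ (1 - α) ≤ σ ^ (1 - α) :=
          Real.rpow_le_rpow_of_nonpos hσ0 (by linarith) (by linarith)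
      _ = _ := by
          rw [hσ, Real.inv_rpow (by positivity), ← Real.rpow_neg (by positivity), neg_sub]
  have h6 : 1 ≤ (N ^ 2) ^ (α - 1) := Real.one_le_rpow (one_le_pow₀ hN) hα1'.le
  calc _ ≤ A * (N ^ 2) ^ (α - 1) + (2 * m) ^ α / (α - 1) * (N ^ 2) ^ (α - 1) := by
        gcongr
        exact le_mul_of_one_le_right hA0 h6
    _ = _ := by ring

theorem measurable_uncurry_comp {T : Type*} [TopologicalSpace T] [SecondCountableTopology T]
    [MeasurableSpace T] [OpensMeasurableSpace T] {u : T → ℝ → ℝ}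
    (hu : Continuous (Function.uncurry u)) {ρ : ℝ → T} (hρ : Measurable ρ) :
    Measurable fun θ => u (ρ θ) θ :=
  hu.measurable.comp (hρ.prodMk measurable_id)

theorem lintegral_ofReal_add_one_sq_le {v : ℝ → ℝ} (hv : Measurable v) (hv0 : ∀ t, 0 ≤ v t)
    {m : ℝ} (hm : 0 ≤ m)
    (h : ∫⁻ t in Ioc 0 (2 * Real.pi), ENNReal.ofReal (v t) ^ 2 ≤ ENNReal.ofReal m) :
    ∫⁻ t in Ioc 0 (2 * Real.pi), ENNReal.ofReal ((v t + 1) ^ 2) ≤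
      ENNReal.ofReal (2 * m + 2 * (2 * Real.pi)) := by
  have hvm : Measurable fun t => ENNReal.ofReal (v t) ^ 2 := hv.ennreal_ofReal.pow_const 2
  have h2 : ∀ t, ENNReal.ofReal ((v t + 1) ^ 2) ≤ 2 * ENNReal.ofReal (v t) ^ 2 + 2 := fun t => by
    have h3 : 0 ≤ 2 * v t ^ 2 := by positivity
    have h4 : ENNReal.ofReal (2 * v t ^ 2 + 2) = 2 * ENNReal.ofReal (v t) ^ 2 + 2 := by
      rw [ENNReal.ofReal_add h3 zero_le_two, ENNReal.ofReal_mul zero_le_two,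
        ENNReal.ofReal_pow (hv0 t), ENNReal.ofReal_ofNat]
    rw [← h4]
    exact ENNReal.ofReal_le_ofReal (by nlinarith [sq_nonneg (v t - 1)])
  have hpi : 0 ≤ 2 * Real.pi := by positivity
  refine (lintegral_mono h2).trans ?_
  rw [lintegral_add_left (hvm.const_mul 2), lintegral_const_mul _ hvm, lintegral_const,
    Measure.restrict_apply_univ, Real.volume_Ioc, sub_zero,
    ENNReal.ofReal_add (mul_nonneg zero_le_two hm) (mul_nonneg zero_le_two hpi),
    ENNReal.ofReal_mul (q := m) zero_le_two, ENNReal.ofReal_mul (q := 2 * Real.pi) zero_le_two,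
    ENNReal.ofReal_ofNat]
  exact add_le_add_left (mul_le_mul_right h 2) _

/-- A majorant of `‖G‖ ^ p` along radii with controlled `L²` norm. -/
theorem exists_radial_majorant {G : ℂ → ℂ} (hG : AnalyticOnNhd ℂ G (Metric.closedBall 0 1))
    {p m R : ℝ} (hp : 0 < p) (hm : 0 ≤ m) (hR0 : 0 ≤ R) (hR1 : R < 1)
    (hM : ∫ θ in (0 : ℝ)..2 * Real.pi, ‖G (circleMap 0 1 θ)‖ ^ p ≤ m) :
    ∃ N : ℝ → ℝ, (∀ θ, 1 ≤ N θ) ∧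
      (∀ r ∈ Icc 0 R, ∀ θ, ‖G (circleMap 0 r θ)‖ ^ p ≤ N θ ^ 2) ∧
      ∫⁻ θ in Ioc 0 (2 * Real.pi), ENNReal.ofReal (N θ ^ 2) ≤
        ENNReal.ofReal (2 * (289 * m) + 2 * (2 * Real.pi)) := by
  have hmem : ∀ r ∈ Icc 0 R, ∀ θ, circleMap 0 r θ ∈ Metric.closedBall (0 : ℂ) 1 := by
    intro r hr θ
    rw [mem_closedBall_zero_iff, norm_circleMap_zero, abs_of_nonneg hr.1]
    linarith [hr.2]
  have hne : Nonempty (Icc 0 R) := ⟨⟨0, by simpa using hR0⟩⟩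
  have hsq : ∀ x : ℝ, 0 ≤ x → (x ^ (p / 2)) ^ 2 = x ^ p := fun x hx => by
    rw [← Real.rpow_natCast, ← Real.rpow_mul hx]
    congr 1; push_cast; ring
  have huc : Continuous (Function.uncurry fun (r : Icc 0 R) (θ : ℝ) =>
      ‖G (circleMap 0 r θ)‖ ^ (p / 2)) := by
    refine Continuous.rpow_const ?_ fun _ => Or.inr (by positivity)
    refine (hG.continuousOn.comp_continuous (f := fun q : Icc 0 R × ℝ => circleMap 0 q.1 q.2) ?_
      fun q => hmem _ q.1.2 _).norm
    simp only [circleMap]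
    fun_prop
  obtain ⟨ρ, hρ, hρu⟩ := exists_measurable_le_add_one huc
  have hum : Measurable fun θ => ‖G (circleMap 0 (ρ θ) θ)‖ ^ (p / 2) :=
    measurable_uncurry_comp huc hρ
  have hu0 : ∀ θ, 0 ≤ ‖G (circleMap 0 (ρ θ) θ)‖ ^ (p / 2) := fun θ => by positivity
  refine ⟨fun θ => ‖G (circleMap 0 (ρ θ) θ)‖ ^ (p / 2) + 1, fun θ => by linarith [hu0 θ],
    fun r hr θ => ?_, lintegral_ofReal_add_one_sq_le hum hu0 (by positivity) ?_⟩
  · rw [← hsq _ (norm_nonneg _)]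
    exact pow_le_pow_left₀ (by positivity) (hρu ⟨r, hr⟩ θ) 2
  · refine (lintegral_sq_norm_rpow_radial_le hG (s := p / 2) (by positivity) hR1
      (ρ := fun θ => (ρ θ : ℝ)) (measurable_subtype_coe.comp hρ) (fun θ => (ρ θ).2)).trans ?_
    have hGc : Continuous fun θ => ‖G (circleMap 0 1 θ)‖ ^ p := by
      refine Continuous.rpow_const ?_ fun _ => Or.inr hp.le
      exact (hG.continuousOn.comp_continuous (by fun_prop) fun θ => by simp).norm
    have e1 : ∀ θ, ENNReal.ofReal (‖G (circleMap 0 1 θ)‖ ^ (p / 2)) ^ 2 =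
        ENNReal.ofReal (‖G (circleMap 0 1 θ)‖ ^ p) := fun θ => by
      rw [← ENNReal.ofReal_pow (by positivity), hsq _ (norm_nonneg _)]
    simp only [e1]
    rw [lintegral_ofReal_Ioc_two_pi _ hGc fun _ => by positivity,
      ENNReal.ofReal_mul (by norm_num), ENNReal.ofReal_ofNat]
    exact mul_le_mul_right (ENNReal.ofReal_le_ofReal hM) _

/-- A quantitative form of the Hardy–Littlewood theorem on primitives. -/
theorem integral_norm_rpow_le_of_deriv {Φ : ℂ → ℂ}
    (hΦ : AnalyticOnNhd ℂ Φ (Metric.closedBall 0 1)) {p m R A : ℝ} (hp : 0 < p) (hp1 : p < 1)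
    (hm : 1 ≤ m) (hR0 : 0 ≤ R) (hR1 : R < 1) (hA : ‖Φ 0‖ ≤ A)
    (hM : ∫ θ in (0 : ℝ)..2 * Real.pi, ‖deriv Φ (circleMap 0 1 θ)‖ ^ p ≤ m) :
    ∫ θ in (0 : ℝ)..2 * Real.pi, ‖Φ (circleMap 0 R θ)‖ ^ (p / (1 - p)) ≤
      (A + (2 * m) ^ (1 / p) / (1 / p - 1)) ^ (p / (1 - p)) *
        (2 * (289 * m) + 2 * (2 * Real.pi)) := by
  have hG : AnalyticOnNhd ℂ (deriv Φ) (Metric.closedBall 0 1) := hΦ.deriv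
  set q := p / (1 - p) with hq
  have hq0 : 0 < q := div_pos hp (by linarith)
  set E := A + (2 * m) ^ (1 / p) / (1 / p - 1) with hE
  have hp1' : 0 < 1 / p - 1 := by rw [sub_pos, lt_div_iff₀ hp]; linarith
  have hE0 : 0 ≤ E := by
    have : 0 ≤ A := (norm_nonneg _).trans hA
    positivity
  have hmem : ∀ r ∈ Icc 0 R, ∀ θ, circleMap 0 r θ ∈ Metric.closedBall (0 : ℂ) 1 := by
    intro r hr θ
    rw [mem_closedBall_zero_iff, norm_circleMap_zero, abs_of_nonneg hr.1]
    linarith [hr.2]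
  obtain ⟨N, hN1, hN, hNint⟩ := exists_radial_majorant hG hp (by linarith) hR0 hR1 hM
  have hpt : ∀ θ, ‖Φ (circleMap 0 R θ)‖ ^ q ≤ E ^ q * N θ ^ 2 := fun θ => by
    have h1 : ‖Φ (circleMap 0 R θ)‖ ≤ E * (N θ ^ 2) ^ (1 / p - 1) := by
      rw [circleMap_zero_eq_mul]
      refine norm_le_mul_rpow_of_radial_bounds (norm_circleMap_zero_one θ) hp hp1 hm (hN1 θ) hR0
        hR1 hA (fun r hr => ?_) (fun r hr => ?_) (fun r hr => ?_)
      · rw [← circleMap_zero_eq_mul]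
        exact (hΦ _ (hmem r hr θ)).differentiableAt
      · rw [← circleMap_zero_eq_mul]
        exact hN r hr θ
      · have h2 : ‖circleMap 0 r θ‖ = r := by rw [norm_circleMap_zero, abs_of_nonneg hr.1]
        have := norm_rpow_le_div_one_sub hG hp hM (z := circleMap 0 r θ)
          (by rw [h2]; linarith [hr.2])
        rwa [h2, circleMap_zero_eq_mul] at this
    refine (Real.rpow_le_rpow (norm_nonneg _) h1 hq0.le).trans_eq ?_
    rw [Real.mul_rpow hE0 (by positivity), ← Real.rpow_mul (by positivity)]
    have h3 : (1 / p - 1) * q = 1 := by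
      have : 1 - p ≠ 0 := by linarith
      rw [hq]; field_simp
    rw [h3, Real.rpow_one]
  have hΦc : Continuous fun θ => ‖Φ (circleMap 0 R θ)‖ ^ q := by
    refine Continuous.rpow_const ?_ fun _ => Or.inr hq0.le
    exact (hΦ.continuousOn.comp_continuous (by fun_prop)
      fun θ => hmem R ⟨hR0, le_rfl⟩ θ).norm
  have hEq : 0 ≤ E ^ q := Real.rpow_nonneg hE0 q
  have hm0 : 0 ≤ E ^ q * (2 * (289 * m) + 2 * (2 * Real.pi)) := by positivity
  rw [← ENNReal.ofReal_le_ofReal_iff hm0,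
    ← lintegral_ofReal_Ioc_two_pi _ hΦc fun _ => by positivity]
  refine (lintegral_mono fun θ => ENNReal.ofReal_le_ofReal (hpt θ)).trans ?_
  simp only [ENNReal.ofReal_mul hEq]
  rw [lintegral_const_mul' _ _ ENNReal.ofReal_ne_top]
  exact mul_le_mul_right hNint _

theorem memHp_iff {E : Type*} [NormedAddCommGroup E] {p : ℝ} (hp : 0 < p) {f : ℂ → E} :
    MemHp p f ↔ ∃ M, ∀ r ∈ Ico (0 : ℝ) 1,
      ∫ θ in (0 : ℝ)..2 * Real.pi, ‖f (circleMap 0 r θ)‖ ^ p ≤ M := by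
  have hI : ∀ r : ℝ, 0 ≤ ∫ θ in (0 : ℝ)..2 * Real.pi, ‖f (circleMap 0 r θ)‖ ^ p := fun r =>
    intervalIntegral.integral_nonneg (by positivity) fun θ _ => by positivity
  have hMp : ∀ r : ℝ, Mp p r f =
      (1 / (2 * Real.pi) * ∫ θ in (0 : ℝ)..2 * Real.pi, ‖f (circleMap 0 r θ)‖ ^ p) ^ (1 / p) :=
    fun r => by simp [Mp, circleMap]
  constructor
  · rintro ⟨C, hC⟩
    refine ⟨2 * Real.pi * C ^ p, fun r hr => ?_⟩
    have h1 : Mp p r f ≤ C := hC ⟨r, hr, rfl⟩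
    have h2 : 0 ≤ 1 / (2 * Real.pi) * ∫ θ in (0 : ℝ)..2 * Real.pi, ‖f (circleMap 0 r θ)‖ ^ p :=
      mul_nonneg (by positivity) (hI r)
    rw [hMp] at h1
    have h3 := Real.rpow_le_rpow (Real.rpow_nonneg h2 _) h1 hp.le
    rw [← Real.rpow_mul h2, one_div_mul_cancel hp.ne', Real.rpow_one, one_div,
      inv_mul_le_iff₀ (by positivity)] at h3
    exact h3
  · rintro ⟨M, hM⟩
    refine ⟨(1 / (2 * Real.pi) * M) ^ (1 / p), ?_⟩
    rintro _ ⟨r, hr, rfl⟩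
    simp only [hMp]
    exact Real.rpow_le_rpow (mul_nonneg (by positivity) (hI r))
      (mul_le_mul_of_nonneg_left (hM r hr) (by positivity)) (by positivity)

theorem circleMap_zero_mem_ball {r : ℝ} (hr : r ∈ Ico (0 : ℝ) 1) (θ : ℝ) :
    circleMap 0 r θ ∈ Metric.ball (0 : ℂ) 1 := by
  rw [mem_ball_zero_iff, norm_circleMap_zero, abs_of_nonneg hr.1]
  exact hr.2

theorem continuous_norm_rpow_circleMap {E : Type*} [NormedAddCommGroup E] {f : ℂ → E}
    (hf : ContinuousOn f (Metric.ball 0 1)) {p : ℝ} (hp : 0 < p) {r : ℝ}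
    (hr : r ∈ Ico (0 : ℝ) 1) : Continuous fun θ => ‖f (circleMap 0 r θ)‖ ^ p := by
  refine Continuous.rpow_const ?_ fun _ => Or.inr hp.le
  exact (hf.comp_continuous (continuous_circleMap 0 r) (circleMap_zero_mem_ball hr)).norm

/-- A function dominated by two functions in Hardy-type spaces belongs to the same space. -/
theorem MemHp.of_le_add {E F G : Type*} [NormedAddCommGroup E] [NormedAddCommGroup F]
    [NormedAddCommGroup G] {p : ℝ} (hp : 0 < p) {f : ℂ → E} {f₁ : ℂ → F} {f₂ : ℂ → G}
    (hf : ContinuousOn f (Metric.ball 0 1)) (hf₁ : ContinuousOn f₁ (Metric.ball 0 1))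
    (hf₂ : ContinuousOn f₂ (Metric.ball 0 1)) {C : ℝ} (hC : 0 ≤ C)
    (hle : ∀ z ∈ Metric.ball (0 : ℂ) 1, ‖f z‖ ≤ C * (‖f₁ z‖ + ‖f₂ z‖))
    (h₁ : MemHp p f₁) (h₂ : MemHp p f₂) : MemHp p f := by
  obtain ⟨M₁, hM₁⟩ := (memHp_iff hp).1 h₁
  obtain ⟨M₂, hM₂⟩ := (memHp_iff hp).1 h₂
  refine (memHp_iff hp).2 ⟨(C * 2) ^ p * (M₁ + M₂), fun r hr => ?_⟩
  have hc₁ := continuous_norm_rpow_circleMap hf₁ hp hr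
  have hc₂ := continuous_norm_rpow_circleMap hf₂ hp hr
  have hC2 : 0 ≤ C * 2 := by positivity
  have hpt : ∀ θ, ‖f (circleMap 0 r θ)‖ ^ p ≤
      (C * 2) ^ p * (‖f₁ (circleMap 0 r θ)‖ ^ p + ‖f₂ (circleMap 0 r θ)‖ ^ p) := fun θ => by
    set a := ‖f₁ (circleMap 0 r θ)‖
    set b := ‖f₂ (circleMap 0 r θ)‖
    have ha : 0 ≤ a := norm_nonneg _
    have hb : 0 ≤ b := norm_nonneg _
    have h3 : ‖f (circleMap 0 r θ)‖ ≤ C * 2 * max a b := by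
      refine (hle _ (circleMap_zero_mem_ball hr θ)).trans ?_
      rw [mul_assoc]
      refine mul_le_mul_of_nonneg_left ?_ hC
      linarith [le_max_left a b, le_max_right a b]
    refine (Real.rpow_le_rpow (norm_nonneg _) h3 hp.le).trans ?_
    rw [Real.mul_rpow hC2 (le_max_of_le_left ha)]
    refine mul_le_mul_of_nonneg_left ?_ (Real.rpow_nonneg hC2 p)
    rcases le_total a b with h | h
    · rw [max_eq_right h]
      linarith [Real.rpow_nonneg ha p]
    · rw [max_eq_left h]
      linarith [Real.rpow_nonneg hb p]
  refine (intervalIntegral.integral_mono_on (by positivity)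
    ((continuous_norm_rpow_circleMap hf hp hr).intervalIntegrable _ _)
    (((hc₁.add hc₂).const_mul _).intervalIntegrable _ _) fun θ _ => hpt θ).trans ?_
  simp only [Pi.add_apply]
  rw [intervalIntegral.integral_const_mul,
    intervalIntegral.integral_add (hc₁.intervalIntegrable _ _) (hc₂.intervalIntegrable _ _)]
  exact mul_le_mul_of_nonneg_left (add_le_add (hM₁ r hr) (hM₂ r hr)) (Real.rpow_nonneg hC2 p)

theorem memHp_const {p : ℝ} (hp : 0 < p) (c : ℂ) : MemHp p fun _ => c :=
  (memHp_iff hp).2 ⟨2 * Real.pi * ‖c‖ ^ p, fun r _ => by simp⟩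

/-- The Hardy–Littlewood theorem: a primitive of a function in `H^p`, `p < 1`, lies in
`H^{p/(1-p)}`. -/
theorem memHp_of_deriv {φ : ℂ → ℂ} (hφ : DifferentiableOn ℂ φ (Metric.ball 0 1)) {p : ℝ}
    (hp : 0 < p) (hp1 : p < 1) (h : MemHp p (deriv φ)) : MemHp (p / (1 - p)) φ := by
  obtain ⟨M, hM⟩ := (memHp_iff hp).1 h
  refine (memHp_iff (div_pos hp (by linarith))).2 ⟨(‖φ 0‖ + (2 * max 1 M) ^ (1 / p) /
    (1 / p - 1)) ^ (p / (1 - p)) * (2 * (289 * max 1 M) + 2 * (2 * Real.pi)), fun r hr => ?_⟩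
  set R := (1 + r) / 2 with hR
  have hRm : R ∈ Ico (0 : ℝ) 1 := ⟨by linarith [hr.1], by linarith [hr.2]⟩
  have hR0 : 0 < R := by linarith [hr.1]
  have hmem : ∀ z ∈ Metric.closedBall (0 : ℂ) 1, (R : ℂ) * z ∈ Metric.ball (0 : ℂ) 1 := by
    intro z hz
    rw [mem_closedBall_zero_iff] at hz
    rw [mem_ball_zero_iff, norm_mul, norm_real, Real.norm_eq_abs, abs_of_pos hR0]
    nlinarith [hRm.2]
  have hφa : AnalyticOnNhd ℂ φ (Metric.ball 0 1) := hφ.analyticOnNhd Metric.isOpen_ball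
  have hΦ : AnalyticOnNhd ℂ (fun z => φ (R * z)) (Metric.closedBall 0 1) := fun z hz =>
    (hφa _ (hmem z hz)).comp (analyticAt_const.mul analyticAt_id)
  have hdc := hφa.deriv.continuousOn
  have key := integral_norm_rpow_le_of_deriv hΦ (m := max 1 M) (R := r / R) (A := ‖φ 0‖) hp hp1
    (le_max_left _ _) (div_nonneg hr.1 hR0.le) (by rw [div_lt_one hR0]; linarith [hr.2])
    (by simp) ?_
  · have e1 : ∀ θ, (R : ℂ) * circleMap 0 (r / R) θ = circleMap 0 r θ := fun θ => by
      have : (R : ℂ) ≠ 0 := by exact_mod_cast hR0.ne'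
      simp only [circleMap, ofReal_div, zero_add]
      field_simp
    simpa only [e1] using key
  · refine le_trans ?_ ((hM R hRm).trans (le_max_right _ _))
    have e2 : ∀ θ, (R : ℂ) * circleMap 0 1 θ = circleMap 0 R θ := fun θ => by simp [circleMap]
    have e3 : ∀ θ, ‖deriv (fun z => φ (R * z)) (circleMap 0 1 θ)‖ =
        R * ‖deriv φ (circleMap 0 R θ)‖ := fun θ => by
      rw [deriv_comp_mul_left, smul_eq_mul, e2, norm_mul, norm_real, Real.norm_eq_abs,
        abs_of_pos hR0]
    have hc := continuous_norm_rpow_circleMap hdc hp hRm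
    simp only [e3, Real.mul_rpow hR0.le (norm_nonneg _)]
    refine intervalIntegral.integral_mono_on (by positivity)
      ((hc.const_mul _).intervalIntegrable _ _) (hc.intervalIntegrable _ _) fun θ _ => ?_
    exact mul_le_of_le_one_left (by positivity) (Real.rpow_le_one hR0.le hRm.2.le hp.le)

/-- The quasiregularity inequality bounds the full derivative by the gradient of the real part. -/
theorem add_norm_le_of_quasiregular {K K' : ℝ} (hK : 1 ≤ K) (hK' : 0 ≤ K') {a b : ℂ}
    (h : (‖a‖ + ‖b‖) ^ 2 ≤ K * (‖a‖ ^ 2 - ‖b‖ ^ 2) + K') :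
    ‖a‖ + ‖b‖ ≤ K * ‖a + b‖ + √K' := by
  have h1 : ‖a‖ - ‖b‖ ≤ ‖a + b‖ := by simpa using norm_sub_norm_le a (-b)
  have h2 := Real.sq_sqrt hK'
  have h3 := Real.sqrt_nonneg K'
  have ha := norm_nonneg a
  have hb := norm_nonneg b
  have h4 : 0 ≤ K * ‖a + b‖ := by positivity
  have h5 : K * (‖a‖ ^ 2 - ‖b‖ ^ 2) ≤ K * ‖a + b‖ * (‖a‖ + ‖b‖) := by
    have : (‖a‖ + ‖b‖) * (‖a‖ - ‖b‖) ≤ (‖a‖ + ‖b‖) * ‖a + b‖ := by gcongr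
    nlinarith
  by_contra! hc
  nlinarith [mul_nonneg h4 h3]

/-- Hardy–Littlewood type theorem: if `|∇u| = |h' + g'| ∈ H^p_g` with `p < 1`,
then `v, f ∈ h^q` with `q = p/(1-p)`. -/
theorem gradient_Hp_implies_hq
    (K K' p : ℝ) (hK : 1 ≤ K) (hK' : 0 ≤ K') (hp0 : 0 < p) (hp1 : p < 1)
    (f h g : ℂ → ℂ)
    (hh : DifferentiableOn ℂ h (Metric.ball 0 1))
    (hg : DifferentiableOn ℂ g (Metric.ball 0 1))
    (hg0 : g 0 = 0)
    (hfdec : ∀ z ∈ Metric.ball (0:ℂ) 1, f z = h z + (starRingEnd ℂ) (g z))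
    (hqr : ∀ z ∈ Metric.ball (0:ℂ) 1,
      (‖deriv h z‖ + ‖deriv g z‖) ^ 2 ≤ K * (‖deriv h z‖ ^ 2 - ‖deriv g z‖ ^ 2) + K')
    (hv0 : (f 0).im = 0)
    (hgrad : MemHp p (fun z => deriv h z + deriv g z)) :
    MemHp (p / (1 - p)) (fun z => (f z).im) ∧ MemHp (p / (1 - p)) f := by
  have hq0 : 0 < p / (1 - p) := div_pos hp0 (by linarith)
  have hhd : ContinuousOn (deriv h) (Metric.ball 0 1) :=
    (hh.analyticOnNhd Metric.isOpen_ball).deriv.continuousOn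
  have hgd : ContinuousOn (deriv g) (Metric.ball 0 1) :=
    (hg.analyticOnNhd Metric.isOpen_ball).deriv.continuousOn
  have hbound : ∀ z ∈ Metric.ball (0 : ℂ) 1, ‖deriv h z‖ + ‖deriv g z‖ ≤
      K * (‖deriv h z + deriv g z‖ + ‖((√K' : ℝ) : ℂ)‖) := fun z hz => by
    have h1 := add_norm_le_of_quasiregular hK hK' (hqr z hz)
    have h2 := Real.sqrt_nonneg K'
    rw [norm_real, Real.norm_eq_abs, abs_of_nonneg h2]
    nlinarith
  have hH : MemHp (p / (1 - p)) h := memHp_of_deriv hh hp0 hp1 <|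
    MemHp.of_le_add hp0 hhd (hhd.add hgd) continuousOn_const (zero_le_one.trans hK)
      (fun z hz => (le_add_of_nonneg_right (norm_nonneg _)).trans (hbound z hz)) hgrad
      (memHp_const hp0 _)
  have hG : MemHp (p / (1 - p)) g := memHp_of_deriv hg hp0 hp1 <|
    MemHp.of_le_add hp0 hgd (hhd.add hgd) continuousOn_const (zero_le_one.trans hK)
      (fun z hz => (le_add_of_nonneg_left (norm_nonneg _)).trans (hbound z hz)) hgrad
      (memHp_const hp0 _)
  have hfc : ContinuousOn f (Metric.ball 0 1) :=
    (hh.continuousOn.add (continuous_conj.comp_continuousOn hg.continuousOn)).congr hfdec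
  have hfle : ∀ z ∈ Metric.ball (0 : ℂ) 1, ‖f z‖ ≤ 1 * (‖h z‖ + ‖g z‖) := fun z hz => by
    rw [one_mul, hfdec z hz, ← RCLike.norm_conj (g z)]
    exact norm_add_le _ _
  refine ⟨MemHp.of_le_add hq0 (continuous_im.comp_continuousOn hfc) hh.continuousOn
    hg.continuousOn zero_le_one (fun z hz => ?_) hH hG,
    MemHp.of_le_add hq0 hfc hh.continuousOn hg.continuousOn zero_le_one hfle hH hG⟩
  exact (abs_im_le_norm _).trans (hfle z hz)
end

section
/- For every p ≥ 2 and every z ∈ ℂ, one has |Im z|^p ≤ a_p |Re z|^p − b_p Φ_p(z), where a_p = cot^p(π/(2p)) and b_p = 2 cos^p(π/(2p)) csc(π/p). -/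
/-- Auxiliary function defining `φ` on `[-π/2, π/2]`. -/
noncomputable def phiAux (p t : ℝ) : ℝ :=
  if Real.pi / 2 - Real.pi / p ≤ |t| then -Real.cos (p * (Real.pi / 2 - |t|))
  else max |Real.cos (p * (Real.pi / 2 - t))| |Real.cos (p * (Real.pi / 2 + t))|

/-- The function `φ` on `[-π, π]` (extended by `φ(t) = φ(π - |t|)` for `π/2 ≤ |t| ≤ π`). -/
noncomputable def phiP (p t : ℝ) : ℝ :=
  if |t| ≤ Real.pi / 2 then phiAux p t else phiAux p (Real.pi - |t|)

/-- The Verbitsky subharmonic function `Φ_p(r e^{it}) = r^p φ(t)`. -/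
noncomputable def PhiP (p : ℝ) (z : ℂ) : ℝ := ‖z‖ ^ p * phiP p (Complex.arg z)

/-- `a_p = cot^p(π/(2p))`. -/
noncomputable def aP (p : ℝ) : ℝ := Real.cot (Real.pi / (2 * p)) ^ p

/-- `b_p = 2 cos^p(π/(2p)) csc(π/p)`. -/
noncomputable def bP (p : ℝ) : ℝ :=
  2 * Real.cos (Real.pi / (2 * p)) ^ p * (Real.sin (Real.pi / p))⁻¹

open Real in
/-- For `p ≥ 2` the quotient `sin ((p - 1) u) / sin ^ (p - 1) u` is decreasing on `(0, π / p)`. -/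
lemma antitoneOn_sin_mul_sin_rpow_neg {p : ℝ} (hp : 2 ≤ p) :
    AntitoneOn (fun u : ℝ => sin ((p - 1) * u) * sin u ^ (-(p - 1))) (Set.Ioo 0 (π / p)) := by
  have hp0 : 0 < p := by linarith
  have hsin : ∀ u ∈ Set.Ioo 0 (π / p), 0 < sin u := fun u hu =>
    sin_pos_of_pos_of_lt_pi hu.1 (hu.2.trans_le (div_le_self pi_pos.le (by linarith)))
  have hderiv : ∀ u ∈ Set.Ioo 0 (π / p),
      HasDerivAt (fun u : ℝ => sin ((p - 1) * u) * sin u ^ (-(p - 1)))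
        (-((p - 1) * sin ((p - 2) * u) * sin u ^ (-(p - 1) - 1))) u := by
    intro u hu
    have hs := hsin u hu
    have h1 : HasDerivAt (fun u : ℝ => sin ((p - 1) * u)) (cos ((p - 1) * u) * ((p - 1) * 1)) u :=
      ((hasDerivAt_id u).const_mul (p - 1)).sin
    have h2 := (hasDerivAt_sin u).rpow_const (p := -(p - 1)) (Or.inl hs.ne')
    refine (h1.mul h2).congr_deriv ?_
    have e1 : sin u ^ (-(p - 1)) = sin u ^ (-(p - 1) - 1) * sin u := by
      rw [← rpow_add_one hs.ne']; congr 1; ring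
    have e2 : sin ((p - 2) * u) = sin ((p - 1) * u) * cos u - cos ((p - 1) * u) * sin u := by
      rw [← sin_sub]; congr 1; ring
    rw [e1, e2]; ring
  refine antitoneOn_of_deriv_nonpos (convex_Ioo _ _)
    (fun u hu => (hderiv u hu).continuousAt.continuousWithinAt)
    (fun u hu => (hderiv u (interior_subset hu)).differentiableAt.differentiableWithinAt)
    (fun u hu => ?_)
  have hu := interior_subset hu
  rw [(hderiv u hu).deriv, neg_nonpos]
  have hpu : u * p < π := (lt_div_iff₀ hp0).1 hu.2
  have hs2 : 0 ≤ sin ((p - 2) * u) :=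
    sin_nonneg_of_nonneg_of_le_pi (mul_nonneg (by linarith) hu.1.le) (by nlinarith [hu.1])
  have := hsin u hu
  have : 0 ≤ p - 1 := by linarith
  positivity

open Real in
lemma half_angle_mem {p : ℝ} (hp : 2 ≤ p) : π / (2 * p) ∈ Set.Ioo 0 (π / p) := by
  have hp0 : 0 < p := by linarith
  have := pi_pos
  exact ⟨by positivity, div_lt_div_of_pos_left pi_pos hp0 (by linarith)⟩

open Real in
lemma sin_pos_cos_pos_of_mem_Ioo_pi_div {p u : ℝ} (hp : 2 ≤ p) (hu : u ∈ Set.Ioo 0 (π / p)) :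
    0 < sin u ∧ 0 < cos u := by
  have h : π / p ≤ π / 2 := div_le_div_of_nonneg_left pi_pos.le two_pos hp
  have := pi_pos
  exact ⟨sin_pos_of_pos_of_lt_pi hu.1 (by linarith [hu.2]),
    cos_pos_of_mem_Ioo ⟨by linarith [hu.1], by linarith [hu.2]⟩⟩

lemma aP_nonneg {p : ℝ} (hp : 2 ≤ p) : 0 ≤ aP p := by
  obtain ⟨hs, hc⟩ := sin_pos_cos_pos_of_mem_Ioo_pi_div hp (half_angle_mem hp)
  rw [aP, Real.cot_eq_cos_div_sin]
  positivity

open Real in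
lemma bP_pos {p : ℝ} (hp : 2 ≤ p) : 0 < bP p := by
  obtain ⟨hs, hc⟩ := sin_pos_cos_pos_of_mem_Ioo_pi_div hp (half_angle_mem hp)
  have h : π / p = 2 * (π / (2 * p)) := by field_simp
  rw [bP, h, sin_two_mul]
  positivity

open Real in
lemma bP_mul_eq_aP {p : ℝ} (hp : 2 ≤ p) :
    bP p * (sin ((p - 1) * (π / (2 * p))) * sin (π / (2 * p)) ^ (-(p - 1))) = aP p := by
  obtain ⟨hs, hc⟩ := sin_pos_cos_pos_of_mem_Ioo_pi_div hp (half_angle_mem hp)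
  have hp0 : p ≠ 0 := by linarith
  have h : π / p = 2 * (π / (2 * p)) := by field_simp
  have h' : (p - 1) * (π / (2 * p)) = π / 2 - π / (2 * p) := by field_simp
  rw [bP, aP, h, h', sin_two_mul, sin_pi_div_two_sub, cot_eq_cos_div_sin, div_rpow hc.le hs.le,
    neg_sub, rpow_sub hs, rpow_one]
  field_simp

open Real in
/-- The derivative of `a tan ^ p u + b cos (p u) / cos ^ p u`. -/
lemma hasDerivAt_tan_rpow_add_cos_mul_cos_rpow_neg (a b p : ℝ) {u : ℝ} (hs : 0 < sin u)
    (hc : 0 < cos u) :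
    HasDerivAt (fun u : ℝ => a * (sin u / cos u) ^ p + b * (cos (p * u) * cos u ^ (-p)))
      (p * cos u ^ (-p - 1) * (a * sin u ^ (p - 1) - b * sin ((p - 1) * u))) u := by
  have h1 := (((hasDerivAt_sin u).div (hasDerivAt_cos u) hc.ne').rpow_const (p := p)
    (Or.inl (div_pos hs hc).ne')).const_mul a
  have h2 : HasDerivAt (fun u : ℝ => cos (p * u)) (-sin (p * u) * (p * 1)) u :=
    ((hasDerivAt_id u).const_mul p).cos
  have h3 := (hasDerivAt_cos u).rpow_const (p := -p) (Or.inl hc.ne')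
  refine (h1.add ((h2.mul h3).const_mul b)).congr_deriv ?_
  simp only [Pi.div_apply]
  have e1 : cos u ^ (-p) = cos u ^ (-p - 1) * cos u := by
    rw [← rpow_add_one hc.ne']; congr 1; ring
  have e2 : (sin u / cos u) ^ (p - 1) = sin u ^ (p - 1) * (cos u ^ (-p - 1) * cos u ^ 2) := by
    rw [div_rpow hs.le hc.le, div_eq_mul_inv, ← rpow_neg hc.le, ← rpow_natCast (cos u) 2,
      ← rpow_add hc]
    congr 2; push_cast; ring
  have e3 : sin ((p - 1) * u) = sin (p * u) * cos u - cos (p * u) * sin u := by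
    rw [← sin_sub]; congr 1; ring
  have e4 : cos u * cos u - sin u * -sin u = 1 := by
    linear_combination sin_sq_add_cos_sq u
  rw [e1, e2, e3, e4]
  field_simp
  ring

open Real in
lemma cos_rpow_le_of_mem_Ioo {p u : ℝ} (hp : 2 ≤ p) (hu : u ∈ Set.Ioo 0 (π / p)) :
    cos u ^ p ≤ aP p * sin u ^ p + bP p * cos (p * u) := by
  set θ := π / (2 * p) with hθ
  have hp0 : p ≠ 0 := by linarith
  have hθm : θ ∈ Set.Ioo 0 (π / p) := half_angle_mem hp
  obtain ⟨hsθ, hcθ⟩ := sin_pos_cos_pos_of_mem_Ioo_pi_div hp hθm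
  have hb := bP_pos hp
  set g : ℝ → ℝ := fun u => aP p * (sin u / cos u) ^ p + bP p * (cos (p * u) * cos u ^ (-p))
  have hg : ∀ v ∈ Set.Ioo 0 (π / p), HasDerivAt g
      (p * cos v ^ (-p - 1) * (aP p * sin v ^ (p - 1) - bP p * sin ((p - 1) * v))) v := by
    intro v hv
    obtain ⟨hs, hc⟩ := sin_pos_cos_pos_of_mem_Ioo_pi_div hp hv
    exact hasDerivAt_tan_rpow_add_cos_mul_cos_rpow_neg _ _ _ hs hc
  have hanti := antitoneOn_sin_mul_sin_rpow_neg hp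
  have heq := bP_mul_eq_aP hp
  have hcancel : ∀ v ∈ Set.Ioo 0 (π / p), bP p * sin ((p - 1) * v) =
      bP p * (sin ((p - 1) * v) * sin v ^ (-(p - 1))) * sin v ^ (p - 1) := by
    intro v hv
    obtain ⟨hs, -⟩ := sin_pos_cos_pos_of_mem_Ioo_pi_div hp hv
    rw [mul_assoc, mul_assoc, ← rpow_add hs, neg_add_cancel, rpow_zero, mul_one]
  have hgθ : g θ = 1 := by
    have h1 : cos (p * θ) = 0 := by
      rw [← cos_pi_div_two]; congr 1; rw [hθ]; field_simp
    simp only [g, h1, aP, ← hθ, cot_eq_cos_div_sin, zero_mul, mul_zero, add_zero]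
    rw [← mul_rpow (by positivity) (by positivity), div_mul_div_cancel₀ hsθ.ne', div_self hcθ.ne',
      one_rpow]
  have hone : 1 ≤ g u := by
    rw [← hgθ]
    rcases le_total u θ with h | h
    · have hsub : Set.Icc u θ ⊆ Set.Ioo 0 (π / p) := Set.Icc_subset_Ioo hu.1 hθm.2
      refine antitoneOn_of_deriv_nonpos (convex_Icc u θ)
        (fun v hv => (hg v (hsub hv)).continuousAt.continuousWithinAt)
        (fun v hv => (hg v (hsub (interior_subset hv))).differentiableAt.differentiableWithinAt)
        (fun v hv => ?_) (Set.left_mem_Icc.2 h) (Set.right_mem_Icc.2 h) h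
      have hv := interior_subset hv
      obtain ⟨hs, hc⟩ := sin_pos_cos_pos_of_mem_Ioo_pi_div hp (hsub hv)
      rw [(hg v (hsub hv)).deriv, hcancel v (hsub hv), ← sub_mul]
      have hle := mul_le_mul_of_nonneg_left (hanti (hsub hv) hθm hv.2) hb.le
      exact mul_nonpos_of_nonneg_of_nonpos (by positivity)
        (mul_nonpos_of_nonpos_of_nonneg (by linarith) (by positivity))
    · have hsub : Set.Icc θ u ⊆ Set.Ioo 0 (π / p) := Set.Icc_subset_Ioo hθm.1 hu.2
      refine monotoneOn_of_deriv_nonneg (convex_Icc θ u)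
        (fun v hv => (hg v (hsub hv)).continuousAt.continuousWithinAt)
        (fun v hv => (hg v (hsub (interior_subset hv))).differentiableAt.differentiableWithinAt)
        (fun v hv => ?_) (Set.left_mem_Icc.2 h) (Set.right_mem_Icc.2 h) h
      have hv := interior_subset hv
      obtain ⟨hs, hc⟩ := sin_pos_cos_pos_of_mem_Ioo_pi_div hp (hsub hv)
      rw [(hg v (hsub hv)).deriv, hcancel v (hsub hv), ← sub_mul]
      have hle := mul_le_mul_of_nonneg_left (hanti hθm (hsub hv) hv.1) hb.le
      exact mul_nonneg (by positivity) (mul_nonneg (by linarith) (by positivity))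
  obtain ⟨hs, hc⟩ := sin_pos_cos_pos_of_mem_Ioo_pi_div hp hu
  have hmul := mul_le_mul_of_nonneg_right hone (rpow_nonneg hc.le p)
  simp only [g, div_rpow hs.le hc.le, rpow_neg hc.le] at hmul
  have hcp : 0 < cos u ^ p := rpow_pos_of_pos hc p
  field_simp at hmul
  linarith

open Real in
lemma cos_rpow_le_of_mem_Icc {p u : ℝ} (hp : 2 ≤ p) (hu : u ∈ Set.Icc 0 (π / p)) :
    cos u ^ p ≤ aP p * sin u ^ p + bP p * cos (p * u) := by
  have hp0 : 0 ≤ p := by linarith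
  have hcl : closure (Set.Ioo 0 (π / p)) = Set.Icc 0 (π / p) :=
    closure_Ioo (div_pos pi_pos (by linarith)).ne
  rw [← hcl] at hu
  refine le_on_closure (fun v hv => cos_rpow_le_of_mem_Ioo hp hv) ?_ ?_ hu
  · exact (continuous_cos.rpow_const fun _ => Or.inr hp0).continuousOn
  · have := continuous_sin.rpow_const fun _ => Or.inr hp0
    exact (by fun_prop : Continuous fun u => aP p * sin u ^ p + bP p * cos (p * u)).continuousOn

open Real in
/-- The inequality on the part of the unit circle with argument in `[-π / 2, π / 2]`. -/
lemma abs_sin_rpow_le_phiAux {p t : ℝ} (hp : 2 ≤ p) (ht : |t| ≤ π / 2) :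
    |sin t| ^ p ≤ aP p * |cos t| ^ p - bP p * phiAux p t := by
  have hp0 : 0 < p := by linarith
  have hpi := pi_pos
  have hdiv : π / p ≤ π / 2 := div_le_div_of_nonneg_left pi_pos.le two_pos hp
  have ht0 := abs_nonneg t
  have hsin : |sin t| = cos (π / 2 - |t|) := by
    rw [cos_pi_div_two_sub, abs_sin_eq_sin_abs_of_abs_le_pi (by linarith)]
  have hcos : |cos t| = sin (π / 2 - |t|) := by
    rw [sin_pi_div_two_sub, cos_abs, abs_of_nonneg (cos_nonneg_of_mem_Icc (abs_le.1 ht))]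
  rw [hsin, hcos, phiAux]
  split_ifs with h
  · have := cos_rpow_le_of_mem_Icc hp (u := π / 2 - |t|) ⟨by linarith, by linarith⟩
    linarith
  · have hend := cos_rpow_le_of_mem_Icc hp (Set.right_mem_Icc.2 (by positivity))
    rw [mul_div_cancel₀ _ hp0.ne', cos_pi] at hend
    have hc : cos (π / 2 - |t|) ^ p ≤ cos (π / p) ^ p := by
      refine rpow_le_rpow (hsin ▸ abs_nonneg _) ?_ hp0.le
      exact cos_le_cos_of_nonneg_of_le_pi (by positivity) (by linarith) (by linarith)
    have hs : sin (π / p) ^ p ≤ sin (π / 2 - |t|) ^ p := by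
      refine rpow_le_rpow (sin_nonneg_of_nonneg_of_le_pi (by positivity) (by linarith)) ?_ hp0.le
      refine sin_le_sin_of_le_of_le_pi_div_two ?_ (by linarith) (by linarith)
      have : 0 ≤ π / p := by positivity
      linarith
    have ha := mul_le_mul_of_nonneg_left hs (aP_nonneg hp)
    have hb := mul_le_mul_of_nonneg_left
      (max_le (abs_cos_le_one (p * (π / 2 - t))) (abs_cos_le_one (p * (π / 2 + t)))) (bP_pos hp).le
    linarith

open Real in
lemma abs_sin_rpow_le_phiP {p t : ℝ} (hp : 2 ≤ p) (ht : |t| ≤ π) :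
    |sin t| ^ p ≤ aP p * |cos t| ^ p - bP p * phiP p t := by
  rw [phiP]
  split_ifs with h
  · exact abs_sin_rpow_le_phiAux hp h
  · have h' : abs (π - |t|) ≤ π / 2 := by
      rw [abs_of_nonneg (by linarith)]; linarith
    have := abs_sin_rpow_le_phiAux hp h'
    rwa [sin_pi_sub, cos_pi_sub, cos_abs, abs_neg, ← abs_sin_eq_sin_abs_of_abs_le_pi ht,
      abs_abs] at this

/-- For `p ≥ 2` and `z ∈ ℂ`: `|Im z|^p ≤ a_p |Re z|^p - b_p Φ_p(z)`. -/
theorem im_rpow_le_aP_re_sub_bP_PhiP (p : ℝ) (hp : 2 ≤ p) (z : ℂ) :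
    |z.im| ^ p ≤ aP p * |z.re| ^ p - bP p * PhiP p z := by
  have h := mul_le_mul_of_nonneg_left (abs_sin_rpow_le_phiP hp (Complex.abs_arg_le_pi z))
    (Real.rpow_nonneg (norm_nonneg z) p)
  rw [← Complex.norm_mul_cos_arg z, ← Complex.norm_mul_sin_arg z, abs_mul, abs_mul, abs_norm,
    Real.mul_rpow (norm_nonneg z) (abs_nonneg _), Real.mul_rpow (norm_nonneg z) (abs_nonneg _),
    PhiP]
  linarith
end
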